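/- arXiv:2009.12959 — 7 statements merged into one kernel-verified Lean document; each statement's English description precedes it below -/
import Mathlib

section
/- There exists γ* > 0, depending only on m, p and h, such that for every convection parameter γ ∈ [0, γ*) the following holds: there is exactly one speed c > 0 for which a finite wavefront with speed c and convection γ exists (this speed is denoted c(γ)), and for c = c(γ) the finite wavefront is unique (recall that the normalization U ≡ 0 on [0,∞) is built into the definition, so uniqueness up to translations becomes plain uniqueness). -/
open Set Filter Topology

/-- The flux `φ(ξ) := |(U^m)'(ξ)|^{p-1}` of a profile `U`. -/
noncomputable def flux (m p : ℝ) (U : ℝ → ℝ) (ξ : ℝ) : ℝ :=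
  |deriv (fun x => U x ^ m) ξ| ^ (p - 1)

/-- A finite wavefront with speed `c` and convection parameter `γ`:
a continuous nonincreasing profile `U`, vanishing on `[0,∞)`, with values in `(0,1)`
on `(-∞,0)`, tending to `1` at `-∞`, twice continuously differentiable on `(-∞,0)`,
whose flux tends to `0` as `ξ → 0⁻`, and which satisfies the travelling-wave
equation `-c U' = -φ' - γ φ + h(U)` on `(-∞,0)`. -/
structure FiniteWavefront (m p : ℝ) (h : ℝ → ℝ) (c γ : ℝ) (U : ℝ → ℝ) : Prop where
  cont : Continuous U
  anti : Antitone U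
  eq_zero : ∀ ξ : ℝ, 0 ≤ ξ → U ξ = 0
  pos : ∀ ξ < (0 : ℝ), 0 < U ξ
  lt_one : ∀ ξ < (0 : ℝ), U ξ < 1
  tendsto_one : Tendsto U atBot (nhds 1)
  smooth : ContDiffOn ℝ 2 U (Iio 0)
  flux_zero : Tendsto (flux m p U) (nhdsWithin 0 (Iio 0)) (nhds 0)
  eqn : ∀ ξ < (0 : ℝ),
    -(c * deriv U ξ) = -(deriv (flux m p U) ξ) - γ * flux m p U ξ + h (U ξ)


lemma fw_cmp {y1 y2 d1 d2 : ℝ → ℝ} {a b η η0 : ℝ}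
    (h1 : ∀ t ∈ Icc a b, HasDerivWithinAt y1 (d1 t) (Icc a b) t)
    (h2 : ∀ t ∈ Icc a b, HasDerivWithinAt y2 (d2 t) (Icc a b) t)
    (h0 : y1 a ≤ y2 a + η0) (hη : 0 ≤ η) (hη0 : 0 ≤ η0)
    (H : ∀ t ∈ Ico a b, y2 t ≤ y1 t → d1 t ≤ d2 t + η) :
    ∀ t ∈ Icc a b, y1 t ≤ y2 t + η0 + η * (t - a) := by
  have key : ∀ ε > 0, ∀ t ∈ Icc a b, y1 t ≤ y2 t + η0 + (η + ε) * (t - a) := by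
    intro ε hε
    have hr : ∀ {f : ℝ → ℝ} {d x : ℝ}, x ∈ Ico a b → HasDerivWithinAt f d (Icc a b) x →
        HasDerivWithinAt f d (Ici x) x := by
      intro f d x hx hf
      have := hf.mono (Icc_subset_Icc_left hx.1)
      exact this.mono_of_mem_nhdsWithin (Icc_mem_nhdsGE hx.2)
    refine image_le_of_deriv_right_lt_deriv_boundary' (f' := d1)
      (B' := fun t => d2 t + (η + ε)) (fun t ht => (h1 t ht).continuousWithinAt)
      (fun t ht => hr ht (h1 t (Ico_subset_Icc_self ht))) (by simpa using h0) ?_ ?_ ?_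
    · have : ContinuousOn y2 (Icc a b) := fun t ht => (h2 t ht).continuousWithinAt
      fun_prop
    · intro t ht
      have := hr ht (h2 t (Ico_subset_Icc_self ht))
      have h3 : HasDerivAt (fun t => η0 + (η + ε) * (t - a)) (η + ε) t := by
        have := (((hasDerivAt_id t).sub_const a).const_mul (η + ε)).const_add η0
        simpa using this
      have h4 := this.add h3.hasDerivWithinAt
      refine h4.congr_of_eventuallyEq (Eventually.of_forall fun x => ?_) ?_ <;> simp [add_assoc]
    · intro t ht he
      have : 0 ≤ (η + ε) * (t - a) := mul_nonneg (by linarith) (by linarith [ht.1])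
      have := H t ht (by linarith)
      linarith
  intro t ht
  refine le_of_forall_pos_le_add fun δ hδ => ?_
  have hb : 0 ≤ t - a := by linarith [ht.1]
  have := key (δ / (t - a + 1)) (by positivity) t ht
  have h5 : δ / (t - a + 1) * (t - a) ≤ δ := by
    rw [div_mul_eq_mul_div, div_le_iff₀ (by positivity)]
    nlinarith
  nlinarith

lemma fw_exists_of_approx (G : ℝ → ℝ → ℝ) (L : NNReal)
    (hanti : ∀ t ∈ Icc (0:ℝ) 1, Antitone (G t))
    (hcont : ContinuousOn (fun z : ℝ × ℝ => G z.1 z.2) (Icc 0 1 ×ˢ univ))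
    (happ : ∀ ε > 0, ε ≤ 1 → ∃ (F : ℝ → ℝ → ℝ) (K : NNReal),
      (∀ t ∈ Icc (0:ℝ) 1, LipschitzWith K (F t)) ∧
      ContinuousOn (fun z : ℝ × ℝ => F z.1 z.2) (Icc 0 1 ×ˢ univ) ∧
      (∀ t ∈ Icc (0:ℝ) 1, ∀ x, |F t x| ≤ L) ∧
      (∀ t ∈ Icc (0:ℝ) 1, ∀ x, |F t x - G t x| ≤ ε)) :
    ∃ y : ℝ → ℝ, y 0 = 0 ∧
      ∀ t ∈ Icc (0:ℝ) 1, HasDerivWithinAt y (G t (y t)) (Icc 0 1) t := by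
  have hε : ∀ n : ℕ, (0:ℝ) < 1 / (n + 1) := fun n => by positivity
  have hε1 : ∀ n : ℕ, (1:ℝ) / (n + 1) ≤ 1 := fun n => by
    rw [div_le_one (by positivity)]; linarith [(Nat.cast_nonneg n : (0:ℝ) ≤ n)]
  choose F K hLip hFc hFL hFG using fun n : ℕ => happ (1 / (n + 1)) (hε n) (hε1 n)
  have hsol : ∀ n, ∃ y : ℝ → ℝ, y 0 = 0 ∧
      ∀ t ∈ Icc (0:ℝ) 1, HasDerivWithinAt y (F n t (y t)) (Icc 0 1) t := by
    intro n
    have : IsPicardLindelof (F n) (tmin := 0) (tmax := 1) ⟨0, by simp⟩ 0 L 0 L (K n) :=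
      { lipschitzOnWith := fun t ht => (hLip n t ht).lipschitzOnWith
        continuousOn := fun x _ => (hFc n).comp (f := fun t => (t, x)) (by fun_prop)
          (fun t ht => ⟨ht, mem_univ _⟩)
        norm_le := fun t ht x _ => hFL n t ht x
        mul_max_le := by simp }
    obtain ⟨y, hy0, hy⟩ := this.exists_eq_forall_mem_Icc_hasDerivWithinAt₀
    exact ⟨y, hy0, hy⟩
  choose y hy0 hy using hsol
  have hcmp : ∀ n k, ∀ t ∈ Icc (0:ℝ) 1, y n t ≤ y k t + (1 / ((n:ℝ) + 1) + 1 / ((k:ℝ) + 1)) := by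
    intro n k t ht
    have := fw_cmp (η0 := 0) (η := 1 / ((n:ℝ) + 1) + 1 / ((k:ℝ) + 1)) (hy n) (hy k)
      (by simp [hy0]) (by positivity) le_rfl (fun s hs hle => by
        have hs' := Ico_subset_Icc_self hs
        have h1 := abs_le.1 (hFG n s hs' (y n s))
        have h2 := abs_le.1 (hFG k s hs' (y k s))
        have h3 := hanti s hs' hle
        linarith) t ht
    have h6 : 0 ≤ 1 / ((n:ℝ) + 1) + 1 / ((k:ℝ) + 1) := by positivity
    nlinarith [ht.1, ht.2]
  have hlim0 : Tendsto (fun n : ℕ => 1 / ((n:ℝ) + 1)) atTop (𝓝 0) :=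
    tendsto_one_div_add_atTop_nhds_zero_nat
  have hconv : ∀ t ∈ Icc (0:ℝ) 1, ∃ l, Tendsto (fun n => y n t) atTop (𝓝 l) := by
    intro t ht
    apply cauchySeq_tendsto_of_complete
    refine cauchySeq_of_le_tendsto_0 (fun n => 2 * (1 / ((n:ℝ) + 1))) ?_ ?_
    · intro n k N hn hk
      rw [Real.dist_eq, abs_le]
      have h1 := hcmp n k t ht
      have h2 := hcmp k n t ht
      have h3 : 1 / ((n:ℝ) + 1) ≤ 1 / ((N:ℝ) + 1) := by gcongr
      have h4 : 1 / ((k:ℝ) + 1) ≤ 1 / ((N:ℝ) + 1) := by gcongr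
      constructor <;> linarith
    · simpa using hlim0.const_mul 2
  choose! Y hY using hconv
  have hYn : ∀ n, ∀ t ∈ Icc (0:ℝ) 1, |y n t - Y t| ≤ 1 / ((n:ℝ) + 1) := by
    intro n t ht
    have hl1 : Tendsto (fun k => y k t + (1 / ((n:ℝ) + 1) + 1 / ((k:ℝ) + 1))) atTop
        (𝓝 (Y t + (1 / ((n:ℝ) + 1) + 0))) := (hY t ht).add (hlim0.const_add _)
    have hl2 : Tendsto (fun k : ℕ => y n t + (1 / ((k:ℝ) + 1) + 1 / ((n:ℝ) + 1))) atTop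
        (𝓝 (y n t + (0 + 1 / ((n:ℝ) + 1)))) := (hlim0.add_const _).const_add _
    have h1 := ge_of_tendsto' hl1 (fun k => hcmp n k t ht)
    have h2 := le_of_tendsto_of_tendsto' (hY t ht) hl2 (fun k => hcmp k n t ht)
    rw [abs_le]; constructor <;> linarith
  have hunif : TendstoUniformlyOn y Y atTop (Icc 0 1) := by
    rw [Metric.tendstoUniformlyOn_iff]
    intro ε hε
    filter_upwards [hlim0.eventually (gt_mem_nhds hε)] with n hn t ht
    rw [dist_comm, Real.dist_eq]
    exact (hYn n t ht).trans_lt hn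
  have hyc : ∀ n, ContinuousOn (y n) (Icc 0 1) := fun n t ht => (hy n t ht).continuousWithinAt
  have hYc : ContinuousOn Y (Icc 0 1) := hunif.continuousOn (Eventually.of_forall hyc).frequently
  have hGc : ContinuousOn (fun t => G t (Y t)) (Icc 0 1) :=
    hcont.comp (f := fun t => (t, Y t)) (by fun_prop) (fun t ht => ⟨ht, mem_univ _⟩)
  have hFyc : ∀ n, ContinuousOn (fun t => F n t (y n t)) (Icc 0 1) := fun n => by
    have := hyc n
    exact (hFc n).comp (f := fun t => (t, y n t)) (by fun_prop) (fun t ht => ⟨ht, mem_univ _⟩)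
  have hint : ∀ n, ∀ t ∈ Icc (0:ℝ) 1, ∫ s in (0:ℝ)..t, F n s (y n s) = y n t := by
    intro n t ht
    have hsub : Icc 0 t ⊆ Icc (0:ℝ) 1 := Icc_subset_Icc_right ht.2
    have := intervalIntegral.integral_eq_sub_of_hasDerivAt_of_le ht.1 ((hyc n).mono hsub)
      (f' := fun s => F n s (y n s))
      (fun s hs => (hy n s (hsub (Ioo_subset_Icc_self hs))).hasDerivAt
        (Icc_mem_nhds hs.1 (hs.2.trans_le ht.2)))
      (ContinuousOn.intervalIntegrable (by rw [uIcc_of_le ht.1]; exact (hFyc n).mono hsub))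
    rw [this, hy0, sub_zero]
  have hYint : ∀ t ∈ Icc (0:ℝ) 1, Y t = ∫ s in (0:ℝ)..t, G s (Y s) := by
    intro t ht
    have hsub : uIoc 0 t ⊆ Icc (0:ℝ) 1 := by
      rw [uIoc_of_le ht.1]; exact Ioc_subset_Icc_self.trans (Icc_subset_Icc_right ht.2)
    refine tendsto_nhds_unique (hY t ht) ?_
    simp_rw [← hint _ t ht]
    refine intervalIntegral.tendsto_integral_filter_of_dominated_convergence (fun _ => (L:ℝ))
      (Eventually.of_forall fun n => ?_) (Eventually.of_forall fun n => ?_) (by simp) ?_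
    · exact ((hFyc n).mono hsub).aestronglyMeasurable measurableSet_uIoc
    · exact Eventually.of_forall fun s hs => hFL n s (hsub hs) _
    · refine Eventually.of_forall fun s hs => ?_
      have hs' := hsub hs
      have h1 : Tendsto (fun n => G s (y n s)) atTop (𝓝 (G s (Y s))) := by
        have hc : Continuous (G s) := by
          rw [← continuousOn_univ]
          exact hcont.comp (f := fun x => (s, x)) (by fun_prop) (fun x _ => ⟨hs', mem_univ _⟩)
        exact (hc.tendsto _).comp (hY s hs')
      have h2 : Tendsto (fun n => F n s (y n s) - G s (y n s)) atTop (𝓝 0) :=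
        squeeze_zero_norm (fun n => hFG n s hs' _) hlim0
      simpa using h2.add h1
  refine ⟨Y, by simpa using hYint 0 (by simp), fun t ht => ?_⟩
  have hder : HasDerivWithinAt (fun t => ∫ s in (0:ℝ)..t, G s (Y s)) (G t (Y t)) (Icc 0 1) t := by
    have : Fact (t ∈ Icc (0:ℝ) 1) := ⟨ht⟩
    refine intervalIntegral.integral_hasDerivWithinAt_right
      (ContinuousOn.intervalIntegrable ?_) ?_ (hGc t ht)
    · rw [uIcc_of_le ht.1]; exact hGc.mono (Icc_subset_Icc_right ht.2)
    · exact hGc.stronglyMeasurableAtFilter_nhdsWithin measurableSet_Icc t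
  exact hder.congr hYint (hYint t ht)

lemma fw_rpow_lip {κ ε : ℝ} (hκ : 0 < κ) (hκ1 : κ ≤ 1) (hε : 0 < ε) :
    LipschitzOnWith (Real.toNNReal (κ * ε ^ (κ - 1))) (fun x : ℝ => x ^ κ) (Ici ε) := by
  apply (convex_Ici ε).lipschitzOnWith_of_nnnorm_hasDerivWithin_le
    (f' := fun x => κ * x ^ (κ - 1))
  · intro x hx
    exact (Real.hasDerivAt_rpow_const (Or.inl (hε.trans_le hx).ne')).hasDerivWithinAt
  · intro x hx
    have hx0 : 0 < x := hε.trans_le hx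
    rw [← NNReal.coe_le_coe, coe_nnnorm, Real.coe_toNNReal _ (by positivity), Real.norm_eq_abs,
      abs_of_nonneg (by positivity)]
    exact mul_le_mul_of_nonneg_left (Real.rpow_le_rpow_of_nonpos hε hx (by linarith)) hκ.le

/-- existence for the dissipative ODE, truncated at height `M` -/
lemma fw_exists_trunc {κ β M : ℝ} (hκ : 0 < κ) (hκ1 : κ ≤ 1) (hβ : 0 < β) (hβ1 : β ≤ 1)
    (hM : 0 ≤ M) {A B H : ℝ → ℝ} (hA : ContinuousOn A (Icc 0 1)) (hB : ContinuousOn B (Icc 0 1))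
    (hH : ContinuousOn H (Icc 0 1)) (hA0 : ∀ t ∈ Icc (0:ℝ) 1, 0 ≤ A t)
    (hB0 : ∀ t ∈ Icc (0:ℝ) 1, 0 ≤ B t) :
    ∃ y : ℝ → ℝ, y 0 = 0 ∧ ∀ t ∈ Icc (0:ℝ) 1, HasDerivWithinAt y
      (H t - A t * (max 0 (min (y t) M)) ^ κ - B t * (max 0 (min (y t) M)) ^ β) (Icc 0 1) t := by
  obtain ⟨CA, hCA⟩ := isCompact_Icc.exists_bound_of_continuousOn hA
  obtain ⟨CB, hCB⟩ := isCompact_Icc.exists_bound_of_continuousOn hB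
  obtain ⟨CH, hCH⟩ := isCompact_Icc.exists_bound_of_continuousOn hH
  have h01 : (0:ℝ) ∈ Icc (0:ℝ) 1 := by simp
  have hCA0 : 0 ≤ CA := (norm_nonneg _).trans (hCA 0 h01)
  have hCB0 : 0 ≤ CB := (norm_nonneg _).trans (hCB 0 h01)
  have hCH0 : 0 ≤ CH := (norm_nonneg _).trans (hCH 0 h01)
  have hmono : ∀ {e : ℝ}, 0 < e → ∀ ε, 0 ≤ ε → Monotone (fun x : ℝ => (max 0 (min x M) + ε) ^ e) := by
    intro e he ε hε x z hxz
    have : 0 ≤ max 0 (min x M) := le_max_left _ _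
    exact Real.rpow_le_rpow (by positivity) (by gcongr) he.le
  refine fw_exists_of_approx
    (fun t x => H t - A t * (max 0 (min x M)) ^ κ - B t * (max 0 (min x M)) ^ β)
    (Real.toNNReal (CH + CA * (M + 1) ^ κ + CB * (M + 1) ^ β)) ?_ ?_ ?_
  · intro t ht x z hxz
    have h1 := hmono hκ 0 le_rfl hxz
    have h2 := hmono hβ 0 le_rfl hxz
    simp only [add_zero] at h1 h2
    have h3 := mul_le_mul_of_nonneg_left h1 (hA0 t ht)
    have h4 := mul_le_mul_of_nonneg_left h2 (hB0 t ht)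
    show _ ≤ _
    linarith
  · have e1 : ContinuousOn (fun z : ℝ × ℝ => A z.1) (Icc 0 1 ×ˢ univ) :=
      hA.comp continuousOn_fst (fun z hz => hz.1)
    have e2 : ContinuousOn (fun z : ℝ × ℝ => B z.1) (Icc 0 1 ×ˢ univ) :=
      hB.comp continuousOn_fst (fun z hz => hz.1)
    have e3 : ContinuousOn (fun z : ℝ × ℝ => H z.1) (Icc 0 1 ×ˢ univ) :=
      hH.comp continuousOn_fst (fun z hz => hz.1)
    have e4 : Continuous (fun z : ℝ × ℝ => (max 0 (min z.2 M)) ^ κ) :=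
      Continuous.rpow_const (by fun_prop) (fun _ => Or.inr hκ.le)
    have e5 : Continuous (fun z : ℝ × ℝ => (max 0 (min z.2 M)) ^ β) :=
      Continuous.rpow_const (by fun_prop) (fun _ => Or.inr hβ.le)
    exact (e3.sub (e1.mul e4.continuousOn)).sub (e2.mul e5.continuousOn)
  · intro ε hε hε1
    -- choose a shift
    obtain ⟨δ, hδ, hδ1, hδε⟩ : ∃ δ > 0, δ ≤ 1 ∧ CA * δ ^ κ + CB * δ ^ β ≤ ε := by
      have hc : Tendsto (fun δ : ℝ => CA * δ ^ κ + CB * δ ^ β) (𝓝[>] 0) (𝓝 0) := by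
        have : ContinuousAt (fun δ : ℝ => CA * δ ^ κ + CB * δ ^ β) 0 := by
          have h1 := Real.continuousAt_rpow_const 0 κ (Or.inr hκ.le)
          have h2 := Real.continuousAt_rpow_const 0 β (Or.inr hβ.le)
          exact (h1.const_mul _).add (h2.const_mul _)
        have h := this.tendsto
        simp only [Real.zero_rpow hκ.ne', Real.zero_rpow hβ.ne', mul_zero, add_zero] at h
        exact h.mono_left nhdsWithin_le_nhds
      have h2 := (hc.eventually (gt_mem_nhds hε)).and (Ioc_mem_nhdsGT (show (0:ℝ) < 1 by norm_num))
      obtain ⟨δ, h3, h4⟩ := h2.exists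
      exact ⟨δ, h4.1, h4.2, h3.le⟩
    have hlip : ∀ {e : ℝ}, 0 < e → e ≤ 1 → LipschitzWith (Real.toNNReal (e * δ ^ (e - 1)))
        (fun x : ℝ => (max 0 (min x M) + δ) ^ e) := by
      intro e he he1
      have h1 := fw_rpow_lip he he1 hδ
      have h2 : LipschitzWith 1 (fun x : ℝ => max 0 (min x M) + δ) := by
        have := ((LipschitzWith.id.min_const M).const_max 0).add (LipschitzWith.const (α := ℝ) δ)
        simpa using this
      have h3 := h1.comp (h2.lipschitzOnWith (s := univ)) (fun x _ => by
        have : 0 ≤ max 0 (min x M) := le_max_left _ _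
        simp only [mem_Ici]; linarith)
      rw [lipschitzOnWith_univ, mul_one] at h3
      exact h3
    have hbd : ∀ {e : ℝ}, 0 < e → ∀ x : ℝ, 0 ≤ (max 0 (min x M) + δ) ^ e ∧
        (max 0 (min x M) + δ) ^ e ≤ (M + 1) ^ e := by
      intro e he x
      have h0 : 0 ≤ max 0 (min x M) := le_max_left _ _
      have h1 : max 0 (min x M) ≤ M := max_le hM (min_le_right _ _)
      exact ⟨by positivity, Real.rpow_le_rpow (by positivity) (by linarith) he.le⟩
    have hcl : ∀ {e : ℝ}, 0 < e → e ≤ 1 → ∀ x : ℝ, (max 0 (min x M)) ^ e ≤ (max 0 (min x M) + δ) ^ e ∧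
        (max 0 (min x M) + δ) ^ e ≤ (max 0 (min x M)) ^ e + δ ^ e := by
      intro e he he1 x
      have h0 : 0 ≤ max 0 (min x M) := le_max_left _ _
      exact ⟨Real.rpow_le_rpow h0 (by linarith) he.le, Real.rpow_add_le_add_rpow h0 hδ.le he.le he1⟩
    refine ⟨fun t x => H t - A t * (max 0 (min x M) + δ) ^ κ - B t * (max 0 (min x M) + δ) ^ β,
      Real.toNNReal CA * Real.toNNReal (κ * δ ^ (κ - 1)) +
      Real.toNNReal CB * Real.toNNReal (β * δ ^ (β - 1)), ?_, ?_, ?_, ?_⟩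
    · intro t ht
      apply LipschitzWith.of_dist_le_mul
      intro x z
      have h1 := (hlip hκ hκ1).dist_le_mul x z
      have h2 := (hlip hβ hβ1).dist_le_mul x z
      have hAt := hCA t ht
      have hBt := hCB t ht
      rw [Real.norm_eq_abs] at hAt hBt
      push_cast
      rw [Real.coe_toNNReal CA hCA0, Real.coe_toNNReal CB hCB0]
      simp only [Real.dist_eq] at h1 h2 ⊢
      generalize (max 0 (min x M) + δ) ^ κ = a1 at *
      generalize (max 0 (min z M) + δ) ^ κ = a2 at *
      generalize (max 0 (min x M) + δ) ^ β = b1 at *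
      generalize (max 0 (min z M) + δ) ^ β = b2 at *
      calc |H t - A t * a1 - B t * b1 - (H t - A t * a2 - B t * b2)|
          = |-(A t * (a1 - a2)) + -(B t * (b1 - b2))| := by congr 1; ring
        _ ≤ |A t| * |a1 - a2| + |B t| * |b1 - b2| := by
            refine (abs_add_le _ _).trans ?_
            rw [abs_neg, abs_neg, abs_mul, abs_mul]
        _ ≤ CA * (_ * |x - z|) + CB * (_ * |x - z|) := by
            gcongr
        _ = _ := by ring
    · have e1 : ContinuousOn (fun z : ℝ × ℝ => A z.1) (Icc 0 1 ×ˢ univ) :=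
        hA.comp continuousOn_fst (fun z hz => hz.1)
      have e2 : ContinuousOn (fun z : ℝ × ℝ => B z.1) (Icc 0 1 ×ˢ univ) :=
        hB.comp continuousOn_fst (fun z hz => hz.1)
      have e3 : ContinuousOn (fun z : ℝ × ℝ => H z.1) (Icc 0 1 ×ˢ univ) :=
        hH.comp continuousOn_fst (fun z hz => hz.1)
      have e4 : Continuous (fun z : ℝ × ℝ => (max 0 (min z.2 M) + δ) ^ κ) :=
        Continuous.rpow_const (by fun_prop) (fun _ => Or.inr hκ.le)
      have e5 : Continuous (fun z : ℝ × ℝ => (max 0 (min z.2 M) + δ) ^ β) :=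
        Continuous.rpow_const (by fun_prop) (fun _ => Or.inr hβ.le)
      exact (e3.sub (e1.mul e4.continuousOn)).sub (e2.mul e5.continuousOn)
    · intro t ht x
      have hAt := hCA t ht
      have hBt := hCB t ht
      have hHt := hCH t ht
      rw [Real.norm_eq_abs] at hAt hBt hHt
      obtain ⟨h1, h2⟩ := hbd hκ x
      obtain ⟨h3, h4⟩ := hbd hβ x
      have hA1 := hA0 t ht
      have hB1 := hB0 t ht
      rw [abs_of_nonneg hA1] at hAt
      rw [abs_of_nonneg hB1] at hBt
      rw [Real.coe_toNNReal _ (by positivity)]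
      have h5 : A t * (max 0 (min x M) + δ) ^ κ ≤ CA * (M + 1) ^ κ := by gcongr
      have h6 : B t * (max 0 (min x M) + δ) ^ β ≤ CB * (M + 1) ^ β := by gcongr
      have h7 : 0 ≤ A t * (max 0 (min x M) + δ) ^ κ := by positivity
      have h8 : 0 ≤ B t * (max 0 (min x M) + δ) ^ β := by positivity
      have h9 := abs_le.1 hHt
      rw [abs_le]; constructor <;> linarith
    · intro t ht x
      have hAt := hCA t ht
      have hBt := hCB t ht
      rw [Real.norm_eq_abs] at hAt hBt
      have hA1 := hA0 t ht
      have hB1 := hB0 t ht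
      rw [abs_of_nonneg hA1] at hAt
      rw [abs_of_nonneg hB1] at hBt
      obtain ⟨h1, h2⟩ := hcl hκ hκ1 x
      obtain ⟨h3, h4⟩ := hcl hβ hβ1 x
      have h5 := mul_le_mul_of_nonneg_left h1 hA1
      have h6 := mul_le_mul_of_nonneg_left h2 hA1
      have h7 := mul_le_mul_of_nonneg_left h3 hB1
      have h8 := mul_le_mul_of_nonneg_left h4 hB1
      have h9 := mul_le_mul_of_nonneg_right hAt (Real.rpow_nonneg hδ.le κ)
      have h10 := mul_le_mul_of_nonneg_right hBt (Real.rpow_nonneg hδ.le β)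
      rw [abs_le]; constructor <;> nlinarith

lemma fw_exists {κ β : ℝ} (hκ : 0 < κ) (hκ1 : κ ≤ 1) (hβ : 0 < β) (hβ1 : β ≤ 1)
    {A B H : ℝ → ℝ} (hA : ContinuousOn A (Icc 0 1)) (hB : ContinuousOn B (Icc 0 1))
    (hH : ContinuousOn H (Icc 0 1)) (hA0 : ∀ t ∈ Icc (0:ℝ) 1, 0 ≤ A t)
    (hB0 : ∀ t ∈ Icc (0:ℝ) 1, 0 ≤ B t) {M : ℝ} (hM : 0 ≤ M)
    (hHM : ∀ t ∈ Icc (0:ℝ) 1, H t ≤ M) :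
    ∃ y : ℝ → ℝ, y 0 = 0 ∧ (∀ t ∈ Icc (0:ℝ) 1, y t ≤ M) ∧ ∀ t ∈ Icc (0:ℝ) 1, HasDerivWithinAt y
      (H t - A t * (max 0 (y t)) ^ κ - B t * (max 0 (y t)) ^ β) (Icc 0 1) t := by
  obtain ⟨y, hy0, hy⟩ := fw_exists_trunc hκ hκ1 hβ hβ1 hM hA hB hH hA0 hB0
  have hle : ∀ t ∈ Icc (0:ℝ) 1, y t ≤ M := by
    intro t ht
    have := fw_cmp (y2 := fun _ => 0) (d2 := fun _ => 0) (η0 := 0) (η := M) hy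
      (fun t _ => hasDerivWithinAt_const _ _ _) (by simp [hy0]) hM le_rfl (fun s hs _ => by
        have hs' := Ico_subset_Icc_self hs
        have h1 := hHM s hs'
        have h2 : 0 ≤ A s * (max 0 (min (y s) M)) ^ κ := mul_nonneg (hA0 s hs') (by positivity)
        have h3 : 0 ≤ B s * (max 0 (min (y s) M)) ^ β := mul_nonneg (hB0 s hs') (by positivity)
        linarith) t ht
    nlinarith [ht.1, ht.2]
  refine ⟨y, hy0, hle, fun t ht => ?_⟩
  have := hy t ht
  rwa [min_eq_left (hle t ht)] at this


lemma fw_inv {f f' : ℝ → ℝ} {I J : Set ℝ} (hI : IsOpen I) (hJ : IsOpen J)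
    (hmono : StrictMonoOn f I) (himg : f '' I = J) (hd : ∀ x ∈ I, HasDerivAt f (f' x) x)
    (hne : ∀ x ∈ I, f' x ≠ 0) :
    ∃ g : ℝ → ℝ, (∀ y ∈ J, g y ∈ I ∧ f (g y) = y ∧ HasDerivAt g (f' (g y))⁻¹ y) ∧
      (∀ x ∈ I, g (f x) = x) ∧ StrictMonoOn g J := by
  have hg : ∀ y ∈ J, Function.invFunOn f I y ∈ I ∧ f (Function.invFunOn f I y) = y := by
    intro y hy
    rw [← himg] at hy
    exact ⟨Function.invFunOn_mem hy, Function.invFunOn_eq hy⟩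
  set g := Function.invFunOn f I with hgdef
  have hgf : ∀ x ∈ I, g (f x) = x := by
    intro x hx
    have hfx : f x ∈ J := himg ▸ mem_image_of_mem f hx
    exact hmono.injOn (hg _ hfx).1 hx (hg _ hfx).2
  have hgm : StrictMonoOn g J := by
    intro y hy z hz hyz
    rw [← hmono.lt_iff_lt (hg y hy).1 (hg z hz).1, (hg y hy).2, (hg z hz).2]
    exact hyz
  have hgi : g '' J = I := by
    ext x
    constructor
    · rintro ⟨y, hy, rfl⟩; exact (hg y hy).1
    · intro hx; exact ⟨f x, himg ▸ mem_image_of_mem f hx, hgf x hx⟩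
  refine ⟨g, fun y hy => ⟨(hg y hy).1, (hg y hy).2, ?_⟩, hgf, hgm⟩
  have hc : ContinuousAt g y := hgm.continuousAt_of_image_mem_nhds (hJ.mem_nhds hy)
    (by rw [hgi]; exact hI.mem_nhds (hg y hy).1)
  exact HasDerivAt.of_local_left_inverse hc (hd _ (hg y hy).1) (hne _ (hg y hy).1)
    (by filter_upwards [hJ.mem_nhds hy] with z hz using (hg z hz).2)

section wave
variable {m p c γ a K : ℝ} {h U : ℝ → ℝ}

lemma fw_U_diff (W : FiniteWavefront m p h c γ U) {ξ : ℝ} (hξ : ξ < 0) :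
    HasDerivAt U (deriv U ξ) ξ :=
  ((W.smooth.differentiableOn (by norm_num)).differentiableAt (Iio_mem_nhds hξ)).hasDerivAt

lemma fw_dU_diff (W : FiniteWavefront m p h c γ U) {ξ : ℝ} (hξ : ξ < 0) :
    DifferentiableAt ℝ (deriv U) ξ := by
  have h2 : ContDiffOn ℝ 1 (deriv U) (Iio 0) :=
    W.smooth.deriv_of_isOpen isOpen_Iio (by norm_num)
  exact (h2.differentiableOn (by norm_num)).differentiableAt (Iio_mem_nhds hξ)

lemma fw_dU_nonpos (W : FiniteWavefront m p h c γ U) (ξ : ℝ) : deriv U ξ ≤ 0 :=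
  W.anti.deriv_nonpos

lemma fw_Um_diff (W : FiniteWavefront m p h c γ U) {ξ : ℝ} (hξ : ξ < 0) :
    HasDerivAt (fun x => U x ^ m) (m * U ξ ^ (m - 1) * deriv U ξ) ξ := by
  have := (fw_U_diff W hξ).rpow_const (p := m) (Or.inl (W.pos ξ hξ).ne')
  exact this.congr_deriv (by ring)

lemma fw_flux_eq (hm : 0 < m) (W : FiniteWavefront m p h c γ U) {ξ : ℝ} (hξ : ξ < 0) :
    flux m p U ξ = (m * U ξ ^ (m - 1) * -deriv U ξ) ^ (p - 1) := by
  unfold flux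
  rw [(fw_Um_diff W hξ).deriv, abs_of_nonpos]
  · ring_nf
  · have h1 := Real.rpow_pos_of_pos (W.pos ξ hξ) (m - 1)
    exact mul_nonpos_of_nonneg_of_nonpos (by positivity) (fw_dU_nonpos W ξ)

lemma fw_flux_cont (hm : 0 < m) (hp : 1 < p) (W : FiniteWavefront m p h c γ U) {ξ : ℝ}
    (hξ : ξ < 0) : ContinuousAt (flux m p U) ξ := by
  have h1 : ContinuousAt (fun ξ => (m * U ξ ^ (m - 1) * -deriv U ξ) ^ (p - 1)) ξ := by
    apply ContinuousAt.rpow_const _ (Or.inr (by linarith))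
    have h2 := (fw_dU_diff W hξ).continuousAt
    have h3 : ContinuousAt (fun ξ => U ξ ^ (m - 1)) ξ :=
      (fw_U_diff W hξ).continuousAt.rpow_const (Or.inl (W.pos ξ hξ).ne')
    exact (h3.const_mul m).mul h2.neg
  refine h1.congr ?_
  filter_upwards [Iio_mem_nhds hξ] with x hx using (fw_flux_eq hm W hx).symm

lemma fw_flux_diff (hm : 0 < m) (W : FiniteWavefront m p h c γ U) {ξ : ℝ}
    (hξ : ξ < 0) (hU : deriv U ξ < 0) :
    HasDerivAt (flux m p U) (c * deriv U ξ - γ * flux m p U ξ + h (U ξ)) ξ := by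
  have h1 : DifferentiableAt ℝ (fun ξ => (m * U ξ ^ (m - 1) * -deriv U ξ) ^ (p - 1)) ξ := by
    have h2 := (fw_dU_diff W hξ)
    have h3 : DifferentiableAt ℝ (fun ξ => U ξ ^ (m - 1)) ξ :=
      ((fw_U_diff W hξ).rpow_const (Or.inl (W.pos ξ hξ).ne')).differentiableAt
    have h4 := Real.rpow_pos_of_pos (W.pos ξ hξ) (m - 1)
    exact ((h3.const_mul m).fun_mul h2.fun_neg).rpow_const
      (Or.inl (mul_pos (by positivity) (by linarith)).ne')
  have h5 : DifferentiableAt ℝ (flux m p U) ξ := by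
    refine h1.congr_of_eventuallyEq ?_
    filter_upwards [Iio_mem_nhds hξ] with x hx using (fw_flux_eq hm W hx)
  have h6 := h5.hasDerivAt
  have h7 := W.eqn ξ hξ
  exact h6.congr_deriv (by linarith)

lemma fw_flux_nonneg (ξ : ℝ) : 0 ≤ flux m p U ξ := Real.rpow_nonneg (abs_nonneg _) _

lemma fw_dU_of_flux_pos (hm : 0 < m) (hp : 1 < p) (W : FiniteWavefront m p h c γ U) {ξ : ℝ}
    (hξ : ξ < 0) (hf : 0 < flux m p U ξ) : deriv U ξ < 0 := by
  refine lt_of_le_of_ne (fw_dU_nonpos W ξ) fun h0 => ?_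
  rw [fw_flux_eq hm W hξ, h0, neg_zero, mul_zero, Real.zero_rpow (by linarith)] at hf
  exact lt_irrefl _ hf

lemma fw_dU_neg (hm : 0 < m) (hp : 1 < p) (hc : 0 < c) (hγ : 0 ≤ γ)
    (hhneg : ∀ u ∈ Icc (0 : ℝ) a, h u ≤ 0) (hhpos : ∀ u ∈ Ioo a (1 : ℝ), 0 < h u)
    (W : FiniteWavefront m p h c γ U) {ξ : ℝ} (hξ : ξ < 0) : deriv U ξ < 0 := by
  by_contra hcon
  have hU0 : deriv U ξ = 0 := le_antisymm (fw_dU_nonpos W ξ) (not_lt.1 hcon)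
  have hf0 : flux m p U ξ = 0 := by
    rw [fw_flux_eq hm W hξ, hU0, neg_zero, mul_zero, Real.zero_rpow (by linarith)]
  have hdf : deriv (flux m p U) ξ = 0 := by
    apply IsLocalMin.deriv_eq_zero
    exact Eventually.of_forall fun x => by rw [hf0]; exact fw_flux_nonneg x
  have hh : h (U ξ) = 0 := by
    have := W.eqn ξ hξ
    rw [hU0, hf0, hdf] at this
    linarith
  have hUa : U ξ ≤ a := by
    by_contra hlt
    have := hhpos (U ξ) ⟨not_le.1 hlt, W.lt_one ξ hξ⟩
    linarith
  have hzero : ∀ x ∈ Ioo ξ 0, flux m p U x = 0 := by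
    intro x hx
    by_contra hne
    have hpos : 0 < flux m p U x := lt_of_le_of_ne (fw_flux_nonneg x) (Ne.symm hne)
    have hcont : ContinuousOn (flux m p U) (Icc ξ x) := fun z hz =>
      (fw_flux_cont hm hp W (hz.2.trans_lt hx.2)).continuousWithinAt
    let S := Icc ξ x ∩ flux m p U ⁻¹' {0}
    have hSc : IsClosed S := hcont.preimage_isClosed_of_isClosed isClosed_Icc isClosed_singleton
    have hSne : S.Nonempty := ⟨ξ, ⟨le_rfl, hx.1.le⟩, hf0⟩
    have hSb : BddAbove S := ⟨x, fun z hz => hz.1.2⟩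
    have hs := hSc.csSup_mem hSne hSb
    set s := sSup S
    have hs0 : flux m p U s = 0 := hs.2
    have hpos' : ∀ z ∈ Ioo s x, 0 < flux m p U z := by
      intro z hz
      refine lt_of_le_of_ne (fw_flux_nonneg z) fun h0 => ?_
      have : z ∈ S := ⟨⟨hs.1.1.trans hz.1.le, hz.2.le⟩, h0.symm⟩
      exact absurd (le_csSup hSb this) (not_le.2 hz.1)
    have hanti : AntitoneOn (flux m p U) (Icc s x) := by
      have hder : ∀ z ∈ Ioo s x, HasDerivAt (flux m p U)
          (c * deriv U z - γ * flux m p U z + h (U z)) z := fun z hz =>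
        fw_flux_diff hm W (hz.2.trans hx.2)
          (fw_dU_of_flux_pos hm hp W (hz.2.trans hx.2) (hpos' z hz))
      apply antitoneOn_of_deriv_nonpos (convex_Icc _ _) (hcont.mono (Icc_subset_Icc_left hs.1.1))
      · rw [interior_Icc]
        exact fun z hz => (hder z hz).differentiableAt.differentiableWithinAt
      · rw [interior_Icc]
        intro z hz
        rw [(hder z hz).deriv]
        have h1 := fw_dU_nonpos W z
        have h2 := fw_flux_nonneg (m := m) (p := p) (U := U) z
        have h3 : h (U z) ≤ 0 := hhneg _ ⟨(W.pos z (hz.2.trans hx.2)).le,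
          (W.anti (hs.1.1.trans hz.1.le)).trans hUa⟩
        nlinarith
    have := hanti (left_mem_Icc.2 hs.1.2) (right_mem_Icc.2 hs.1.2) hs.1.2
    linarith
  have hconst : U 0 = U ξ := by
    have hd : ∀ x ∈ Ioo ξ 0, deriv U x = 0 := by
      intro x hx
      by_contra hne
      have hlt := lt_of_le_of_ne (fw_dU_nonpos W x) hne
      have h1 := hzero x hx
      rw [fw_flux_eq hm W hx.2] at h1
      have h4 := Real.rpow_pos_of_pos (W.pos x hx.2) (m - 1)
      have : 0 < (m * U x ^ (m - 1) * -deriv U x) ^ (p - 1) :=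
        Real.rpow_pos_of_pos (mul_pos (by positivity) (by linarith)) _
      linarith
    obtain ⟨x, hx, hx2⟩ := exists_deriv_eq_slope U hξ W.cont.continuousOn
      (fun z hz => (fw_U_diff W hz.2).differentiableAt.differentiableWithinAt)
    rw [hd x hx, eq_comm, div_eq_zero_iff] at hx2
    rcases hx2 with h1 | h1 <;> linarith
  have := W.pos ξ hξ
  rw [← hconst, W.eq_zero 0 le_rfl] at this
  exact lt_irrefl _ this

lemma fw_flux_lower (hm : 0 < m) (hγ : 0 ≤ γ)
    (hK : ∀ u ∈ Icc (0:ℝ) 1, |h u| ≤ K * u) (hK0 : 0 ≤ K)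
    (W : FiniteWavefront m p h c γ U) (hneg : ∀ ξ < 0, deriv U ξ < 0) {ξ : ℝ} (hξ : ξ < 0) :
    (c + K * ξ) * U ξ ≤ flux m p U ξ := by
  have hder : ∀ z < 0, HasDerivAt (fun z => flux m p U z - c * U z - K * U ξ * z)
      (c * deriv U z - γ * flux m p U z + h (U z) - c * deriv U z - K * U ξ) z := by
    intro z hz
    have := ((fw_flux_diff hm W hz (hneg z hz)).fun_sub ((fw_U_diff W hz).const_mul c)).fun_sub
      ((hasDerivAt_id' z).const_mul (K * U ξ))
    exact this.congr_deriv (by ring)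
  have hanti : AntitoneOn (fun z => flux m p U z - c * U z - K * U ξ * z) (Ico ξ 0) := by
    apply antitoneOn_of_deriv_nonpos (convex_Ico _ _)
      (fun z hz => (hder z hz.2).continuousAt.continuousWithinAt)
    · rw [interior_Ico]
      exact fun z hz => (hder z hz.2).differentiableAt.differentiableWithinAt
    · rw [interior_Ico]
      intro z hz
      rw [(hder z hz.2).deriv]
      have h1 := (abs_le.1 (hK (U z) ⟨(W.pos z hz.2).le, (W.lt_one z hz.2).le⟩)).2
      have h2 : K * U z ≤ K * U ξ := mul_le_mul_of_nonneg_left (W.anti hz.1.le) hK0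
      have h3 := mul_nonneg hγ (fw_flux_nonneg (m := m) (p := p) (U := U) z)
      linarith
  have hlim : Tendsto (fun z => flux m p U z - c * U z - K * U ξ * z) (𝓝[<] 0) (𝓝 0) := by
    have h1 : Tendsto (fun z => c * U z + K * U ξ * z) (𝓝[<] 0) (𝓝 (c * U 0 + K * U ξ * 0)) := by
      have := W.cont
      exact ((by fun_prop : Continuous (fun z => c * U z + K * U ξ * z)).tendsto 0).mono_left
        nhdsWithin_le_nhds
    have := W.flux_zero.sub h1
    rw [W.eq_zero 0 le_rfl] at this
    simp only [mul_zero, add_zero, sub_zero] at this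
    refine this.congr fun z => by ring
  have := le_of_tendsto hlim (b := flux m p U ξ - c * U ξ - K * U ξ * ξ) (by
    filter_upwards [Ico_mem_nhdsLT hξ] with z hz
    exact hanti (left_mem_Ico.2 hξ) hz hz.1)
  nlinarith

lemma fw_flux_upper (hm : 0 < m) (hc : 0 < c) (hγ : 0 ≤ γ)
    (hK : ∀ u ∈ Icc (0:ℝ) 1, |h u| ≤ K * u) (hK0 : 0 ≤ K)
    (W : FiniteWavefront m p h c γ U) (hneg : ∀ ξ < 0, deriv U ξ < 0) {ξ : ℝ} (hξ : ξ < 0) :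
    Real.exp (γ * ξ) * flux m p U ξ ≤ (c - K * ξ) * U ξ := by
  have hder : ∀ z < 0, HasDerivAt (fun z => Real.exp (γ * z) * flux m p U z - c * U z + K * U ξ * z)
      (Real.exp (γ * z) * (c * deriv U z + h (U z)) - c * deriv U z + K * U ξ) z := by
    intro z hz
    have he : HasDerivAt (fun z => Real.exp (γ * z)) (Real.exp (γ * z) * γ) z := by
      simpa using ((hasDerivAt_id z).const_mul γ).exp
    have := ((he.fun_mul (fw_flux_diff hm W hz (hneg z hz))).fun_sub
      ((fw_U_diff W hz).const_mul c)).fun_add ((hasDerivAt_id' z).const_mul (K * U ξ))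
    exact this.congr_deriv (by ring)
  have hmon : MonotoneOn (fun z => Real.exp (γ * z) * flux m p U z - c * U z + K * U ξ * z)
      (Ico ξ 0) := by
    apply monotoneOn_of_deriv_nonneg (convex_Ico _ _)
      (fun z hz => (hder z hz.2).continuousAt.continuousWithinAt)
    · rw [interior_Ico]
      exact fun z hz => (hder z hz.2).differentiableAt.differentiableWithinAt
    · rw [interior_Ico]
      intro z hz
      rw [(hder z hz.2).deriv]
      have h1 := (abs_le.1 (hK (U z) ⟨(W.pos z hz.2).le, (W.lt_one z hz.2).le⟩)).1
      have h2 : K * U z ≤ K * U ξ := mul_le_mul_of_nonneg_left (W.anti hz.1.le) hK0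
      have h3 : Real.exp (γ * z) ≤ 1 :=
        Real.exp_le_one_iff.2 (mul_nonpos_of_nonneg_of_nonpos hγ hz.2.le)
      have h4 := Real.exp_pos (γ * z)
      have h5 : c * deriv U z ≤ 0 := mul_nonpos_of_nonneg_of_nonpos hc.le (fw_dU_nonpos W z)
      have h6 : 0 ≤ K * U z := mul_nonneg hK0 (W.pos z hz.2).le
      nlinarith
  have hlim : Tendsto (fun z => Real.exp (γ * z) * flux m p U z - c * U z + K * U ξ * z)
      (𝓝[<] 0) (𝓝 0) := by
    have h1 : Tendsto (fun z => c * U z - K * U ξ * z) (𝓝[<] 0) (𝓝 (c * U 0 - K * U ξ * 0)) := by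
      have := W.cont
      exact ((by fun_prop : Continuous (fun z => c * U z - K * U ξ * z)).tendsto 0).mono_left
        nhdsWithin_le_nhds
    have h2 : Tendsto (fun z => Real.exp (γ * z)) (𝓝[<] 0) (𝓝 (Real.exp (γ * 0))) :=
      ((by fun_prop : Continuous (fun z => Real.exp (γ * z))).tendsto 0).mono_left
        nhdsWithin_le_nhds
    have := (h2.mul W.flux_zero).sub h1
    rw [W.eq_zero 0 le_rfl] at this
    simp only [mul_zero, sub_zero] at this
    refine this.congr fun z => by ring
  have := ge_of_tendsto hlim (b := Real.exp (γ * ξ) * flux m p U ξ - c * U ξ + K * U ξ * ξ) (by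
    filter_upwards [Ico_mem_nhdsLT hξ] with z hz
    exact hmon (left_mem_Ico.2 hξ) hz hz.1)
  nlinarith

lemma fw_flux_small (hm : 0 < m) (hp : 1 < p)
    (W : FiniteWavefront m p h c γ U) {ξ0 ε : ℝ} (hξ0 : ξ0 < 0) (hε : 0 < ε) :
    ∃ ξ < ξ0, flux m p U ξ ≤ ε := by
  by_contra! hcon
  set e := ε ^ (p - 1)⁻¹ with he
  have he0 : 0 < e := by positivity
  have hp1 : 0 < p - 1 := by linarith
  have hbig : ∀ ξ < ξ0, deriv (fun x => U x ^ m) ξ ≤ -e := by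
    intro ξ hξ
    have hξ' := hξ.trans hξ0
    rw [(fw_Um_diff W hξ').deriv]
    have h1 := hcon ξ hξ
    rw [fw_flux_eq hm W hξ'] at h1
    have h4 := Real.rpow_pos_of_pos (W.pos ξ hξ') (m - 1)
    have h5 : 0 ≤ m * U ξ ^ (m - 1) * -deriv U ξ :=
      mul_nonneg (by positivity) (by linarith [fw_dU_nonpos W ξ])
    have h6 := Real.rpow_le_rpow hε.le h1.le (inv_pos.2 hp1).le
    rw [Real.rpow_rpow_inv h5 hp1.ne'] at h6
    linarith
  set b := ξ0 - 1
  set x := b - 2 / e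
  have h2e : 0 < 2 / e := by positivity
  have hxb : x < b := by simp only [x]; linarith
  obtain ⟨z, hz, hz2⟩ := exists_deriv_eq_slope (fun x => U x ^ m) hxb
    (fun z hz => (fw_Um_diff W (by simp only [b] at hz; linarith [hz.2])).continuousAt.continuousWithinAt)
    (fun z hz => (fw_Um_diff W
      (by simp only [b] at hz; linarith [hz.2])).differentiableAt.differentiableWithinAt)
  have h7 := hbig z (by simp only [b] at hz; linarith [hz.2])
  rw [hz2, div_le_iff₀ (by linarith)] at h7
  have h8 : b - x = 2 / e := by simp only [x]; ring
  rw [h8] at h7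
  have h9 : -e * (2 / e) = -2 := by field_simp
  have hx0 : x < 0 := by simp only [b] at hxb; linarith
  have hb0 : b < 0 := by simp only [b]; linarith
  have h10 : U x ^ m ≤ 1 := Real.rpow_le_one (W.pos x hx0).le (W.lt_one x hx0).le hm.le
  have h11 : 0 ≤ U b ^ m := Real.rpow_nonneg (W.pos b hb0).le _
  rw [h9] at h7
  linarith

end wave


lemma fw_phase {m p c γ : ℝ} {h U : ℝ → ℝ} (hm : 0 < m) (hp : 1 < p)
    (W : FiniteWavefront m p h c γ U) (hneg : ∀ ξ < 0, deriv U ξ < 0) :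
    ∃ g : ℝ → ℝ, (∀ s ∈ Ioo (0:ℝ) 1, g s < 0 ∧ U (g s) = 1 - s ∧
      HasDerivAt g (m * (1 - s) ^ (m - 1) / (flux m p U (g s)) ^ (p - 1)⁻¹) s ∧
      0 < flux m p U (g s) ∧
      HasDerivAt (fun s => flux m p U (g s) ^ (p / (p - 1)))
        (p / (p - 1) * (m * (1 - s) ^ (m - 1) * (h (1 - s) - γ * flux m p U (g s))
          - c * flux m p U (g s) ^ (p - 1)⁻¹)) s) ∧
      (∀ ξ < 0, g (1 - U ξ) = ξ) ∧ StrictMonoOn g (Ioo 0 1) := by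
  have hp1 : 0 < p - 1 := by linarith
  have hd : ∀ x ∈ Iio (0:ℝ), HasDerivAt (fun ξ => 1 - U ξ) (-deriv U x) x := by
    intro x hx
    exact (fw_U_diff W hx).const_sub 1
  have hmono : StrictMonoOn (fun ξ => 1 - U ξ) (Iio 0) := by
    apply strictMonoOn_of_deriv_pos (convex_Iio 0)
      (fun x hx => (hd x hx).continuousAt.continuousWithinAt)
    rw [interior_Iio]
    intro x hx
    rw [(hd x hx).deriv]
    linarith [hneg x hx]
  have himg : (fun ξ => 1 - U ξ) '' Iio 0 = Ioo 0 1 := by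
    ext s
    constructor
    · rintro ⟨ξ, hξ, rfl⟩
      have h1 := W.pos ξ hξ
      have h2 := W.lt_one ξ hξ
      constructor <;> simp only <;> linarith
    · intro hs
      obtain ⟨ξ1, hξ1⟩ := (W.tendsto_one.eventually (lt_mem_nhds (show 1 - s < 1 by linarith [hs.1]))).exists
      obtain ⟨ξ, hξ⟩ := mem_range_of_exists_le_of_exists_ge W.cont
        (⟨0, by rw [W.eq_zero 0 le_rfl]; linarith [hs.2]⟩ : ∃ x, U x ≤ 1 - s) ⟨ξ1, hξ1.le⟩
      refine ⟨ξ, ?_, by simp only; linarith⟩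
      by_contra hge
      rw [W.eq_zero ξ (not_lt.1 hge)] at hξ
      linarith [hs.2]
  obtain ⟨g, hg, hgf, hgm⟩ := fw_inv isOpen_Iio isOpen_Ioo hmono himg hd
    (fun x hx => by have := hneg x hx; linarith)
  refine ⟨g, fun s hs => ?_, hgf, hgm⟩
  obtain ⟨h1, h2, h3⟩ := hg s hs
  have hU : U (g s) = 1 - s := by linarith
  have hs1 : 0 < 1 - s := by linarith [hs.2]
  have hD : 0 < -deriv U (g s) := by linarith [hneg _ h1]
  have hr := Real.rpow_pos_of_pos hs1 (m - 1)
  have hflux : flux m p U (g s) = (m * (1 - s) ^ (m - 1) * -deriv U (g s)) ^ (p - 1) := by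
    rw [fw_flux_eq hm W h1, hU]
  have hpos : 0 < flux m p U (g s) := by rw [hflux]; positivity
  have hF : flux m p U (g s) ^ (p - 1)⁻¹ = m * (1 - s) ^ (m - 1) * -deriv U (g s) := by
    rw [hflux, Real.rpow_rpow_inv (by positivity) hp1.ne']
  refine ⟨h1, hU, ?_, hpos, ?_⟩
  · refine h3.congr_deriv ?_
    rw [hF]
    field_simp
  · have h4 := (fw_flux_diff hm W h1 (hneg _ h1)).comp s h3
    have h5 := h4.rpow_const (p := p / (p - 1)) (Or.inl hpos.ne')
    refine h5.congr_deriv ?_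
    have h6 : p / (p - 1) - 1 = (p - 1)⁻¹ := by field_simp; ring
    simp only [Function.comp]
    rw [h6, hF, hU]
    have hD' : deriv U (g s) ≠ 0 := (hneg _ h1).ne
    field_simp
    ring

lemma fw_waves_le {m p c1 c2 γ : ℝ} {h U1 U2 g1 g2 : ℝ → ℝ} (hm : 0 < m) (hp : 1 < p)
    (hγ : 0 ≤ γ) (hc2 : 0 < c2) (hc : c2 ≤ c1)
    (W1 : FiniteWavefront m p h c1 γ U1)
    (h1 : ∀ s ∈ Ioo (0:ℝ) 1, g1 s < 0 ∧ U1 (g1 s) = 1 - s ∧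
      HasDerivAt g1 (m * (1 - s) ^ (m - 1) / (flux m p U1 (g1 s)) ^ (p - 1)⁻¹) s ∧
      0 < flux m p U1 (g1 s) ∧
      HasDerivAt (fun s => flux m p U1 (g1 s) ^ (p / (p - 1)))
        (p / (p - 1) * (m * (1 - s) ^ (m - 1) * (h (1 - s) - γ * flux m p U1 (g1 s))
          - c1 * flux m p U1 (g1 s) ^ (p - 1)⁻¹)) s)
    (hi1 : ∀ ξ < 0, g1 (1 - U1 ξ) = ξ) (hm1 : StrictMonoOn g1 (Ioo 0 1))
    (h2 : ∀ s ∈ Ioo (0:ℝ) 1, g2 s < 0 ∧ U2 (g2 s) = 1 - s ∧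
      HasDerivAt g2 (m * (1 - s) ^ (m - 1) / (flux m p U2 (g2 s)) ^ (p - 1)⁻¹) s ∧
      0 < flux m p U2 (g2 s) ∧
      HasDerivAt (fun s => flux m p U2 (g2 s) ^ (p / (p - 1)))
        (p / (p - 1) * (m * (1 - s) ^ (m - 1) * (h (1 - s) - γ * flux m p U2 (g2 s))
          - c2 * flux m p U2 (g2 s) ^ (p - 1)⁻¹)) s) :
    ∀ s ∈ Ioo (0:ℝ) 1, flux m p U1 (g1 s) ≤ flux m p U2 (g2 s) := by
  have hp1 : 0 < p - 1 := by linarith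
  have hP : 0 < p / (p - 1) := by positivity
  intro s hs
  have key : flux m p U1 (g1 s) ^ (p / (p - 1)) ≤ flux m p U2 (g2 s) ^ (p / (p - 1)) := by
    refine le_of_forall_pos_le_add fun η hη => ?_
    obtain ⟨ξ, hξ, hξη⟩ := fw_flux_small (ε := η ^ (p / (p - 1))⁻¹) hm hp W1 (h1 s hs).1
      (by positivity)
    have hξ0 : ξ < 0 := hξ.trans (h1 s hs).1
    have hs0 : 1 - U1 ξ ∈ Ioo (0:ℝ) 1 := by
      have := W1.pos ξ hξ0
      have := W1.lt_one ξ hξ0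
      constructor <;> linarith
    have hlt : 1 - U1 ξ < s := by
      rw [← hm1.lt_iff_lt hs0 hs, hi1 ξ hξ0]; exact hξ
    have hsub : Icc (1 - U1 ξ) s ⊆ Ioo 0 1 := fun x hx =>
      ⟨hs0.1.trans_le hx.1, hx.2.trans_lt hs.2⟩
    have := fw_cmp (η0 := η) (η := 0)
      (fun t ht => (h1 t (hsub ht)).2.2.2.2.hasDerivWithinAt (s := Icc (1 - U1 ξ) s))
      (fun t ht => (h2 t (hsub ht)).2.2.2.2.hasDerivWithinAt (s := Icc (1 - U1 ξ) s))
      (by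
        have e1 : flux m p U1 (g1 (1 - U1 ξ)) ^ (p / (p - 1)) ≤ η := by
          rw [hi1 ξ hξ0]
          have := Real.rpow_le_rpow (fw_flux_nonneg ξ) hξη hP.le
          rwa [Real.rpow_inv_rpow hη.le hP.ne'] at this
        have e2 := Real.rpow_nonneg (fw_flux_nonneg (m := m) (p := p) (U := U2) (g2 (1 - U1 ξ)))
          (p / (p - 1))
        linarith) le_rfl hη.le
      (by
        intro t ht hle
        have ht' := hsub (Ico_subset_Icc_self ht)
        have e1 : flux m p U2 (g2 t) ≤ flux m p U1 (g1 t) :=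
          (Real.rpow_le_rpow_iff (fw_flux_nonneg _) (fw_flux_nonneg _) hP).1 hle
        have e2 := Real.rpow_le_rpow (fw_flux_nonneg _) e1 (inv_pos.2 hp1).le
        have e3 := Real.rpow_nonneg (fw_flux_nonneg (m := m) (p := p) (U := U2) (g2 t)) (p - 1)⁻¹
        have e4 : 0 < 1 - t := by linarith [ht'.2]
        have e5 : 0 ≤ c1 := by linarith
        rw [add_zero]
        apply mul_le_mul_of_nonneg_left _ hP.le
        gcongr) s ⟨hlt.le, le_rfl⟩
    simpa using this
  exact (Real.rpow_le_rpow_iff (fw_flux_nonneg _) (fw_flux_nonneg _) hP).1 key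

lemma fw_speed_le {m p c1 c2 γ a K : ℝ} {h U1 U2 : ℝ → ℝ} (hm : 0 < m) (hp : 1 < p)
    (hγ : 0 ≤ γ) (hc1 : 0 < c1) (hc2 : 0 < c2)
    (hhneg : ∀ u ∈ Icc (0 : ℝ) a, h u ≤ 0) (hhpos : ∀ u ∈ Ioo a (1 : ℝ), 0 < h u)
    (hK : ∀ u ∈ Icc (0:ℝ) 1, |h u| ≤ K * u) (hK0 : 0 ≤ K)
    (W1 : FiniteWavefront m p h c1 γ U1) (W2 : FiniteWavefront m p h c2 γ U2) : c1 ≤ c2 := by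
  by_contra! hlt
  have n1 : ∀ ξ < 0, deriv U1 ξ < 0 := fun ξ hξ => fw_dU_neg hm hp hc1 hγ hhneg hhpos W1 hξ
  have n2 : ∀ ξ < 0, deriv U2 ξ < 0 := fun ξ hξ => fw_dU_neg hm hp hc2 hγ hhneg hhpos W2 hξ
  obtain ⟨g1, h1, hi1, hm1⟩ := fw_phase hm hp W1 n1
  obtain ⟨g2, h2, hi2, hm2⟩ := fw_phase hm hp W2 n2
  have hle := fw_waves_le hm hp hγ hc2 hlt.le W1 h1 hi1 hm1 h2
  -- choose δ
  obtain ⟨δ, hδ, hδ2⟩ : ∃ δ > 0, (c2 + K * δ) < Real.exp (γ * -δ) * (c1 - K * δ) := by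
    have hc : ContinuousAt (fun δ => Real.exp (γ * -δ) * (c1 - K * δ) - (c2 + K * δ)) 0 := by
      fun_prop
    have h3 := hc.tendsto.mono_left (nhdsWithin_le_nhds (s := Ioi 0))
    simp only [neg_zero, mul_zero, Real.exp_zero, sub_zero, add_zero, one_mul] at h3
    obtain ⟨δ, h4, h5⟩ := ((h3.eventually (lt_mem_nhds (show 0 < c1 - c2 by linarith))).and
      self_mem_nhdsWithin).exists
    exact ⟨δ, h5, by linarith⟩
  have hδn : -δ < 0 := by linarith
  have p1 := W1.pos _ hδn
  have p2 := W2.pos _ hδn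
  have l1 := W1.lt_one _ hδn
  have l2 := W2.lt_one _ hδn
  set u := min (U1 (-δ)) (U2 (-δ)) with hu
  have hu0 : 0 < u := lt_min p1 p2
  have hu1 : u < 1 := (min_le_left _ _).trans_lt l1
  have hs : 1 - u ∈ Ioo (0:ℝ) 1 := by constructor <;> linarith
  have hg1 : -δ ≤ g1 (1 - u) := by
    rw [← hi1 _ hδn]
    refine hm1.monotoneOn ⟨by linarith, by linarith⟩ hs ?_
    linarith [min_le_left (U1 (-δ)) (U2 (-δ))]
  have hg2 : -δ ≤ g2 (1 - u) := by
    rw [← hi2 _ hδn]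
    refine hm2.monotoneOn ⟨by linarith, by linarith⟩ hs ?_
    linarith [min_le_right (U1 (-δ)) (U2 (-δ))]
  obtain ⟨a1, b1, -, d1, -⟩ := h1 _ hs
  obtain ⟨a2, b2, -, d2, -⟩ := h2 _ hs
  have e1 := fw_flux_lower hm hγ hK hK0 W1 n1 a1
  have e2 := fw_flux_upper hm hc2 hγ hK hK0 W2 n2 a2
  have e3 := hle _ hs
  rw [b1, sub_sub_cancel] at e1
  rw [b2, sub_sub_cancel] at e2
  have e4 : Real.exp (γ * -δ) ≤ Real.exp (γ * g2 (1 - u)) :=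
    Real.exp_le_exp.2 (mul_le_mul_of_nonneg_left hg2 hγ)
  have e5 := Real.exp_pos (γ * -δ)
  have e6 : (c1 - K * δ) * u ≤ flux m p U2 (g2 (1 - u)) := by
    have : K * -δ ≤ K * g1 (1 - u) := mul_le_mul_of_nonneg_left hg1 hK0
    nlinarith
  have e7 : Real.exp (γ * -δ) * flux m p U2 (g2 (1 - u)) ≤ (c2 + K * δ) * u := by
    have i1 : K * -δ ≤ K * g2 (1 - u) := mul_le_mul_of_nonneg_left hg2 hK0
    have i2 := mul_le_mul_of_nonneg_right e4 d2.le
    nlinarith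
  have e8 := mul_le_mul_of_nonneg_left e6 e5.le
  have e9 := mul_lt_mul_of_pos_right hδ2 hu0
  nlinarith

lemma fw_unique {m p c γ a : ℝ} {h U1 U2 : ℝ → ℝ} (hm : 0 < m) (hp : 1 < p)
    (hγ : 0 ≤ γ) (hc : 0 < c)
    (hhneg : ∀ u ∈ Icc (0 : ℝ) a, h u ≤ 0) (hhpos : ∀ u ∈ Ioo a (1 : ℝ), 0 < h u)
    (W1 : FiniteWavefront m p h c γ U1) (W2 : FiniteWavefront m p h c γ U2) : U1 = U2 := by
  have n1 : ∀ ξ < 0, deriv U1 ξ < 0 := fun ξ hξ => fw_dU_neg hm hp hc hγ hhneg hhpos W1 hξ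
  have n2 : ∀ ξ < 0, deriv U2 ξ < 0 := fun ξ hξ => fw_dU_neg hm hp hc hγ hhneg hhpos W2 hξ
  obtain ⟨g1, h1, hi1, hm1⟩ := fw_phase hm hp W1 n1
  obtain ⟨g2, h2, hi2, hm2⟩ := fw_phase hm hp W2 n2
  have hle := fw_waves_le hm hp hγ hc le_rfl W1 h1 hi1 hm1 h2
  have hge := fw_waves_le hm hp hγ hc le_rfl W2 h2 hi2 hm2 h1
  have hd : ∀ s ∈ Ioo (0:ℝ) 1, HasDerivAt (fun s => g1 s - g2 s) 0 s := by
    intro s hs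
    have := (h1 s hs).2.2.1.fun_sub (h2 s hs).2.2.1
    refine this.congr_deriv ?_
    rw [le_antisymm (hle s hs) (hge s hs), sub_self]
  have hcst : ∀ s ∈ Ioo (0:ℝ) 1, ∀ t ∈ Ioo (0:ℝ) 1, g1 s - g2 s = g1 t - g2 t := by
    intro s hs t ht
    exact isOpen_Ioo.is_const_of_deriv_eq_zero isPreconnected_Ioo
      (fun x hx => (hd x hx).differentiableAt.differentiableWithinAt)
      (fun x hx => (hd x hx).deriv) hs ht
  have mem1 : ∀ ξ < 0, 1 - U1 ξ ∈ Ioo (0:ℝ) 1 := fun ξ hξ =>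
    ⟨by linarith [W1.lt_one ξ hξ], by linarith [W1.pos ξ hξ]⟩
  have mem2 : ∀ ξ < 0, 1 - U2 ξ ∈ Ioo (0:ℝ) 1 := fun ξ hξ =>
    ⟨by linarith [W2.lt_one ξ hξ], by linarith [W2.pos ξ hξ]⟩
  have heq : ∀ s ∈ Ioo (0:ℝ) 1, g1 s = g2 s := by
    intro s hs
    rcases lt_trichotomy (g1 s) (g2 s) with hlt | he | hgt
    · exfalso
      have hn : (g1 s - g2 s) / 2 < 0 := by linarith
      have e1 := hcst s hs _ (mem1 _ hn)
      rw [hi1 _ hn] at e1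
      have e2 := (h2 _ (mem1 _ hn)).1
      linarith
    · exact he
    · exfalso
      have hn : (g2 s - g1 s) / 2 < 0 := by linarith
      have e1 := hcst s hs _ (mem2 _ hn)
      rw [hi2 _ hn] at e1
      have e2 := (h1 _ (mem2 _ hn)).1
      linarith
  funext ξ
  rcases lt_or_ge ξ 0 with hξ | hξ
  · have e1 := heq _ (mem1 ξ hξ)
    rw [hi1 ξ hξ] at e1
    have e2 := (h2 _ (mem1 ξ hξ)).2.1
    rw [← e1] at e2
    linarith
  · rw [W1.eq_zero ξ hξ, W2.eq_zero ξ hξ]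


/-- right-hand side of the phase-plane equation -/
noncomputable def fwG (m p : ℝ) (h : ℝ → ℝ) (c γ t x : ℝ) : ℝ :=
  (1 + 1 / m) * (p / (p - 1)) * (m * (1 - t) ^ m * h ((1 - t) ^ (1 + 1 / m))
    - c * (1 - t) ^ (1 / m) * (max 0 x) ^ (1 / p)
    - γ * (m * (1 - t) ^ m) * (max 0 x) ^ (1 - 1 / p))

/-- phase-plane solution issuing from the equilibrium `1` -/
def FwSol (m p : ℝ) (h : ℝ → ℝ) (c γ : ℝ) (y : ℝ → ℝ) : Prop :=
  y 0 = 0 ∧ ∀ t ∈ Icc (0:ℝ) 1, HasDerivWithinAt y (fwG m p h c γ t (y t)) (Icc 0 1) t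

section phase
variable {m p a K M c γ : ℝ} {h y : ℝ → ℝ}

lemma fw_rq_mem (hm : 0 < m) {t : ℝ} (ht : t ∈ Icc (0:ℝ) 1) :
    (1 - t) ^ (1 + 1 / m) ∈ Icc (0:ℝ) 1 :=
  ⟨Real.rpow_nonneg (by linarith [ht.2]) _,
    Real.rpow_le_one (by linarith [ht.2]) (by linarith [ht.1]) (by positivity)⟩

lemma fw_H_cont (hm : 0 < m) (hh : ContinuousOn h (Icc 0 1)) :
    ContinuousOn (fun t => (1 + 1 / m) * (p / (p - 1)) * (m * (1 - t) ^ m * h ((1 - t) ^ (1 + 1 / m))))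
      (Icc 0 1) := by
  have e1 : Continuous (fun t : ℝ => (1 - t) ^ m) :=
    Continuous.rpow_const (by fun_prop) (fun _ => Or.inr hm.le)
  have e2 : Continuous (fun t : ℝ => (1 - t) ^ (1 + 1 / m)) :=
    Continuous.rpow_const (by fun_prop) (fun _ => Or.inr (by positivity))
  have e3 : ContinuousOn (fun t : ℝ => h ((1 - t) ^ (1 + 1 / m))) (Icc 0 1) :=
    hh.comp e2.continuousOn (fun t ht => fw_rq_mem hm ht)
  exact ((e1.continuousOn.const_mul m).mul e3).const_mul _

lemma fw_sol_exists (hm : 0 < m) (hp : 1 < p) (hh : ContinuousOn h (Icc 0 1)) :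
    ∃ M ≥ 0, ∀ c γ, 0 ≤ c → 0 ≤ γ → ∃ y, FwSol m p h c γ y ∧ ∀ t ∈ Icc (0:ℝ) 1, y t ≤ M := by
  have hH := fw_H_cont (p := p) hm hh
  obtain ⟨M, hM⟩ := isCompact_Icc.exists_bound_of_continuousOn hH
  have hM0 : 0 ≤ M := (norm_nonneg _).trans (hM 0 (by simp))
  refine ⟨M, hM0, fun c γ hc hγ => ?_⟩
  have hp1 : 0 < p - 1 := by linarith
  have hp0 : 0 < p := by linarith
  have e1 : Continuous (fun t : ℝ => (1 - t) ^ m) :=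
    Continuous.rpow_const (by fun_prop) (fun _ => Or.inr hm.le)
  have e2 : Continuous (fun t : ℝ => (1 - t) ^ (1 / m)) :=
    Continuous.rpow_const (by fun_prop) (fun _ => Or.inr (by positivity))
  have hip : 1 / p < 1 := by rw [div_lt_one hp0]; exact hp
  have hip0 : 0 < 1 / p := by positivity
  obtain ⟨y, hy0, hyM, hy⟩ := fw_exists (κ := 1 / p) (β := 1 - 1 / p)
    (A := fun t => (1 + 1 / m) * (p / (p - 1)) * (c * (1 - t) ^ (1 / m)))
    (B := fun t => (1 + 1 / m) * (p / (p - 1)) * (γ * (m * (1 - t) ^ m)))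
    hip0 hip.le (by linarith) (by linarith)
    ((e2.const_mul c).const_mul _).continuousOn
    (((e1.const_mul m).const_mul γ).const_mul _).continuousOn hH
    (fun t ht => by
      have : 0 ≤ (1 - t) ^ (1 / m) := Real.rpow_nonneg (by linarith [ht.2]) _
      positivity)
    (fun t ht => by
      have : 0 ≤ (1 - t) ^ m := Real.rpow_nonneg (by linarith [ht.2]) _
      positivity) hM0
    (fun t ht => (le_abs_self _).trans (hM t ht))
  refine ⟨y, ⟨hy0, fun t ht => (hy t ht).congr_deriv ?_⟩, hyM⟩
  unfold fwG
  ring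

lemma fw_sol_lip (hm : 0 < m) (hp : 1 < p) {c1 c2 : ℝ} {y1 y2 : ℝ → ℝ} (hc2 : 0 ≤ c2)
    (hγ : 0 ≤ γ) (h1 : FwSol m p h c1 γ y1) (h2 : FwSol m p h c2 γ y2) (hM : 0 ≤ M)
    (hM1 : ∀ t ∈ Icc (0:ℝ) 1, y1 t ≤ M) :
    ∀ t ∈ Icc (0:ℝ) 1, y1 t ≤ y2 t + (1 + 1 / m) * (p / (p - 1)) * M ^ (1 / p) * |c1 - c2| := by
  have hp1 : 0 < p - 1 := by linarith
  have hp0 : 0 < p := by linarith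
  have hip : 1 / p < 1 := by rw [div_lt_one hp0]; exact hp
  have hQ : 0 < (1 + 1 / m) * (p / (p - 1)) := by positivity
  have hη : 0 ≤ (1 + 1 / m) * (p / (p - 1)) * M ^ (1 / p) * |c1 - c2| := by positivity
  intro t ht
  have := fw_cmp (η0 := 0) (η := (1 + 1 / m) * (p / (p - 1)) * M ^ (1 / p) * |c1 - c2|)
    h1.2 h2.2 (by rw [h1.1, h2.1, add_zero]) hη le_rfl (by
      intro s hs hle
      have hs' := Ico_subset_Icc_self hs
      unfold fwG
      have hr0 : 0 ≤ 1 - s := by linarith [hs'.2]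
      have hr1 : 1 - s ≤ 1 := by linarith [hs'.1]
      have a1 : 0 ≤ (1 - s) ^ (1 / m) := Real.rpow_nonneg hr0 _
      have a2 : (1 - s) ^ (1 / m) ≤ 1 := Real.rpow_le_one hr0 hr1 (by positivity)
      have a3 : 0 ≤ (1 - s) ^ m := Real.rpow_nonneg hr0 _
      have b1 : (max 0 (y2 s)) ^ (1 / p) ≤ (max 0 (y1 s)) ^ (1 / p) := by gcongr
      have b2 : (max 0 (y2 s)) ^ (1 - 1 / p) ≤ (max 0 (y1 s)) ^ (1 - 1 / p) :=
        Real.rpow_le_rpow (le_max_left _ _) (by gcongr) (by linarith)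
      have b3 : (max 0 (y1 s)) ^ (1 / p) ≤ M ^ (1 / p) :=
        Real.rpow_le_rpow (le_max_left _ _) (max_le hM (hM1 s hs')) (by positivity)
      have b4 : 0 ≤ (max 0 (y1 s)) ^ (1 / p) := by positivity
      generalize (max 0 (y1 s)) ^ (1 / p) = Y1 at *
      generalize (max 0 (y2 s)) ^ (1 / p) = Y2 at *
      generalize (max 0 (y1 s)) ^ (1 - 1 / p) = Z1 at *
      generalize (max 0 (y2 s)) ^ (1 - 1 / p) = Z2 at *
      generalize (1 - s) ^ (1 / m) = r1 at *
      generalize (1 - s) ^ m = r2 at *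
      have k1 : γ * (m * r2) * Z2 ≤ γ * (m * r2) * Z1 := by gcongr
      have k2 : r1 * (c2 * Y2) ≤ r1 * (c2 * Y1) := by gcongr
      have k3 : r1 * ((c2 - c1) * Y1) ≤ 1 * (|c1 - c2| * M ^ (1 / p)) := by
        have : c2 - c1 ≤ |c1 - c2| := by rw [abs_sub_comm]; exact le_abs_self _
        calc r1 * ((c2 - c1) * Y1) ≤ r1 * (|c1 - c2| * M ^ (1 / p)) := by
              apply mul_le_mul_of_nonneg_left _ a1
              exact (mul_le_mul_of_nonneg_right this b4).trans
                (mul_le_mul_of_nonneg_left b3 (abs_nonneg _))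
          _ ≤ _ := by gcongr
      have k4 : m * r2 * h ((1 - s) ^ (1 + 1 / m)) - c1 * r1 * Y1 - γ * (m * r2) * Z1 ≤
        m * r2 * h ((1 - s) ^ (1 + 1 / m)) - c2 * r1 * Y2 - γ * (m * r2) * Z2
          + M ^ (1 / p) * |c1 - c2| := by nlinarith
      have k5 := mul_le_mul_of_nonneg_left k4 hQ.le
      nlinarith) t ht
  nlinarith [ht.1, ht.2]

lemma fw_sol_c0 (hm : 0 < m) (hp : 1 < p) (hh : ContinuousOn h (Icc 0 1)) (hγ : 0 ≤ γ)
    (hy : FwSol m p h 0 γ y) (hM : 0 ≤ M) (hM1 : ∀ t ∈ Icc (0:ℝ) 1, y t ≤ M) :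
    (∫ t in (0:ℝ)..1, (1 + 1 / m) * (p / (p - 1)) *
      (m * (1 - t) ^ m * h ((1 - t) ^ (1 + 1 / m)))) ≤
      y 1 + (1 + 1 / m) * (p / (p - 1)) * (m * M ^ (1 - 1 / p)) * γ := by
  have hp1 : 0 < p - 1 := by linarith
  have hp0 : 0 < p := by linarith
  have hip : 1 / p < 1 := by rw [div_lt_one hp0]; exact hp
  have hQ : 0 < (1 + 1 / m) * (p / (p - 1)) := by positivity
  have hH := fw_H_cont (p := p) hm hh
  have hder : ∀ t ∈ Icc (0:ℝ) 1, HasDerivWithinAt (fun t => ∫ s in (0:ℝ)..t,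
      (1 + 1 / m) * (p / (p - 1)) * (m * (1 - s) ^ m * h ((1 - s) ^ (1 + 1 / m))))
      ((1 + 1 / m) * (p / (p - 1)) * (m * (1 - t) ^ m * h ((1 - t) ^ (1 + 1 / m)))) (Icc 0 1) t := by
    intro t ht
    have : Fact (t ∈ Icc (0:ℝ) 1) := ⟨ht⟩
    refine intervalIntegral.integral_hasDerivWithinAt_right
      (ContinuousOn.intervalIntegrable ?_) ?_ (hH t ht)
    · rw [uIcc_of_le ht.1]; exact hH.mono (Icc_subset_Icc_right ht.2)
    · exact hH.stronglyMeasurableAtFilter_nhdsWithin measurableSet_Icc t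
  have := fw_cmp (η0 := 0) (η := (1 + 1 / m) * (p / (p - 1)) * (m * M ^ (1 - 1 / p)) * γ) hder hy.2
    (by simp [hy.1]) (by positivity) le_rfl (by
      intro s hs _
      have hs' := Ico_subset_Icc_self hs
      unfold fwG
      have hr0 : 0 ≤ 1 - s := by linarith [hs'.2]
      have hr1 : 1 - s ≤ 1 := by linarith [hs'.1]
      have a3 : 0 ≤ (1 - s) ^ m := Real.rpow_nonneg hr0 _
      have a4 : (1 - s) ^ m ≤ 1 := Real.rpow_le_one hr0 hr1 hm.le
      have b3 : (max 0 (y s)) ^ (1 - 1 / p) ≤ M ^ (1 - 1 / p) :=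
        Real.rpow_le_rpow (le_max_left _ _) (max_le hM (hM1 s hs')) (by linarith)
      have k : γ * (m * (1 - s) ^ m) * (max 0 (y s)) ^ (1 - 1 / p) ≤
          γ * (m * 1) * M ^ (1 - 1 / p) := by
        gcongr
      have k5 := mul_le_mul_of_nonneg_left k hQ.le
      nlinarith) 1 (by simp)
  simpa using this

lemma fw_sol_pos (hm : 0 < m) (hp : 1 < p) (ha0 : 0 ≤ a) (h1 : h 1 = 0)
    (hhpos : ∀ u ∈ Ioo a (1 : ℝ), 0 < h u)
    (hy : FwSol m p h c γ y) {t : ℝ} (ht : t ∈ Ioo (0:ℝ) 1) (hta : a < (1 - t) ^ (1 + 1 / m)) :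
    0 < y t := by
  have hp1 : 0 < p - 1 := by linarith
  have hp0 : 0 < p := by linarith
  have hip : 1 / p < 1 := by rw [div_lt_one hp0]; exact hp
  have hQ : 0 < (1 + 1 / m) * (p / (p - 1)) := by positivity
  have e2 : Continuous (fun t : ℝ => (1 - t) ^ (1 + 1 / m)) :=
    Continuous.rpow_const (by fun_prop) (fun _ => Or.inr (by positivity))
  obtain ⟨b, hb1, hb2⟩ : ∃ b ∈ Ioo t 1, a < (1 - b) ^ (1 + 1 / m) := by
    have h3 := (e2.tendsto t).mono_left (nhdsWithin_le_nhds (s := Ioi t))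
    obtain ⟨b, h4, h5⟩ := ((h3.eventually (lt_mem_nhds hta)).and (Ioo_mem_nhdsGT ht.2)).exists
    exact ⟨b, h5, h4⟩
  have hu : ∀ s ∈ Ioc 0 b, (1 - s) ^ (1 + 1 / m) ∈ Ioo a 1 := by
    intro s hs
    refine ⟨hb2.trans_le ?_, ?_⟩
    · exact Real.rpow_le_rpow (by linarith [hb1.2]) (by linarith [hs.2]) (by positivity)
    · exact Real.rpow_lt_one (by linarith [hs.2, hb1.2]) (by linarith [hs.1]) (by positivity)
  have hG : ∀ s ∈ Icc 0 b, ∀ x ≤ 0, fwG m p h c γ s x = (1 + 1 / m) * (p / (p - 1)) *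
      (m * (1 - s) ^ m * h ((1 - s) ^ (1 + 1 / m))) := by
    intro s hs x hx
    unfold fwG
    rw [max_eq_left hx, Real.zero_rpow (by positivity), Real.zero_rpow (by linarith)]
    ring
  have hpos' : ∀ s ∈ Ioc 0 b, 0 < (1 + 1 / m) * (p / (p - 1)) *
      (m * (1 - s) ^ m * h ((1 - s) ^ (1 + 1 / m))) := by
    intro s hs
    have k1 := hhpos _ (hu s hs)
    have k2 : 0 < (1 - s) ^ m := Real.rpow_pos_of_pos (by linarith [hs.2, hb1.2]) _
    positivity
  have hsub : Icc 0 b ⊆ Icc (0:ℝ) 1 := Icc_subset_Icc_right hb1.2.le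
  have hnn : ∀ s ∈ Icc 0 b, 0 ≤ y s := by
    intro s hs
    have := fw_cmp (η0 := 0) (η := 0) (y1 := fun _ => 0) (d1 := fun _ => 0)
      (fun s _ => hasDerivWithinAt_const s (Icc 0 b) 0)
      (fun s hs => (hy.2 s (hsub hs)).mono hsub) (by simp [hy.1]) le_rfl le_rfl (by
        intro s hs hle
        rw [hG s (Ico_subset_Icc_self hs) _ hle, add_zero]
        rcases hs.1.eq_or_lt with h0 | h0
        · simp [← h0, h1]
        · exact (hpos' s ⟨h0, hs.2.le⟩).le) s hs
    simpa using this
  have htb : t ∈ Icc 0 b := ⟨ht.1.le, hb1.1.le⟩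
  refine lt_of_le_of_ne (hnn t htb) fun h0 => ?_
  have hmin : IsLocalMin y t := by
    filter_upwards [Icc_mem_nhds ht.1 hb1.1] with x hx
    rw [← h0]; exact hnn x hx
  have hd := (hy.2 t (hsub htb)).hasDerivAt (Icc_mem_nhds ht.1 ht.2)
  have := hmin.hasDerivAt_eq_zero hd
  rw [← h0, hG t htb 0 le_rfl] at this
  have k := hpos' t ⟨ht.1, hb1.1.le⟩
  linarith

lemma fw_sol_anti (hm : 0 < m) (hp : 1 < p) (hc : 0 ≤ c) (hγ : 0 ≤ γ)
    (hhneg : ∀ u ∈ Icc (0 : ℝ) a, h u ≤ 0)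
    (hy : FwSol m p h c γ y) {t s : ℝ} (ht : 0 ≤ t) (hts : t ≤ s) (hs : s ≤ 1)
    (hta : (1 - t) ^ (1 + 1 / m) ≤ a) : y s ≤ y t := by
  have hp1 : 0 < p - 1 := by linarith
  have hQ : 0 < (1 + 1 / m) * (p / (p - 1)) := by positivity
  have hsub : Icc t s ⊆ Icc (0:ℝ) 1 := Icc_subset_Icc ht hs
  have := fw_cmp (η0 := 0) (η := 0) (y2 := fun _ => y t) (d2 := fun _ => 0)
      (fun s hs => (hy.2 s (hsub hs)).mono hsub)
      (fun x _ => hasDerivWithinAt_const x (Icc t s) (y t)) (by simp) le_rfl le_rfl (by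
        intro x hx _
        have hx' := hsub (Ico_subset_Icc_self hx)
        have hr0 : 0 ≤ 1 - x := by linarith [hx'.2]
        have a1 : 0 ≤ (1 - x) ^ (1 / m) := Real.rpow_nonneg hr0 _
        have a3 : 0 ≤ (1 - x) ^ m := Real.rpow_nonneg hr0 _
        have k1 : h ((1 - x) ^ (1 + 1 / m)) ≤ 0 := by
          refine hhneg _ ⟨(fw_rq_mem hm hx').1, le_trans ?_ hta⟩
          exact Real.rpow_le_rpow hr0 (by linarith [hx.1]) (by positivity)
        unfold fwG
        have k2 : 0 ≤ c * (1 - x) ^ (1 / m) * (max 0 (y x)) ^ (1 / p) := by positivity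
        have k3 : 0 ≤ γ * (m * (1 - x) ^ m) * (max 0 (y x)) ^ (1 - 1 / p) := by positivity
        have k4 : m * (1 - x) ^ m * h ((1 - x) ^ (1 + 1 / m)) ≤ 0 :=
          mul_nonpos_of_nonneg_of_nonpos (by positivity) k1
        rw [add_zero]
        exact mul_nonpos_of_nonneg_of_nonpos hQ.le (by linarith)) s ⟨hts, le_rfl⟩
  simpa using this

lemma fw_sol_lower (hm : 0 < m) (hp : 1 < p) (hmp : 1 < m * (p - 1)) (hc : 0 < c) (hγ : 0 ≤ γ)
    (hK0 : 0 < K) (hK : ∀ u ∈ Icc (0:ℝ) 1, |h u| ≤ K * u)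
    (hy : FwSol m p h c γ y) (hy1 : 0 < y 1) {ρ : ℝ} (hρ1 : ρ ≤ 1)
    (hρ : m * K * ρ ^ ((1 + 1 / m) * (m - 1 / (p - 1))) ≤ (c / 2) ^ (p / (p - 1))) :
    ∀ r ∈ Icc 0 ρ, (c / 2) ^ (p / (p - 1)) * r ^ ((1 + 1 / m) * (p / (p - 1))) ≤ y (1 - r) := by
  have hp1 : 0 < p - 1 := by linarith
  have hp0 : 0 < p := by linarith
  have hQ : 0 < (1 + 1 / m) * (p / (p - 1)) := by positivity
  have hP1 : 1 < p / (p - 1) := by rw [one_lt_div hp1]; linarith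
  have hq1 : 1 < 1 + 1 / m := by have : 0 < 1 / m := by positivity
                                 linarith
  have hQ1 : 1 ≤ (1 + 1 / m) * (p / (p - 1)) := by nlinarith
  have he : 0 < (1 + 1 / m) * (m - 1 / (p - 1)) := by
    apply mul_pos (by positivity)
    rw [sub_pos, div_lt_iff₀ hp1]; exact hmp
  have hmap : ∀ r ∈ Icc 0 ρ, 1 - r ∈ Icc (0:ℝ) 1 := fun r hr =>
    ⟨by linarith [hr.2], by linarith [hr.1]⟩
  have hB : ∀ r ∈ Icc 0 ρ, HasDerivWithinAt (fun r => y (1 - r))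
      (-fwG m p h c γ (1 - r) (y (1 - r))) (Icc 0 ρ) r := by
    intro r hr
    have h1 : HasDerivWithinAt (fun r : ℝ => 1 - r) (-1) (Icc 0 ρ) r :=
      ((hasDerivAt_id' r).const_sub 1).hasDerivWithinAt
    have := (hy.2 (1 - r) (hmap r hr)).comp r h1 hmap
    exact this.congr_deriv (by ring)
  have hf : ∀ r : ℝ, HasDerivAt (fun r : ℝ => (c / 2) ^ (p / (p - 1)) * r ^ ((1 + 1 / m) * (p / (p - 1))))
      ((c / 2) ^ (p / (p - 1)) * ((1 + 1 / m) * (p / (p - 1)) * r ^ ((1 + 1 / m) * (p / (p - 1)) - 1))) r :=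
    fun r => (Real.hasDerivAt_rpow_const (Or.inr hQ1)).const_mul _
  refine image_le_of_deriv_right_lt_deriv_boundary'
    (f' := fun r => (c / 2) ^ (p / (p - 1)) * ((1 + 1 / m) * (p / (p - 1)) * r ^ ((1 + 1 / m) * (p / (p - 1)) - 1)))
    (B' := fun r => -fwG m p h c γ (1 - r) (y (1 - r)))
    (fun r _ => (hf r).continuousAt.continuousWithinAt)
    (fun r _ => (hf r).hasDerivWithinAt) ?_ (fun r hr => (hB r hr).continuousWithinAt) ?_ ?_
  · rw [Real.zero_rpow hQ.ne']; simpa using hy1.le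
  · intro r hr
    exact ((hB r (Ico_subset_Icc_self hr)).mono (Icc_subset_Icc_left hr.1)).mono_of_mem_nhdsWithin
      (Icc_mem_nhdsGE hr.2)
  · intro r hr heq
    have hr0 : 0 < r := by
      refine lt_of_le_of_ne hr.1 fun h0 => ?_
      rw [← h0, Real.zero_rpow hQ.ne'] at heq
      simp at heq
      linarith
    have hc2 : 0 < c / 2 := by linarith
    have hr1 : r ≤ 1 := hr.2.le.trans hρ1
    rw [← heq]
    unfold fwG
    rw [sub_sub_cancel, max_eq_right (by positivity)]
    have x1 : ((c / 2) ^ (p / (p - 1)) * r ^ ((1 + 1 / m) * (p / (p - 1)))) ^ (1 / p) =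
        (c / 2) ^ (1 / (p - 1)) * r ^ ((1 + 1 / m) * (1 / (p - 1))) := by
      rw [Real.mul_rpow (by positivity) (by positivity), ← Real.rpow_mul hc2.le,
        ← Real.rpow_mul hr0.le]
      congr 2 <;> field_simp
    have x2 : (c / 2) ^ (p / (p - 1)) = (c / 2) * (c / 2) ^ (1 / (p - 1)) := by
      nth_rw 2 [← Real.rpow_one (c / 2)]
      rw [← Real.rpow_add hc2]
      congr 1; field_simp; ring
    have x3 : r ^ ((1 + 1 / m) * (p / (p - 1)) - 1) = r ^ (1 / m) * r ^ ((1 + 1 / m) * (1 / (p - 1))) := by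
      rw [← Real.rpow_add hr0]; congr 1; field_simp; ring
    have x4 : r ^ m * r ^ (1 + 1 / m) =
        r ^ ((1 + 1 / m) * (p / (p - 1)) - 1) * r ^ ((1 + 1 / m) * (m - 1 / (p - 1))) := by
      rw [← Real.rpow_add hr0, ← Real.rpow_add hr0]; congr 1; field_simp; ring
    have x5 : r ^ ((1 + 1 / m) * (m - 1 / (p - 1))) < ρ ^ ((1 + 1 / m) * (m - 1 / (p - 1))) :=
      Real.rpow_lt_rpow hr0.le hr.2 he
    have hu : r ^ (1 + 1 / m) ∈ Icc (0:ℝ) 1 :=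
      ⟨by positivity, Real.rpow_le_one hr0.le hr1 (by positivity)⟩
    have x6 : h (r ^ (1 + 1 / m)) ≤ K * r ^ (1 + 1 / m) := (abs_le.1 (hK _ hu)).2
    have x7 : 0 ≤ γ * (m * r ^ m) *
      ((c / 2) ^ (p / (p - 1)) * r ^ ((1 + 1 / m) * (p / (p - 1)))) ^ (1 - 1 / p) := by positivity
    have x8 : m * r ^ m * h (r ^ (1 + 1 / m)) ≤ m * K * (r ^ m * r ^ (1 + 1 / m)) := by
      have : m * r ^ m * h (r ^ (1 + 1 / m)) ≤ m * r ^ m * (K * r ^ (1 + 1 / m)) := by gcongr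
      linarith
    have x9 : m * K * (r ^ m * r ^ (1 + 1 / m)) <
        (c / 2) ^ (p / (p - 1)) * r ^ ((1 + 1 / m) * (p / (p - 1)) - 1) := by
      rw [x4]
      have hz : 0 < r ^ ((1 + 1 / m) * (p / (p - 1)) - 1) := by positivity
      have : m * K * r ^ ((1 + 1 / m) * (m - 1 / (p - 1))) < (c / 2) ^ (p / (p - 1)) :=
        lt_of_lt_of_le (mul_lt_mul_of_pos_left x5 (by positivity)) hρ
      nlinarith
    rw [x1]
    have x10 : c * r ^ (1 / m) * ((c / 2) ^ (1 / (p - 1)) * r ^ ((1 + 1 / m) * (1 / (p - 1)))) =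
        2 * ((c / 2) ^ (p / (p - 1)) * r ^ ((1 + 1 / m) * (p / (p - 1)) - 1)) := by
      rw [x2, x3]; ring
    rw [x10]
    have := mul_lt_mul_of_pos_left (lt_of_le_of_lt x8 x9) hQ
    have := mul_nonneg hQ.le x7
    nlinarith

end phase


lemma fw_integral_pos {m p : ℝ} {h : ℝ → ℝ} (hm : 0 < m) (hp : 1 < p)
    (hint : 0 < ∫ u in (0:ℝ)..1, u ^ (m - 1) * h u) :
    0 < ∫ t in (0:ℝ)..1, (1 + 1 / m) * (p / (p - 1)) *
      (m * (1 - t) ^ m * h ((1 - t) ^ (1 + 1 / m))) := by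
  have hp1 : 0 < p - 1 := by linarith
  have hp0 : 0 < p := by linarith
  have hq : 0 < 1 + 1 / m := by positivity
  have e1 := intervalIntegral.integral_comp_sub_left (a := 0) (b := 1)
    (fun r : ℝ => (1 + 1 / m) * (p / (p - 1)) * (m * r ^ m * h (r ^ (1 + 1 / m)))) 1
  simp only [sub_self, sub_zero] at e1
  rw [e1]
  have e2 := MeasureTheory.integral_comp_rpow_Ioi_of_pos
    (g := (Ioc (0:ℝ) 1).indicator (fun u => u ^ (m - 1) * h u)) hq
  rw [MeasureTheory.setIntegral_indicator measurableSet_Ioc] at e2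
  have e3 : Ioi (0:ℝ) ∩ Ioc 0 1 = Ioc 0 1 := by
    ext x; simp
  rw [e3, ← intervalIntegral.integral_of_le zero_le_one] at e2
  have e4 : ∫ x in Ioi (0:ℝ), ((1 + 1 / m) * x ^ (1 + 1 / m - 1)) •
      (Ioc (0:ℝ) 1).indicator (fun u => u ^ (m - 1) * h u) (x ^ (1 + 1 / m)) =
      ∫ x in Ioi (0:ℝ), (Ioc (0:ℝ) 1).indicator
        (fun r => (1 + 1 / m) * (r ^ m * h (r ^ (1 + 1 / m)))) x := by
    apply MeasureTheory.setIntegral_congr_fun measurableSet_Ioi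
    intro x hx
    have hx : 0 < x := hx
    by_cases hx1 : x ≤ 1
    · have hxm : x ^ (1 + 1 / m) ∈ Ioc (0:ℝ) 1 :=
        ⟨by positivity, Real.rpow_le_one hx.le hx1 hq.le⟩
      simp only [indicator_of_mem hxm, indicator_of_mem (show x ∈ Ioc (0:ℝ) 1 from ⟨hx, hx1⟩),
        smul_eq_mul]
      rw [← Real.rpow_mul hx.le]
      have : x ^ m = x ^ (1 + 1 / m - 1) * x ^ ((1 + 1 / m) * (m - 1)) := by
        rw [← Real.rpow_add hx]; congr 1; field_simp; ring
      rw [this]; ring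
    · have hx1 : 1 < x := not_le.1 hx1
      have hxm : x ^ (1 + 1 / m) ∉ Ioc (0:ℝ) 1 := fun hc =>
        absurd hc.2 (not_le.2 (Real.one_lt_rpow hx1 hq))
      simp only [indicator_of_notMem hxm,
        indicator_of_notMem (show x ∉ Ioc (0:ℝ) 1 from fun hc => absurd hc.2 (not_le.2 hx1)),
        smul_zero]
  rw [e4, MeasureTheory.setIntegral_indicator measurableSet_Ioc, e3,
    ← intervalIntegral.integral_of_le zero_le_one] at e2
  rw [← e2] at hint
  have e5 : ∫ x in (0:ℝ)..1, (1 + 1 / m) * (p / (p - 1)) * (m * x ^ m * h (x ^ (1 + 1 / m))) =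
      (p / (p - 1) * m) * ∫ x in (0:ℝ)..1, (1 + 1 / m) * (x ^ m * h (x ^ (1 + 1 / m))) := by
    rw [← intervalIntegral.integral_const_mul]
    congr 1; ext x; ring
  rw [e5]
  positivity

lemma fw_speed_exists {m p a K γ M : ℝ} {h : ℝ → ℝ} (hm : 0 < m) (hp : 1 < p)
    (hmp : 1 < m * (p - 1)) (ha0 : 0 ≤ a) (h1 : h 1 = 0)
    (hhneg : ∀ u ∈ Icc (0 : ℝ) a, h u ≤ 0) (hhpos : ∀ u ∈ Ioo a (1 : ℝ), 0 < h u)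
    (hγ : 0 ≤ γ) (hK0 : 0 < K) (hK : ∀ u ∈ Icc (0:ℝ) 1, |h u| ≤ K * u) (hM : 0 ≤ M)
    (hex : ∀ c, 0 ≤ c → ∃ y, FwSol m p h c γ y ∧ ∀ t ∈ Icc (0:ℝ) 1, y t ≤ M)
    (hpos0 : ∀ y, FwSol m p h 0 γ y → (∀ t ∈ Icc (0:ℝ) 1, y t ≤ M) → 0 < y 1) :
    ∃ c > 0, ∃ y ρ, 0 < ρ ∧ ρ ≤ 1 ∧ FwSol m p h c γ y ∧ y 1 = 0 ∧ (∀ t ∈ Ioo (0:ℝ) 1, 0 < y t) ∧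
      ∀ r ∈ Icc (0:ℝ) ρ, (c / 4) ^ (p / (p - 1)) * r ^ ((1 + 1 / m) * (p / (p - 1))) ≤ y (1 - r) := by
  have hp1 : 0 < p - 1 := by linarith
  have hp0 : 0 < p := by linarith
  have hP : 0 < p / (p - 1) := by positivity
  choose! Y hYs hYM using hex
  set Λ := (1 + 1 / m) * (p / (p - 1)) * M ^ (1 / p) with hΛ
  have hΛ0 : 0 ≤ Λ := by positivity
  have lip : ∀ c1 c2, 0 ≤ c1 → 0 ≤ c2 → ∀ t ∈ Icc (0:ℝ) 1, Y c1 t ≤ Y c2 t + Λ * |c1 - c2| :=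
    fun c1 c2 hc1 hc2 => fw_sol_lip hm hp hc2 hγ (hYs c1 hc1) (hYs c2 hc2) hM (hYM c1 hc1)
  set S := {c : ℝ | 0 ≤ c ∧ Y c 1 ≤ 0} with hS
  have one : (1:ℝ) ∈ Icc (0:ℝ) 1 := by simp
  have hSne : S.Nonempty := by
    refine ⟨2 * max 1 (m * K), by positivity, ?_⟩
    by_contra hcon
    push Not at hcon
    have hx1 : 1 ≤ max 1 (m * K) := le_max_left _ _
    have hx2 : m * K ≤ max 1 (m * K) := le_max_right _ _
    have hc : 0 < 2 * max 1 (m * K) := by positivity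
    have := fw_sol_lower (ρ := 1) hm hp hmp hc hγ hK0 hK (hYs _ hc.le) hcon le_rfl (by
      rw [Real.one_rpow, mul_one, mul_div_cancel_left₀ _ two_ne_zero]
      refine hx2.trans ?_
      apply Real.self_le_rpow_of_one_le hx1
      rw [le_div_iff₀ hp1]; linarith) 1 one
    rw [Real.one_rpow, mul_one, sub_self, (hYs _ hc.le).1] at this
    have h3 : 0 < (2 * max 1 (m * K) / 2) ^ (p / (p - 1)) := by positivity
    linarith
  have hSb : BddBelow S := ⟨0, fun c hc => hc.1⟩
  set cs := sInf S with hcs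
  have hcs0 : 0 ≤ cs := le_csInf hSne (fun c hc => hc.1)
  have hlt : ∀ c, 0 ≤ c → c < cs → 0 < Y c 1 := by
    intro c hc hlt
    by_contra hcon
    exact absurd (csInf_le hSb (show c ∈ S from ⟨hc, not_lt.1 hcon⟩)) (not_le.2 hlt)
  -- value at cs is ≤ 0
  have hle : Y cs 1 ≤ 0 := by
    apply le_of_forall_pos_le_add
    intro ε hε
    obtain ⟨c, hcS, hc⟩ := exists_lt_of_csInf_lt hSne
      (show sInf S < cs + ε / (Λ + 1) by rw [← hcs]; linarith [show 0 < ε / (Λ + 1) by positivity])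
    have hge : cs ≤ c := csInf_le hSb hcS
    have := lip cs c hcs0 hcS.1 1 one
    have h2 : |cs - c| ≤ ε / (Λ + 1) := by rw [abs_sub_comm, abs_of_nonneg] <;> linarith
    have h3 : Λ * |cs - c| ≤ (Λ + 1) * (ε / (Λ + 1)) := by gcongr; linarith
    rw [mul_div_cancel₀ _ (by positivity)] at h3
    linarith [hcS.2]
  have hcsp : 0 < cs := by
    rcases hcs0.lt_or_eq with h' | h'
    · exact h'
    · exfalso
      rw [← h'] at hle
      linarith [hpos0 _ (hYs 0 le_rfl) (hYM 0 le_rfl)]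
  -- approximation from below
  have approx : ∀ (t : ℝ), t ∈ Icc (0:ℝ) 1 → ∀ A, (∀ c, cs / 2 ≤ c → c < cs → A ≤ Y c t) → A ≤ Y cs t := by
    intro t ht A hA
    apply le_of_forall_pos_le_add
    intro ε hε
    set d := min (cs / 2) (ε / (Λ + 1)) with hd
    have hd0 : 0 < d := by positivity
    have hd1 : d ≤ cs / 2 := min_le_left _ _
    have h1 := hA (cs - d) (by linarith) (by linarith)
    have h2 := lip (cs - d) cs (by linarith) hcs0 t ht
    have h3 : |cs - d - cs| = d := by rw [show cs - d - cs = -d by ring, abs_neg, abs_of_pos hd0]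
    rw [h3] at h2
    have h4 : Λ * d ≤ (Λ + 1) * (ε / (Λ + 1)) := by
      gcongr
      · linarith
      · exact min_le_right _ _
    rw [mul_div_cancel₀ _ (by positivity)] at h4
    linarith
  have hy1 : Y cs 1 = 0 := le_antisymm hle
    (approx 1 one 0 (fun c h1 h2 => (hlt c (by linarith) h2).le))
  set e := (1 + 1 / m) * (m - 1 / (p - 1)) with he
  have hmp' : 0 < m - 1 / (p - 1) := by
    rw [sub_pos, div_lt_iff₀ hp1]; exact hmp
  have he0 : 0 < e := by positivity
  obtain ⟨ρ, hρ0, hρ1, hρ⟩ : ∃ ρ > 0, ρ ≤ 1 ∧ m * K * ρ ^ e ≤ (cs / 4) ^ (p / (p - 1)) := by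
    set B := (cs / 4) ^ (p / (p - 1)) / (m * K) with hB
    have hB0 : 0 < B := by positivity
    refine ⟨min 1 (B ^ (1 / e)), by positivity, min_le_left _ _, ?_⟩
    have : (min 1 (B ^ (1 / e))) ^ e ≤ (B ^ (1 / e)) ^ e :=
      Real.rpow_le_rpow (by positivity) (min_le_right _ _) he0.le
    rw [← Real.rpow_mul hB0.le, one_div_mul_cancel he0.ne', Real.rpow_one] at this
    calc _ ≤ m * K * B := by gcongr
      _ = _ := by rw [hB]; field_simp
  have low : ∀ r ∈ Icc (0:ℝ) ρ, (cs / 4) ^ (p / (p - 1)) * r ^ ((1 + 1 / m) * (p / (p - 1))) ≤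
      Y cs (1 - r) := by
    intro r hr
    apply approx (1 - r) ⟨by linarith [hr.2], by linarith [hr.1]⟩
    intro c hc1 hc2
    have hc0 : 0 < c := by linarith
    have hmono : (cs / 4) ^ (p / (p - 1)) ≤ (c / 2) ^ (p / (p - 1)) :=
      Real.rpow_le_rpow (by positivity) (by linarith) hP.le
    refine le_trans ?_ (fw_sol_lower hm hp hmp hc0 hγ hK0 hK (hYs _ hc0.le) (hlt c hc0.le hc2) hρ1
      (hρ.trans hmono) r hr)
    have := Real.rpow_nonneg hr.1 ((1 + 1 / m) * (p / (p - 1)))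
    gcongr
  refine ⟨cs, hcsp, Y cs, ρ, hρ0, hρ1, hYs cs hcs0, hy1, ?_, low⟩
  intro t ht
  by_cases hta : a < (1 - t) ^ (1 + 1 / m)
  · exact fw_sol_pos hm hp ha0 h1 hhpos (hYs cs hcs0) ht hta
  · push Not at hta
    have key : ∀ r, 0 < r → r ≤ ρ → 0 < Y cs (1 - r) := fun r h1 h2 =>
      lt_of_lt_of_le (by positivity) (low r ⟨h1.le, h2⟩)
    by_cases htr : 1 - t ≤ ρ
    · have := key (1 - t) (by linarith [ht.2]) htr
      rwa [sub_sub_cancel] at this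
    · exact (key ρ hρ0 le_rfl).trans_le (fw_sol_anti hm hp hcs0 hγ hhneg (hYs cs hcs0) ht.1.le
        (by linarith) (by linarith) hta)


lemma fw_sol_upper {m p K c γ : ℝ} {h y : ℝ → ℝ} (hm : 0 < m) (hp : 1 < p) (hc : 0 < c)
    (hγ : 0 ≤ γ) (hK0 : 0 < K) (hK : ∀ u ∈ Icc (0:ℝ) 1, |h u| ≤ K * (1 - u))
    (hy : FwSol m p h c γ y) : ∃ C > 0, ∀ t ∈ Icc (0:ℝ) (1 / 2), y t ≤ (C * t) ^ p := by
  have hp1 : 0 < p - 1 := by linarith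
  have hp0 : 0 < p := by linarith
  have hQ : 0 < (1 + 1 / m) * (p / (p - 1)) := by positivity
  set b := (1 / 2 : ℝ) ^ (1 / m) with hb
  have hb0 : 0 < b := by positivity
  set C := m * K * (1 + 1 / m) / (c * b) with hC
  have hC0 : 0 < C := by positivity
  refine ⟨C, hC0, ?_⟩
  have hsub : Icc (0:ℝ) (1 / 2) ⊆ Icc (0:ℝ) 1 := Icc_subset_Icc_right (by norm_num)
  have := fw_cmp (η0 := 0) (η := 0) (y2 := fun t => (C * t) ^ p)
      (d2 := fun t => C * 1 * p * (C * t) ^ (p - 1))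
      (fun s hs => (hy.2 s (hsub hs)).mono hsub)
      (fun s hs => (((hasDerivAt_id' s).const_mul C).rpow_const (Or.inr hp.le)).hasDerivWithinAt)
      (by simp [hy.1, Real.zero_rpow hp0.ne']) le_rfl le_rfl (by
        intro t ht hle
        have hts := hsub (Ico_subset_Icc_self ht)
        have hr0 : 0 ≤ 1 - t := by linarith [hts.2]
        have hr1 : 1 - t ≤ 1 := by linarith [hts.1]
        have hCt : 0 ≤ C * t := mul_nonneg hC0.le ht.1
        have a1 : b ≤ (1 - t) ^ (1 / m) :=
          Real.rpow_le_rpow (by norm_num) (by linarith [ht.2]) (by positivity)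
        have a3 : 0 ≤ (1 - t) ^ m := Real.rpow_nonneg hr0 _
        have a4 : (1 - t) ^ m ≤ 1 := Real.rpow_le_one hr0 hr1 hm.le
        have b1 : C * t ≤ (max 0 (y t)) ^ (1 / p) := by
          have h3 : ((C * t) ^ p) ^ (1 / p) ≤ (max 0 (y t)) ^ (1 / p) :=
            Real.rpow_le_rpow (by positivity) (hle.trans (le_max_right _ _)) (by positivity)
          rwa [← Real.rpow_mul hCt, mul_one_div_cancel hp0.ne', Real.rpow_one] at h3
        have b2 : 0 ≤ (max 0 (y t)) ^ (1 - 1 / p) := by positivity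
        have hu := fw_rq_mem hm hts
        have bern : 1 + (1 + 1 / m) * (-t) ≤ (1 + -t) ^ (1 + 1 / m) :=
          one_add_mul_self_le_rpow_one_add (by linarith [hts.2]) (by
            have : 0 < 1 / m := by positivity
            linarith)
        rw [← sub_eq_add_neg (1:ℝ) t] at bern
        have hh1 : h ((1 - t) ^ (1 + 1 / m)) ≤ K * ((1 + 1 / m) * t) := by
          refine (le_abs_self _).trans ((hK _ hu).trans ?_)
          gcongr; linarith
        have k1 : m * (1 - t) ^ m * h ((1 - t) ^ (1 + 1 / m)) ≤ m * 1 * (K * ((1 + 1 / m) * t)) := by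
          have ht0 := ht.1
          calc m * (1 - t) ^ m * h ((1 - t) ^ (1 + 1 / m))
              ≤ m * (1 - t) ^ m * (K * ((1 + 1 / m) * t)) := by gcongr
            _ ≤ _ := by gcongr
        have k2 : c * b * (C * t) ≤ c * (1 - t) ^ (1 / m) * (max 0 (y t)) ^ (1 / p) := by gcongr
        have k3 : c * b * (C * t) = m * 1 * (K * ((1 + 1 / m) * t)) := by
          rw [hC]; field_simp
        have k4 : 0 ≤ γ * (m * (1 - t) ^ m) * (max 0 (y t)) ^ (1 - 1 / p) := by positivity
        have k5 : 0 ≤ C * 1 * p * (C * t) ^ (p - 1) := by positivity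
        have k6 : fwG m p h c γ t (y t) ≤ 0 := by
          unfold fwG
          apply mul_nonpos_of_nonneg_of_nonpos hQ.le
          linarith
        linarith)
  intro t ht
  simpa using this t ht

lemma fw_bij {E : ℝ → ℝ} (hE : ContinuousOn E (Ioo 0 1)) (hpos : ∀ t ∈ Ioo (0:ℝ) 1, 0 < E t)
    {ρ C e c0 : ℝ} (hρ0 : 0 < ρ) (hρ1 : ρ ≤ 1) (hC : 0 ≤ C) (he : 0 < e) (hc0 : 0 < c0)
    (hup : ∀ t ∈ Ioo (0:ℝ) 1, 1 - ρ ≤ t → E t ≤ C * (1 - t) ^ (e - 1))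
    (hlow : ∀ t ∈ Ioo (0:ℝ) 1, t ≤ 1 / 2 → c0 / t ≤ E t) :
    ∃ T : ℝ → ℝ, (∀ ξ < 0, T ξ ∈ Ioo (0:ℝ) 1 ∧ HasDerivAt T (E (T ξ))⁻¹ ξ) ∧
      StrictMonoOn T (Iio 0) ∧ Tendsto T (𝓝[<] 0) (𝓝 1) ∧ Tendsto T atBot (𝓝 0) := by
  set X := fun t : ℝ => ∫ s in (1/2:ℝ)..t, E s with hX
  have half : (1/2:ℝ) ∈ Ioo (0:ℝ) 1 := by norm_num
  have hXd : ∀ t ∈ Ioo (0:ℝ) 1, HasDerivAt X (E t) t := by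
    intro t ht
    refine intervalIntegral.integral_hasDerivAt_right
      (ContinuousOn.intervalIntegrable (hE.mono (ordConnected_Ioo.uIcc_subset half ht))) ?_
      (hE.continuousAt (isOpen_Ioo.mem_nhds ht))
    exact hE.stronglyMeasurableAtFilter isOpen_Ioo t ht
  have hXc : ContinuousOn X (Ioo 0 1) := fun t ht => (hXd t ht).continuousAt.continuousWithinAt
  have hXm : StrictMonoOn X (Ioo 0 1) := by
    apply strictMonoOn_of_deriv_pos (convex_Ioo 0 1) hXc
    intro t ht
    rw [interior_Ioo] at ht
    rw [(hXd t ht).deriv]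
    exact hpos t ht
  -- upper bound
  have hbdd : BddAbove (X '' Ioo 0 1) := by
    set t0 := 1 - ρ / 2 with ht0
    have ht0m : t0 ∈ Ioo (0:ℝ) 1 := ⟨by linarith, by linarith⟩
    have anti : AntitoneOn (fun t => X t + C / e * (1 - t) ^ e) (Ico t0 1) := by
      have hd : ∀ t ∈ Ico t0 1, HasDerivAt (fun t => X t + C / e * (1 - t) ^ e)
          (E t - C * (1 - t) ^ (e - 1)) t := by
        intro t ht
        have h1 : HasDerivAt (fun t : ℝ => (1 - t) ^ e) (-1 * e * (1 - t) ^ (e - 1)) t :=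
          ((hasDerivAt_id' t).const_sub 1).rpow_const (Or.inl (by linarith [ht.2]))
        refine ((hXd t ⟨ht0m.1.trans_le ht.1, ht.2⟩).fun_add (h1.const_mul (C / e))).congr_deriv ?_
        field_simp; ring
      apply antitoneOn_of_deriv_nonpos (convex_Ico _ _)
        (fun t ht => (hd t ht).continuousAt.continuousWithinAt)
      · intro t ht
        exact (hd t (interior_subset ht)).differentiableAt.differentiableWithinAt
      · intro t ht
        have ht := interior_subset ht
        rw [(hd t ht).deriv]
        linarith [hup t ⟨ht0m.1.trans_le ht.1, ht.2⟩ (by linarith [ht.1])]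
    refine ⟨X t0 + C / e * (1 - t0) ^ e, ?_⟩
    rintro _ ⟨t, ht, rfl⟩
    have hnn : ∀ t, t ≤ 1 → 0 ≤ C / e * (1 - t) ^ e := fun t ht =>
      mul_nonneg (by positivity) (Real.rpow_nonneg (by linarith) _)
    rcases le_total t t0 with hle | hle
    · have := hXm.monotoneOn ht ht0m hle
      linarith [hnn t0 ht0m.2.le]
    · have := anti ⟨le_rfl, ht0m.2⟩ ⟨hle, ht.2⟩ hle
      simp only at this
      linarith [hnn t ht.2.le]
  -- lower behaviour
  have hlowX : ∀ t ∈ Ioc (0:ℝ) (1/2), X t ≤ X (1/2) - c0 * Real.log (1/2) + c0 * Real.log t := by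
    have mono : MonotoneOn (fun t => X t - c0 * Real.log t) (Ioc (0:ℝ) (1/2)) := by
      have hd : ∀ t ∈ Ioc (0:ℝ) (1/2), HasDerivAt (fun t => X t - c0 * Real.log t)
          (E t - c0 * t⁻¹) t := by
        intro t ht
        exact (hXd t ⟨ht.1, by linarith [ht.2]⟩).fun_sub ((Real.hasDerivAt_log ht.1.ne').const_mul c0)
      apply monotoneOn_of_deriv_nonneg (convex_Ioc _ _)
        (fun t ht => (hd t ht).continuousAt.continuousWithinAt)
      · intro t ht
        exact (hd t (interior_subset ht)).differentiableAt.differentiableWithinAt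
      · intro t ht
        have ht := interior_subset ht
        rw [(hd t ht).deriv]
        have := hlow t ⟨ht.1, by linarith [ht.2]⟩ ht.2
        rw [div_eq_mul_inv] at this
        linarith
    intro t ht
    have := mono ht ⟨by norm_num, le_rfl⟩ ht.2
    simp only at this
    linarith
  set S := sSup (X '' Ioo 0 1) with hS
  have hne : (X '' Ioo 0 1).Nonempty := ⟨_, mem_image_of_mem X half⟩
  have himg : (fun t => X t - S) '' Ioo 0 1 = Iio 0 := by
    ext x
    constructor
    · rintro ⟨t, ht, rfl⟩
      have ht2 : (t + 1) / 2 ∈ Ioo (0:ℝ) 1 := ⟨by linarith [ht.1], by linarith [ht.2]⟩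
      have h1 := hXm ht ht2 (by linarith [ht.2])
      have h2 := le_csSup hbdd (mem_image_of_mem X ht2)
      show X t - S < 0
      linarith
    · intro hx
      have hx : x < 0 := hx
      obtain ⟨_, ⟨t1, ht1, rfl⟩, h1⟩ := exists_lt_of_lt_csSup hne (show S + x < S by linarith)
      have hlim : Tendsto (fun t => X (1/2) - c0 * Real.log (1/2) + c0 * Real.log t) (𝓝[>] 0) atBot :=
        tendsto_atBot_add_const_left _ _ (Real.tendsto_log_nhdsGT_zero.const_mul_atBot hc0)
      obtain ⟨t2, ht2, ht2'⟩ := ((hlim.eventually (eventually_le_atBot (S + x))).and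
        (Ioc_mem_nhdsGT (show (0:ℝ) < 1/2 by norm_num))).exists
      have h2 := hlowX t2 ht2'
      have ht2m : t2 ∈ Ioo (0:ℝ) 1 := ⟨ht2'.1, by linarith [ht2'.2]⟩
      obtain ⟨t, ht, hh⟩ := isPreconnected_Ioo.intermediate_value ht2m ht1 hXc
        (show S + x ∈ Icc (X t2) (X t1) from ⟨h2.trans ht2, h1.le⟩)
      exact ⟨t, ht, by simp only [hh]; ring⟩
  obtain ⟨T, hT, hTi, hTm⟩ := fw_inv (f := fun t => X t - S) (f' := E) isOpen_Ioo isOpen_Iio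
    (fun a ha b hb hab => sub_lt_sub_right (hXm ha hb hab) S) himg
    (fun t ht => (hXd t ht).sub_const S) (fun t ht => (hpos t ht).ne')
  have hmem : ∀ t ∈ Ioo (0:ℝ) 1, X t - S ∈ Iio (0:ℝ) := fun t ht => himg ▸ ⟨t, ht, rfl⟩
  refine ⟨T, fun ξ hξ => ⟨(hT ξ hξ).1, (hT ξ hξ).2.2⟩, hTm, ?_, ?_⟩
  · rw [tendsto_order]
    constructor
    · intro b hb
      set t := max b (1/2) with ht
      have htm : t ∈ Ioo (0:ℝ) 1 := ⟨lt_max_of_lt_right (by norm_num), max_lt hb (by norm_num)⟩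
      filter_upwards [Ioo_mem_nhdsLT (hmem t htm)] with ξ hξ
      have := hTm (hmem t htm) hξ.2 hξ.1
      rw [hTi t htm] at this
      exact (le_max_left _ _).trans_lt this
    · intro b hb
      filter_upwards [self_mem_nhdsWithin] with ξ hξ
      exact (hT ξ hξ).1.2.trans hb
  · rw [tendsto_order]
    constructor
    · intro b hb
      filter_upwards [eventually_lt_atBot 0] with ξ hξ
      exact hb.trans (hT ξ hξ).1.1
    · intro b hb
      set t := min b (1/2) with ht
      have htm : t ∈ Ioo (0:ℝ) 1 := ⟨lt_min hb (by norm_num), min_lt_of_right_lt (by norm_num)⟩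
      filter_upwards [eventually_lt_atBot (X t - S)] with ξ hξ
      have := hTm (show ξ ∈ Iio (0:ℝ) from lt_trans hξ (hmem t htm)) (hmem t htm) hξ
      rw [hTi t htm] at this
      exact this.trans_le (min_le_left _ _)


lemma fw_wave_of_T {m p c γ : ℝ} {h y T : ℝ → ℝ} (hm : 0 < m) (hp : 1 < p)
    (hh : ContinuousOn h (Icc 0 1))
    (hy : FwSol m p h c γ y) (hy1 : y 1 = 0) (hpos : ∀ t ∈ Ioo (0:ℝ) 1, 0 < y t)
    (hT : ∀ ξ < 0, T ξ ∈ Ioo (0:ℝ) 1 ∧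
      HasDerivAt T ((m + 1) * (1 - T ξ) ^ m * (y (T ξ)) ^ (-(1 / p)))⁻¹ ξ)
    (hTm : StrictMonoOn T (Iio 0)) (hT0 : Tendsto T (𝓝[<] 0) (𝓝 1))
    (hT1 : Tendsto T atBot (𝓝 0)) :
    FiniteWavefront m p h c γ (fun ξ => if ξ < 0 then (1 - T ξ) ^ (1 + 1 / m) else 0) := by
  have hp1 : 0 < p - 1 := by linarith
  have hp0 : 0 < p := by linarith
  have hq : 0 < 1 + 1 / m := by positivity
  have hip : 1 / p < 1 := by rw [div_lt_one hp0]; exact hp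
  set U : ℝ → ℝ := fun ξ => if ξ < 0 then (1 - T ξ) ^ (1 + 1 / m) else 0 with hU
  have Uneg : ∀ ξ < 0, U ξ = (1 - T ξ) ^ (1 + 1 / m) := fun ξ hξ => by simp [hU, hξ]
  have Upos : ∀ ξ, 0 ≤ ξ → U ξ = 0 := fun ξ hξ => by simp [hU, not_lt.2 hξ]
  have hnhds : ∀ ξ < (0:ℝ), ∀ᶠ x in 𝓝 ξ, x < 0 := fun ξ hξ => Iio_mem_nhds hξ
  -- y derivative on the open interval
  have hyd : ∀ t ∈ Ioo (0:ℝ) 1, HasDerivAt y (fwG m p h c γ t (y t)) t := fun t ht =>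
    (hy.2 t (Ioo_subset_Icc_self ht)).hasDerivAt (Icc_mem_nhds ht.1 ht.2)
  have hyc : ContinuousOn y (Ioo 0 1) := fun t ht => (hyd t ht).continuousAt.continuousWithinAt
  have hGc : ContinuousOn (fun t => fwG m p h c γ t (y t)) (Ioo 0 1) := by
    have e1 : Continuous (fun t : ℝ => (1 - t) ^ m) :=
      Continuous.rpow_const (by fun_prop) (fun _ => Or.inr hm.le)
    have e2 : Continuous (fun t : ℝ => (1 - t) ^ (1 + 1 / m)) :=
      Continuous.rpow_const (by fun_prop) (fun _ => Or.inr hq.le)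
    have e4 : Continuous (fun t : ℝ => (1 - t) ^ (1 / m)) :=
      Continuous.rpow_const (by fun_prop) (fun _ => Or.inr (by positivity))
    have e3 : ContinuousOn (fun t : ℝ => h ((1 - t) ^ (1 + 1 / m))) (Ioo 0 1) :=
      hh.comp e2.continuousOn (fun t ht => fw_rq_mem hm (Ioo_subset_Icc_self ht))
    have e5 : ContinuousOn (fun t => max 0 (y t)) (Ioo 0 1) := continuousOn_const.sup hyc
    have e6 : ContinuousOn (fun t => (max 0 (y t)) ^ (1 / p)) (Ioo 0 1) :=
      e5.rpow_const (fun _ _ => Or.inr (by positivity))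
    have e7 : ContinuousOn (fun t => (max 0 (y t)) ^ (1 - 1 / p)) (Ioo 0 1) :=
      e5.rpow_const (fun _ _ => Or.inr (by linarith))
    unfold fwG
    exact (((((e1.continuousOn.const_mul m).mul e3).sub ((e4.continuousOn.const_mul c).mul e6)).sub
      (((e1.continuousOn.const_mul m).const_mul γ).mul e7))).const_mul _
  have hyC1 : ContDiffOn ℝ 1 y (Ioo 0 1) := by
    rw [show (1 : WithTop ℕ∞) = 0 + 1 by rfl, contDiffOn_succ_iff_deriv_of_isOpen isOpen_Ioo]
    refine ⟨fun t ht => (hyd t ht).differentiableAt.differentiableWithinAt, by simp, ?_⟩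
    rw [contDiffOn_zero]
    exact hGc.congr (fun t ht => (hyd t ht).deriv)
  have hTmaps : MapsTo T (Iio 0) (Ioo 0 1) := fun ξ hξ => (hT ξ hξ).1
  have hTc : ContinuousOn T (Iio 0) := fun ξ hξ => (hT ξ hξ).2.continuousAt.continuousWithinAt
  -- derivative of T, nicer form
  have hTd : ∀ ξ < 0, HasDerivAt T ((m + 1)⁻¹ * ((1 - T ξ) ^ (-m) * (y (T ξ)) ^ (1 / p))) ξ := by
    intro ξ hξ
    obtain ⟨hm1, hd⟩ := hT ξ hξ
    refine hd.congr_deriv ?_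
    rw [Real.rpow_neg (show 0 ≤ 1 - T ξ by linarith [hm1.2]), Real.rpow_neg (hpos _ hm1).le, mul_inv, mul_inv, inv_inv]
    ring
  have hyTc : ContinuousOn (fun ξ => y (T ξ)) (Iio 0) := hyc.comp hTc hTmaps
  have hTC1 : ContDiffOn ℝ 1 T (Iio 0) := by
    rw [show (1 : WithTop ℕ∞) = 0 + 1 by rfl, contDiffOn_succ_iff_deriv_of_isOpen isOpen_Iio]
    refine ⟨fun t ht => (hTd t ht).differentiableAt.differentiableWithinAt, by simp, ?_⟩
    rw [contDiffOn_zero]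
    refine ContinuousOn.congr (ContinuousOn.const_mul (ContinuousOn.mul ?_ ?_) _)
      (fun ξ hξ => (hTd ξ hξ).deriv)
    · have hs : ContinuousOn (fun ξ => 1 - T ξ) (Iio 0) := continuousOn_const.sub hTc
      exact hs.rpow_const (fun ξ hξ => Or.inl (sub_pos.2 (hTmaps hξ).2).ne')
    · exact hyTc.rpow_const (fun ξ hξ => Or.inr (by positivity))
  have hUd : ∀ ξ < 0, HasDerivAt U
      (-(1 / m) * ((1 - T ξ) ^ (1 / m - m) * (y (T ξ)) ^ (1 / p))) ξ := by
    intro ξ hξ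
    have hm1 := hTmaps hξ
    have hr : 0 < 1 - T ξ := by linarith [hm1.2]
    have h1 := ((hTd ξ hξ).const_sub 1).rpow_const (p := 1 + 1 / m) (Or.inl hr.ne')
    refine (h1.congr_of_eventuallyEq ?_).congr_deriv ?_
    · filter_upwards [hnhds ξ hξ] with x hx using Uneg x hx
    · rw [show 1 / m - m = -m + (1 + 1 / m - 1) by ring, Real.rpow_add hr]
      have : (m + 1) ≠ 0 := by positivity
      field_simp
  have hUmd : ∀ ξ < 0, HasDerivAt (fun x => U x ^ m) (-(y (T ξ)) ^ (1 / p)) ξ := by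
    intro ξ hξ
    have hm1 := hTmaps hξ
    have hr : 0 < 1 - T ξ := by linarith [hm1.2]
    have h1 := ((hTd ξ hξ).const_sub 1).rpow_const (p := m + 1) (Or.inl hr.ne')
    refine (h1.congr_of_eventuallyEq ?_).congr_deriv ?_
    · filter_upwards [hnhds ξ hξ] with x hx
      rw [Uneg x hx, ← Real.rpow_mul (by linarith [(hTmaps hx).2])]
      congr 1; field_simp
    · rw [add_sub_cancel_right, Real.rpow_neg hr.le]
      have : (m + 1) ≠ 0 := by positivity
      have : (1 - T ξ) ^ m ≠ 0 := by positivity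
      field_simp
  have hfl : ∀ ξ < 0, flux m p U ξ = (y (T ξ)) ^ (1 - 1 / p) := by
    intro ξ hξ
    have hyp := hpos _ (hTmaps hξ)
    unfold flux
    rw [(hUmd ξ hξ).deriv, abs_neg, abs_of_nonneg (by positivity), ← Real.rpow_mul hyp.le]
    congr 1; field_simp
  have hfld : ∀ ξ < 0, HasDerivAt (flux m p U)
      (h (U ξ) - γ * (y (T ξ)) ^ (1 - 1 / p) -
        c * (1 / m * ((1 - T ξ) ^ (1 / m - m) * (y (T ξ)) ^ (1 / p)))) ξ := by
    intro ξ hξ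
    have hm1 := hTmaps hξ
    have hr : 0 < 1 - T ξ := by linarith [hm1.2]
    have hyp := hpos _ hm1
    have h0 : HasDerivAt (fun x => y (T x)) _ ξ := (hyd _ hm1).comp ξ (hTd ξ hξ)
    have h1 := h0.rpow_const (p := 1 - 1 / p) (Or.inl hyp.ne')
    refine (h1.congr_of_eventuallyEq ?_).congr_deriv ?_
    · filter_upwards [hnhds ξ hξ] with x hx using hfl x hx
    · rw [Uneg ξ hξ]
      unfold fwG
      generalize h ((1 - T ξ) ^ (1 + 1 / m)) = H
      rw [max_eq_right hyp.le, show 1 / m - m = -m + 1 / m by ring, Real.rpow_add hr,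
        Real.rpow_neg hr.le, show 1 - 1 / p - 1 = -(1 / p) by ring, Real.rpow_neg hyp.le]
      have g1 : (1 - T ξ) ^ m ≠ 0 := by positivity
      have g2 : (y (T ξ)) ^ (1 / p) ≠ 0 := by positivity
      have g3 : m + 1 ≠ 0 := by positivity
      have g4 : p - 1 ≠ 0 := hp1.ne'
      clear h0 h1
      generalize (1 - T ξ) ^ m = R at *
      generalize (y (T ξ)) ^ (1 / p) = Y at *
      generalize (y (T ξ)) ^ (1 - 1 / p) = Z at *
      generalize (1 - T ξ) ^ (1 / m) = R1 at *
      field_simp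
      ring
  have hU0 : Tendsto U (𝓝[<] 0) (𝓝 0) := by
    have h1 : Tendsto (fun ξ => (1 - T ξ) ^ (1 + 1 / m)) (𝓝[<] 0) (𝓝 ((1 - 1) ^ (1 + 1 / m))) :=
      (hT0.const_sub 1).rpow_const (Or.inr hq.le)
    rw [sub_self, Real.zero_rpow hq.ne'] at h1
    refine h1.congr' ?_
    filter_upwards [self_mem_nhdsWithin] with x hx using (Uneg x hx).symm
  refine ⟨?_, ?_, Upos, ?_, ?_, ?_, ?_, ?_, ?_⟩
  · rw [continuous_iff_continuousAt]
    intro ξ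
    rcases lt_trichotomy ξ 0 with h | h | h
    · exact (hUd ξ h).continuousAt
    · subst h
      rw [continuousAt_iff_continuous_left'_right']
      constructor
      · show Tendsto U _ (𝓝 (U 0))
        rw [Upos 0 le_rfl]; exact hU0
      · show Tendsto U _ (𝓝 (U 0))
        rw [Upos 0 le_rfl]
        refine tendsto_const_nhds.congr' ?_
        filter_upwards [self_mem_nhdsWithin] with x hx using (Upos x (le_of_lt hx)).symm
    · refine (continuousAt_const (y := (0:ℝ))).congr ?_
      filter_upwards [Ioi_mem_nhds h] with x hx using (Upos x (le_of_lt hx)).symm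
  · intro x z hxz
    by_cases hz : z < 0
    · have hx : x < 0 := lt_of_le_of_lt hxz hz
      rw [Uneg x hx, Uneg z hz]
      have := hTm.monotoneOn hx hz hxz
      exact Real.rpow_le_rpow (by linarith [(hTmaps hz).2]) (by linarith) hq.le
    · rw [Upos z (not_lt.1 hz)]
      by_cases hx : x < 0
      · rw [Uneg x hx]; exact Real.rpow_nonneg (by linarith [(hTmaps hx).2]) _
      · rw [Upos x (not_lt.1 hx)]
  · intro ξ hξ
    rw [Uneg ξ hξ]; exact Real.rpow_pos_of_pos (by linarith [(hTmaps hξ).2]) _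
  · intro ξ hξ
    rw [Uneg ξ hξ]
    exact Real.rpow_lt_one (by linarith [(hTmaps hξ).2]) (by linarith [(hTmaps hξ).1]) hq
  · have h1 : Tendsto (fun ξ => (1 - T ξ) ^ (1 + 1 / m)) atBot (𝓝 ((1 - 0) ^ (1 + 1 / m))) :=
      (hT1.const_sub 1).rpow_const (Or.inr hq.le)
    rw [sub_zero, Real.one_rpow] at h1
    refine h1.congr' ?_
    filter_upwards [eventually_lt_atBot 0] with x hx using (Uneg x hx).symm
  · rw [show (2 : WithTop ℕ∞) = 1 + 1 by rfl, contDiffOn_succ_iff_deriv_of_isOpen isOpen_Iio]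
    refine ⟨fun t ht => (hUd t ht).differentiableAt.differentiableWithinAt, by simp, ?_⟩
    refine ContDiffOn.congr ?_ (fun ξ hξ => (hUd ξ hξ).deriv)
    refine contDiffOn_const.mul (ContDiffOn.mul ?_ ?_)
    · exact (contDiffOn_const.sub hTC1).rpow_const_of_ne
        (fun ξ hξ => by have := (hTmaps hξ).2; simp only [ne_eq]; linarith)
    · exact (hyC1.comp hTC1 hTmaps).rpow_const_of_ne (fun ξ hξ => (hpos _ (hTmaps hξ)).ne')
  · have h1 : Tendsto (fun ξ => y (T ξ)) (𝓝[<] 0) (𝓝 (y 1)) := by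
      have : Tendsto y (𝓝[Icc 0 1] 1) (𝓝 (y 1)) := (hy.2 1 (by simp)).continuousWithinAt
      refine this.comp (tendsto_nhdsWithin_iff.2 ⟨hT0, ?_⟩)
      filter_upwards [self_mem_nhdsWithin] with x hx using Ioo_subset_Icc_self (hTmaps hx)
    have h2 := h1.rpow_const (p := 1 - 1 / p) (Or.inr (by linarith))
    rw [hy1, Real.zero_rpow (by linarith)] at h2
    refine h2.congr' ?_
    filter_upwards [self_mem_nhdsWithin] with x hx using (hfl x hx).symm
  · intro ξ hξ
    rw [(hfld ξ hξ).deriv, (hUd ξ hξ).deriv, hfl ξ hξ]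
    ring

lemma fw_wave_exists {m p c γ K ρ : ℝ} {h y : ℝ → ℝ} (hm : 0 < m) (hp : 1 < p)
    (hmp : 1 < m * (p - 1)) (hc : 0 < c) (hγ : 0 ≤ γ) (hh : ContinuousOn h (Icc 0 1))
    (hK0 : 0 < K) (hK : ∀ u ∈ Icc (0:ℝ) 1, |h u| ≤ K * (1 - u))
    (hρ0 : 0 < ρ) (hρ1 : ρ ≤ 1)
    (hy : FwSol m p h c γ y) (hy1 : y 1 = 0) (hpos : ∀ t ∈ Ioo (0:ℝ) 1, 0 < y t)
    (hlow : ∀ r ∈ Icc (0:ℝ) ρ,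
      (c / 4) ^ (p / (p - 1)) * r ^ ((1 + 1 / m) * (p / (p - 1))) ≤ y (1 - r)) :
    ∃ U, FiniteWavefront m p h c γ U := by
  have hp1 : 0 < p - 1 := by linarith
  have hp0 : 0 < p := by linarith
  have hmp' : 0 < m - 1 / (p - 1) := by
    rw [sub_pos, div_lt_iff₀ hp1]; exact hmp
  obtain ⟨C, hC0, hC⟩ := fw_sol_upper hm hp hc hγ hK0 hK hy
  have hyc : ContinuousOn y (Ioo 0 1) := fun t ht =>
    ((hy.2 t (Ioo_subset_Icc_self ht)).hasDerivAt (Icc_mem_nhds ht.1 ht.2)).continuousAt.continuousWithinAt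
  obtain ⟨T, hT, hTm, hT0, hT1⟩ := fw_bij
    (E := fun t => (m + 1) * (1 - t) ^ m * (y t) ^ (-(1 / p)))
    (ρ := ρ) (C := (m + 1) * ((c / 4) ^ (p / (p - 1))) ^ (-(1 / p)))
    (e := (1 + 1 / m) * (m - 1 / (p - 1))) (c0 := (m + 1) * (1 / 2) ^ m * C⁻¹)
    (by
      refine ContinuousOn.mul (ContinuousOn.const_mul ?_ _) ?_
      · exact (continuousOn_const.sub continuousOn_id).rpow_const (fun _ _ => Or.inr hm.le)
      · exact hyc.rpow_const (fun t ht => Or.inl (hpos t ht).ne'))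
    (by
      intro t ht
      have h1 := hpos t ht
      have h2 : 0 < 1 - t := by linarith [ht.2]
      positivity) hρ0 hρ1 (by positivity) (by positivity) (by positivity)
    (by
      intro t ht htρ
      have h2 : 0 < 1 - t := by linarith [ht.2]
      have h3 := hlow (1 - t) ⟨h2.le, by linarith⟩
      rw [sub_sub_cancel] at h3
      have h4 := Real.rpow_le_rpow_of_nonpos (by positivity) h3
        (show -(1 / p) ≤ 0 by have : 0 < 1 / p := by positivity
                              linarith)
      rw [Real.mul_rpow (by positivity) (by positivity), ← Real.rpow_mul h2.le] at h4
      calc (m + 1) * (1 - t) ^ m * (y t) ^ (-(1 / p)) ≤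
          (m + 1) * (1 - t) ^ m * (((c / 4) ^ (p / (p - 1))) ^ (-(1 / p)) *
            (1 - t) ^ ((1 + 1 / m) * (p / (p - 1)) * (-(1 / p)))) := by gcongr
        _ = (m + 1) * ((c / 4) ^ (p / (p - 1))) ^ (-(1 / p)) * ((1 - t) ^ m *
            (1 - t) ^ ((1 + 1 / m) * (p / (p - 1)) * (-(1 / p)))) := by ring
        _ = _ := by
          rw [← Real.rpow_add h2]
          congr 2; field_simp; ring)
    (by
      intro t ht ht2
      have h1 := hpos t ht
      have ht0 := ht.1
      have h3 := hC t ⟨ht.1.le, ht2⟩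
      have h4 := Real.rpow_le_rpow_of_nonpos h1 h3
        (show -(1 / p) ≤ 0 by have : 0 < 1 / p := by positivity
                              linarith)
      rw [← Real.rpow_mul (by positivity), show p * (-(1 / p)) = -1 by field_simp,
        Real.rpow_neg_one] at h4
      have h5 : (1 / 2 : ℝ) ^ m ≤ (1 - t) ^ m :=
        Real.rpow_le_rpow (by norm_num) (by linarith) hm.le
      have h6 : 0 ≤ (1 - t) ^ m := Real.rpow_nonneg (by linarith) _
      calc (m + 1) * (1 / 2) ^ m * C⁻¹ / t = (m + 1) * (1 / 2) ^ m * (C * t)⁻¹ := by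
            rw [mul_inv]; ring
        _ ≤ _ := by
          have h7 : 0 ≤ (m + 1) * (1 - t) ^ m := by positivity
          gcongr)
  exact ⟨_, fw_wave_of_T hm hp hh hy hy1 hpos hT hTm hT0 hT1⟩

/-- There is `γ* > 0` such that for every `γ ∈ [0, γ*)` there is exactly one pair
`(c, U)` with `c > 0` and `U` a finite wavefront with speed `c` and convection `γ`. -/
theorem statement0 (m p a : ℝ) (h : ℝ → ℝ)
    (hm : 0 < m) (hp : 1 < p) (hmp : 1 < m * (p - 1))
    (ha0 : 0 ≤ a) (ha1 : a < 1)
    (hhC1 : ContDiffOn ℝ 1 h (Ici 0))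
    (hh0 : h 0 = 0)
    (hhneg : ∀ u ∈ Icc (0 : ℝ) a, h u ≤ 0)
    (hhpos : ∀ u ∈ Ioo a (1 : ℝ), 0 < h u)
    (hhgt : ∀ u : ℝ, 1 < u → h u < 0)
    (hh1 : deriv h 1 < 0)
    (hint : 0 < ∫ u in (0:ℝ)..1, u ^ (m - 1) * h u) :
    ∃ γstar > (0 : ℝ), ∀ γ : ℝ, 0 ≤ γ → γ < γstar →
      ∃! cU : ℝ × (ℝ → ℝ), 0 < cU.1 ∧ FiniteWavefront m p h cU.1 γ cU.2 := by
  have hp1 : 0 < p - 1 := by linarith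
  have hp0 : 0 < p := by linarith
  have hcI : ContinuousOn h (Ici 0) := hhC1.continuousOn
  have hh : ContinuousOn h (Icc 0 1) := hcI.mono Icc_subset_Ici_self
  have hat1 : ContinuousAt h 1 := hcI.continuousAt (Ici_mem_nhds one_pos)
  have h1 : h 1 = 0 := by
    apply le_antisymm
    · refine le_of_tendsto (hat1.tendsto.mono_left nhdsWithin_le_nhds : Tendsto h (𝓝[>] 1) _) ?_
      filter_upwards [self_mem_nhdsWithin] with x hx using (hhgt x hx).le
    · refine ge_of_tendsto (hat1.tendsto.mono_left nhdsWithin_le_nhds : Tendsto h (𝓝[<] 1) _) ?_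
      filter_upwards [Ioo_mem_nhdsLT ha1] with x hx using (hhpos x hx).le
  obtain ⟨K, hK0, hKl⟩ : ∃ K > 0, ∀ x ∈ Icc (0:ℝ) 1, ∀ z ∈ Icc (0:ℝ) 1,
      |h x - h z| ≤ K * |x - z| := by
    have hdc : ContinuousOn (derivWithin h (Ici 0)) (Icc 0 1) :=
      (hhC1.continuousOn_derivWithin (uniqueDiffOn_Ici 0) le_rfl).mono Icc_subset_Ici_self
    obtain ⟨K, hK⟩ := isCompact_Icc.exists_bound_of_continuousOn hdc
    have hK0 : 0 ≤ K := (norm_nonneg _).trans (hK 0 (by simp))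
    refine ⟨K + 1, by positivity, fun x hx z hz => ?_⟩
    have hd : ∀ u ∈ Icc (0:ℝ) 1, HasDerivWithinAt h (derivWithin h (Ici 0) u) (Icc 0 1) u :=
      fun u hu => ((hhC1.differentiableOn one_ne_zero u hu.1).hasDerivWithinAt).mono
        Icc_subset_Ici_self
    have := (convex_Icc (0:ℝ) 1).norm_image_sub_le_of_norm_hasDerivWithin_le hd hK hz hx
    rw [Real.norm_eq_abs, Real.norm_eq_abs] at this
    nlinarith [abs_nonneg (x - z)]
  have hKa : ∀ u ∈ Icc (0:ℝ) 1, |h u| ≤ K * u := by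
    intro u hu
    have := hKl u hu 0 (by simp)
    rwa [hh0, sub_zero, sub_zero, abs_of_nonneg hu.1] at this
  have hKb : ∀ u ∈ Icc (0:ℝ) 1, |h u| ≤ K * (1 - u) := by
    intro u hu
    have := hKl u hu 1 (by simp)
    rwa [h1, sub_zero, abs_sub_comm u 1, abs_of_nonneg (sub_nonneg.2 hu.2)] at this
  obtain ⟨M, hM, hex⟩ := fw_sol_exists (p := p) hm hp hh
  have hI := fw_integral_pos hm hp hint
  set I := ∫ t in (0:ℝ)..1, (1 + 1 / m) * (p / (p - 1)) *
      (m * (1 - t) ^ m * h ((1 - t) ^ (1 + 1 / m))) with hIdef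
  set D := (1 + 1 / m) * (p / (p - 1)) * (m * M ^ (1 - 1 / p)) with hD
  have hD0 : 0 ≤ D := by positivity
  refine ⟨I / (D + 1), by positivity, fun γ hγ hγs => ?_⟩
  have hpos0 : ∀ y, FwSol m p h 0 γ y → (∀ t ∈ Icc (0:ℝ) 1, y t ≤ M) → 0 < y 1 := by
    intro y hy hyM
    have h2 := fw_sol_c0 hm hp hh hγ hy hM hyM
    rw [← hIdef, ← hD] at h2
    rw [lt_div_iff₀ (by positivity)] at hγs
    rcases hγ.eq_or_lt with h3 | h3
    · rw [← h3] at h2; linarith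
    · nlinarith
  obtain ⟨c, hc, y, ρ, hρ0, hρ1, hy, hy1, hypos, hylow⟩ := fw_speed_exists hm hp hmp ha0 h1 hhneg
    hhpos hγ hK0 hKa hM (fun c hc => hex c γ hc hγ) hpos0
  obtain ⟨U, hW⟩ := fw_wave_exists hm hp hmp hc hγ hh hK0 hKb hρ0 hρ1 hy hy1 hypos hylow
  refine ⟨(c, U), ⟨hc, hW⟩, ?_⟩
  rintro ⟨c', U'⟩ ⟨hc', hW'⟩
  simp only at hc' hW'
  have hcc : c' = c := le_antisymm
    (fw_speed_le hm hp hγ hc' hc hhneg hhpos hKa hK0.le hW' hW)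
    (fw_speed_le hm hp hγ hc hc' hhneg hhpos hKa hK0.le hW hW')
  subst hcc
  exact Prod.ext rfl (fw_unique hm hp hγ hc hhneg hhpos hW' hW)
end

section
/- Let U be a finite wavefront with speed c > 0 and convection parameter γ ≥ 0 whose flux φ additionally satisfies lim_{ξ→0⁻} φ(ξ)/U(ξ) = c. Then the pressure V := (m/(m−α)) U^{m−α} satisfies: (i) lim_{ξ→0⁻} V'(ξ) = −c^α; (ii) lim_{ξ→0⁻} V''(ξ) = (γ c − h'(0)) (m−α) / ((p−1)(m−α+1) c^{1−α}); and (iii) lim_{ξ→0⁻} (p−1) |V'(ξ)|^{p−2} V''(ξ) = (γ c − h'(0)) (m−α) / (m−α+1). -/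
open Set Filter Topology

/-- Behaviour at the free boundary of the pressure `V = (m/(m-α)) U^{m-α}` of a finite
wavefront whose flux satisfies `φ(ξ)/U(ξ) → c` as `ξ → 0⁻`. -/
theorem statement1 (m p a α c γ : ℝ) (h U V : ℝ → ℝ)
    (hm : 0 < m) (hp : 1 < p) (hmp : 1 < m * (p - 1)) (hα : α = 1 / (p - 1))
    (ha0 : 0 ≤ a) (ha1 : a < 1)
    (hhC1 : ContDiffOn ℝ 1 h (Ici 0))
    (hh0 : h 0 = 0)
    (hhneg : ∀ u ∈ Icc (0 : ℝ) a, h u ≤ 0)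
    (hhpos : ∀ u ∈ Ioo a (1 : ℝ), 0 < h u)
    (hhgt : ∀ u : ℝ, 1 < u → h u < 0)
    (hh1 : deriv h 1 < 0)
    (hc : 0 < c) (hγ : 0 ≤ γ)
    (hU : FiniteWavefront m p h c γ U)
    (hflux : Tendsto (fun ξ => flux m p U ξ / U ξ) (nhdsWithin 0 (Iio 0)) (nhds c))
    (hV : V = fun ξ => m / (m - α) * U ξ ^ (m - α)) :
    Tendsto (deriv V) (nhdsWithin 0 (Iio 0)) (nhds (-(c ^ α))) ∧
    Tendsto (deriv (deriv V)) (nhdsWithin 0 (Iio 0))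
      (nhds ((γ * c - derivWithin h (Ici 0) 0) * (m - α) /
        ((p - 1) * (m - α + 1) * c ^ (1 - α)))) ∧
    Tendsto (fun ξ => (p - 1) * |deriv V ξ| ^ (p - 2) * deriv (deriv V) ξ)
      (nhdsWithin 0 (Iio 0))
      (nhds ((γ * c - derivWithin h (Ici 0) 0) * (m - α) / (m - α + 1))) := by
  have hp1 : 0 < p - 1 := by linarith
  have hαpos : 0 < α := by rw [hα]; positivity
  have hαp : (p - 1) * α = 1 := by rw [hα]; field_simp
  have hβ : 0 < m - α := by
    have : 0 < (m - α) * (p - 1) := by nlinarith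
    exact (pos_iff_pos_of_mul_pos this).2 hp1
  have hIio : ∀ᶠ ξ : ℝ in 𝓝[<] (0:ℝ), ξ < 0 := self_mem_nhdsWithin
  -- basic regularity
  have hUd : ∀ ξ < (0:ℝ), HasDerivAt U (deriv U ξ) ξ := fun ξ hξ =>
    ((hU.smooth.contDiffAt (Iio_mem_nhds hξ)).differentiableAt (by norm_num)).hasDerivAt
  have hUd2 : ∀ ξ < (0:ℝ), DifferentiableAt ℝ (deriv U) ξ := fun ξ hξ => by
    have h1 : ContDiffOn ℝ 1 (deriv U) (Iio 0) :=
      hU.smooth.deriv_of_isOpen isOpen_Iio (by norm_num)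
    exact (h1.contDiffAt (Iio_mem_nhds hξ)).differentiableAt (by norm_num)
  have hU'np : ∀ ξ, deriv U ξ ≤ 0 := fun ξ => hU.anti.deriv_nonpos
  have hpowd : ∀ (r : ℝ), ∀ ξ < (0:ℝ),
      HasDerivAt (fun x => U x ^ r) (deriv U ξ * r * U ξ ^ (r - 1)) ξ := fun r ξ hξ =>
    (hUd ξ hξ).rpow_const (Or.inl (hU.pos ξ hξ).ne')
  have hDm : ∀ ξ < (0:ℝ), deriv (fun x => U x ^ m) ξ = deriv U ξ * m * U ξ ^ (m - 1) :=
    fun ξ hξ => (hpowd m ξ hξ).deriv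
  have hφ : ∀ ξ < (0:ℝ), flux m p U ξ = (-(deriv U ξ * m * U ξ ^ (m - 1))) ^ (p - 1) := by
    intro ξ hξ
    unfold flux
    rw [hDm ξ hξ, abs_of_nonpos]
    have := Real.rpow_pos_of_pos (hU.pos ξ hξ) (m - 1)
    have h2 : deriv U ξ * m ≤ 0 := mul_nonpos_of_nonpos_of_nonneg (hU'np ξ) hm.le
    exact mul_nonpos_of_nonpos_of_nonneg h2 this.le
  have hVd : ∀ ξ < (0:ℝ), deriv V ξ = m * U ξ ^ (m - α - 1) * deriv U ξ := by
    intro ξ hξ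
    rw [hV, ((hpowd (m - α) ξ hξ).const_mul (m / (m - α))).deriv]
    field_simp
  have hVw : ∀ ξ < (0:ℝ), deriv V ξ = -((flux m p U ξ / U ξ) ^ α) := by
    intro ξ hξ
    have hu := hU.pos ξ hξ
    have hn : 0 ≤ -(deriv U ξ * m * U ξ ^ (m - 1)) := by
      have := Real.rpow_pos_of_pos hu (m - 1)
      have h2 : deriv U ξ * m ≤ 0 := mul_nonpos_of_nonpos_of_nonneg (hU'np ξ) hm.le
      have := mul_nonpos_of_nonpos_of_nonneg h2 this.le
      linarith
    rw [hVd ξ hξ, hφ ξ hξ, Real.div_rpow (Real.rpow_nonneg hn _) hu.le, ← Real.rpow_mul hn, hαp,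
      Real.rpow_one, show m - α - 1 = (m - 1) - α by ring, Real.rpow_sub hu]
    ring
  have hev : deriv V =ᶠ[𝓝[<] (0:ℝ)] fun ξ => -((flux m p U ξ / U ξ) ^ α) := by
    filter_upwards [hIio] with ξ hξ using hVw ξ hξ
  have hi : Tendsto (deriv V) (𝓝[<] 0) (𝓝 (-(c ^ α))) :=
    (((hflux.rpow_const (Or.inl hc.ne')).neg).congr' hev.symm)
  have hU0 : Tendsto U (𝓝[<] 0) (𝓝 0) := by
    have := hU.cont.tendsto 0
    rw [hU.eq_zero 0 le_rfl] at this
    exact this.mono_left nhdsWithin_le_nhds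
  -- h(U)/U
  set d := derivWithin h (Ici 0) 0 with hd
  have hhU : Tendsto (fun ξ => h (U ξ) / U ξ) (𝓝[<] 0) (𝓝 d) := by
    have h1 : HasDerivWithinAt h d (Ici 0) 0 :=
      ((hhC1.differentiableOn (by norm_num)) 0 (by simp)).hasDerivWithinAt
    rw [hasDerivWithinAt_iff_tendsto_slope] at h1
    have h2 : Tendsto U (𝓝[<] 0) (𝓝[Ici 0 \ {0}] 0) := by
      refine tendsto_nhdsWithin_iff.2 ⟨hU0, ?_⟩
      filter_upwards [hIio] with ξ hξ
      exact ⟨(hU.pos ξ hξ).le, (hU.pos ξ hξ).ne'⟩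
    refine (h1.comp h2).congr fun ξ => ?_
    simp [slope_def_field, hh0]
  have hwpos : ∀ᶠ ξ in 𝓝[<] (0:ℝ), 0 < flux m p U ξ / U ξ := hflux.eventually_const_lt hc
  -- flux differentiability
  have hφd : ∀ ξ < (0:ℝ), 0 < flux m p U ξ / U ξ →
      HasDerivAt (flux m p U) (c * deriv U ξ - γ * flux m p U ξ + h (U ξ)) ξ := by
    intro ξ hξ hw
    have hu := hU.pos ξ hξ
    have hdiff : DifferentiableAt ℝ (flux m p U) ξ := by
      have heq : flux m p U =ᶠ[𝓝 ξ] fun x => (-(deriv U x * m * U x ^ (m - 1))) ^ (p - 1) := by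
        filter_upwards [Iio_mem_nhds hξ] with x hx using hφ x hx
      refine DifferentiableAt.congr_of_eventuallyEq ?_ heq
      have hne : -(deriv U ξ * m * U ξ ^ (m - 1)) ≠ 0 := by
        intro h0
        rw [hφ ξ hξ, h0, Real.zero_rpow hp1.ne'] at hw
        simp at hw
      exact DifferentiableAt.rpow_const
        ((((hUd2 ξ hξ).mul_const m).mul (hpowd (m - 1) ξ hξ).differentiableAt).neg) (Or.inl hne)
    have := hdiff.hasDerivAt
    have he := hU.eqn ξ hξ
    refine this.congr_deriv ?_
    linarith
  set w : ℝ → ℝ := fun ξ => flux m p U ξ / U ξ with hwdef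
  set g := γ * c - d with hg
  have hk : 0 < c ^ α := Real.rpow_pos_of_pos hc α
  have hU'neg : ∀ ξ < (0:ℝ), 0 < w ξ → deriv U ξ < 0 := by
    intro ξ hξ hw
    refine lt_of_le_of_ne (hU'np ξ) fun h0 => ?_
    have := hVd ξ hξ
    rw [hVw ξ hξ, h0] at this
    have h3 := Real.rpow_pos_of_pos hw α
    simp only [hwdef] at h3
    linarith
  -- l Hopital rule
  have hG : Tendsto (fun ξ => -γ * w ξ + h (U ξ) / U ξ) (𝓝[<] 0) (𝓝 (-g)) := by
    have := (hflux.const_mul (-γ)).add hhU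
    convert this using 2
    rw [hg]; ring
  have hL : Tendsto (fun ξ => (flux m p U ξ - c * U ξ) / U ξ ^ (m - α + 1)) (𝓝[<] 0)
      (𝓝 (m * (-g) / ((m - α + 1) * (-(c ^ α))))) := by
    refine HasDerivAt.lhopital_zero_nhdsLT
      (f' := fun ξ => -γ * flux m p U ξ + h (U ξ))
      (g' := fun ξ => deriv U ξ * (m - α + 1) * U ξ ^ (m - α + 1 - 1)) ?_ ?_ ?_ ?_ ?_ ?_
    · filter_upwards [hIio, hwpos] with ξ hξ hw
      refine ((hφd ξ hξ hw).sub ((hUd ξ hξ).const_mul c)).congr_deriv ?_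
      ring
    · filter_upwards [hIio] with ξ hξ using hpowd _ ξ hξ
    · filter_upwards [hIio, hwpos] with ξ hξ hw
      have h1 := (hU'neg ξ hξ hw).ne
      have h2 := (Real.rpow_pos_of_pos (hU.pos ξ hξ) (m - α + 1 - 1)).ne'
      have h3 : m - α + 1 ≠ 0 := by linarith
      exact mul_ne_zero (mul_ne_zero h1 h3) h2
    · simpa using hU.flux_zero.sub (hU0.const_mul c)
    · have := hU0.rpow_const (p := m - α + 1) (Or.inr (by linarith))
      rwa [Real.zero_rpow (by linarith)] at this
    · have := (hG.const_mul m).div (hi.const_mul (m - α + 1))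
        (mul_ne_zero (by linarith) (by linarith))
      refine this.congr' ?_
      filter_upwards [hIio, hwpos] with ξ hξ hw
      have hu := hU.pos ξ hξ
      have h1 := (hU'neg ξ hξ hw).ne
      have h2 := (Real.rpow_pos_of_pos hu (m - α)).ne'
      have h3 : m - α + 1 ≠ 0 := by linarith
      simp only [Pi.div_apply]
      rw [hVd ξ hξ, Real.rpow_sub_one hu.ne', show m - α + 1 - 1 = m - α by ring]
      simp only [hwdef]
      field_simp
  -- derivative of w
  have hw' : ∀ ξ < (0:ℝ), 0 < w ξ → HasDerivAt w
      (-(flux m p U ξ - c * U ξ) / U ξ ^ (m - α + 1) * deriv V ξ / m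
        + (-γ * w ξ + h (U ξ) / U ξ)) ξ := by
    intro ξ hξ hw
    have hu := hU.pos ξ hξ
    have h2 := (Real.rpow_pos_of_pos hu (m - α)).ne'
    refine ((hφd ξ hξ hw).div (hUd ξ hξ) hu.ne').congr_deriv ?_
    rw [hVd ξ hξ, Real.rpow_sub_one hu.ne', Real.rpow_add_one hu.ne']
    simp only [hwdef]
    field_simp
    ring
  have hw'lim : Tendsto (fun ξ => -(flux m p U ξ - c * U ξ) / U ξ ^ (m - α + 1) * deriv V ξ / m
        + (-γ * w ξ + h (U ξ) / U ξ)) (𝓝[<] 0) (𝓝 (-(g * (m - α) / (m - α + 1)))) := by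
    have := (((hL.neg).mul hi).div_const m).add hG
    have h3 : m - α + 1 ≠ 0 := by linarith
    convert this using 2
    · ring
    · field_simp
      ring
  have hii : Tendsto (deriv (deriv V)) (𝓝[<] 0)
      (𝓝 (g * (m - α) / ((p - 1) * (m - α + 1) * c ^ (1 - α)))) := by
    have hlim := ((hw'lim.mul_const α).mul
      (hflux.rpow_const (p := α - 1) (Or.inl hc.ne'))).neg
    have hval : -(-(g * (m - α) / (m - α + 1)) * α * c ^ (α - 1)) =
        g * (m - α) / ((p - 1) * (m - α + 1) * c ^ (1 - α)) := by
      have h3 : m - α + 1 ≠ 0 := by linarith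
      rw [show α - 1 = -(1 - α) by ring, Real.rpow_neg hc.le]
      have h4 := (Real.rpow_pos_of_pos hc (1 - α)).ne'
      generalize c ^ (1 - α) = K at *
      rw [hα] at *
      field_simp
    rw [hval] at hlim
    refine hlim.congr' ?_
    filter_upwards [hIio, hwpos] with ξ hξ hw
    have he : deriv V =ᶠ[𝓝 ξ] fun x => -(w x ^ α) := by
      filter_upwards [Iio_mem_nhds hξ] with x hx using hVw x hx
    rw [he.deriv_eq]
    exact (((hw' ξ hξ hw).rpow_const (p := α) (Or.inl hw.ne')).neg).deriv.symm
  refine ⟨hi, hii, ?_⟩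
  have hab : |(-(c ^ α))| = c ^ α := by rw [abs_neg, abs_of_pos hk]
  have := ((hi.abs.rpow_const (p := p - 2) (Or.inl (by rw [hab]; exact hk.ne'))).const_mul
    (p - 1)).mul hii
  convert this using 2
  rw [hab, ← Real.rpow_mul hc.le, show α * (p - 2) = 1 - α by linarith]
  have h4 := (Real.rpow_pos_of_pos hc (1 - α)).ne'
  have h3 : m - α + 1 ≠ 0 := by linarith
  field_simp
end

section
/- Let U be a finite wavefront with speed c > 0 and convection parameter γ ≥ 0. Then the derivative of the pressure V := (m/(m−α)) U^{m−α} satisfies lim_{ξ→−∞} V'(ξ) = 0. -/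
open Set Filter Topology

/-- The derivative of the pressure `V = (m/(m-α)) U^{m-α}` of a finite wavefront
tends to `0` as `ξ → -∞`. -/
theorem statement2 (m p a α c γ : ℝ) (h U V : ℝ → ℝ)
    (hm : 0 < m) (hp : 1 < p) (hmp : 1 < m * (p - 1)) (hα : α = 1 / (p - 1))
    (ha0 : 0 ≤ a) (ha1 : a < 1)
    (hhC1 : ContDiffOn ℝ 1 h (Ici 0))
    (hh0 : h 0 = 0)
    (hhneg : ∀ u ∈ Icc (0 : ℝ) a, h u ≤ 0)
    (hhpos : ∀ u ∈ Ioo a (1 : ℝ), 0 < h u)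
    (hhgt : ∀ u : ℝ, 1 < u → h u < 0)
    (hh1 : deriv h 1 < 0)
    (hc : 0 < c) (hγ : 0 ≤ γ)
    (hU : FiniteWavefront m p h c γ U)
    (hV : V = fun ξ => m / (m - α) * U ξ ^ (m - α)) :
    Tendsto (deriv V) atBot (nhds 0) := by
  have hp1 : 0 < p - 1 := by linarith
  have hαm : m - α ≠ 0 := by
    have : α < m := by rw [hα, div_lt_iff₀ hp1]; exact hmp
    exact (sub_pos.2 this).ne'
  have hUd : ∀ x < (0:ℝ), HasDerivAt U (deriv U x) x := fun x hx =>
    ((hU.smooth.differentiableOn (by norm_num)).differentiableAt (Iio_mem_nhds hx)).hasDerivAt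
  set W : ℝ → ℝ := fun x => U x ^ m with hW
  have hWd : ∀ x < (0:ℝ), HasDerivAt W (deriv U x * m * U x ^ (m - 1)) x := fun x hx =>
    (hUd x hx).rpow_const (Or.inl (hU.pos x hx).ne')
  have hWs : ContDiffOn ℝ 2 W (Iio 0) :=
    hU.smooth.rpow_const_of_ne (fun x hx => (hU.pos x hx).ne')
  have hWs' : ∀ x < (0:ℝ), DifferentiableAt ℝ (deriv W) x := fun x hx =>
    (((contDiffOn_succ_iff_deriv_of_isOpen (n := 1) isOpen_Iio).1 hWs).2.2.differentiableOn
      (by norm_num)).differentiableAt (Iio_mem_nhds hx)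
  have hφ : ∀ x, flux m p U x = |deriv W x| ^ (p - 1) := fun x => rfl
  have hφ0 : ∀ x, 0 ≤ flux m p U x := fun x => by rw [hφ]; positivity
  have hUneg : ∀ x, deriv U x ≤ 0 := fun x => hU.anti.deriv_nonpos
  -- `h 1 = 0`
  have hhc : ContinuousAt h 1 := hhC1.continuousOn.continuousAt (Ici_mem_nhds one_pos)
  have h1 : h 1 = 0 := by
    apply le_antisymm
    · have t : Tendsto h (𝓝[>] 1) (𝓝 (h 1)) := hhc.tendsto.mono_left nhdsWithin_le_nhds
      refine le_of_tendsto t ?_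
      filter_upwards [self_mem_nhdsWithin] with x hx
      exact (hhgt x hx).le
    · have t : Tendsto h (𝓝[<] 1) (𝓝 (h 1)) := hhc.tendsto.mono_left nhdsWithin_le_nhds
      refine ge_of_tendsto t ?_
      filter_upwards [Ioo_mem_nhdsLT ha1] with x hx
      exact (hhpos x hx).le
  have hhU : Tendsto (fun x => h (U x)) atBot (𝓝 0) := by
    rw [← h1]; exact hhc.tendsto.comp hU.tendsto_one
  -- flux is differentiable near -∞
  obtain ⟨N, hN⟩ : ∃ N : ℝ, ∀ x ≤ N, x < 0 ∧ a < U x := by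
    have := (eventually_lt_atBot (0:ℝ)).and (hU.tendsto_one.eventually (lt_mem_nhds ha1))
    exact eventually_atBot.1 this
  have hne : ∀ x ≤ N, deriv W x ≠ 0 := by
    intro x hx h0
    obtain ⟨hx0, hxa⟩ := hN x hx
    have hf0 : flux m p U x = 0 := by
      rw [hφ, h0, abs_zero, Real.zero_rpow hp1.ne']
    have hd : deriv (flux m p U) x = 0 := by
      apply IsLocalMin.deriv_eq_zero
      exact Filter.Eventually.of_forall fun y => by rw [hf0]; exact hφ0 y
    have e := hU.eqn x hx0
    rw [hd, hf0] at e
    have hp' := hhpos (U x) ⟨hxa, hU.lt_one x hx0⟩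
    have hu' : deriv U x ≠ 0 := by
      intro h; rw [h] at e; linarith
    rw [(hWd x hx0).deriv] at h0
    exact (mul_ne_zero (mul_ne_zero hu' hm.ne') (Real.rpow_pos_of_pos (hU.pos x hx0) _).ne') h0
  have hfd : ∀ x ≤ N, DifferentiableAt ℝ (flux m p U) x := by
    intro x hx
    have : DifferentiableAt ℝ (fun y => |deriv W y| ^ (p - 1)) x :=
      ((hWs' x (hN x hx).1).abs (hne x hx)).rpow_const (Or.inl (abs_ne_zero.2 (hne x hx)))
    exact this
  have hfle : ∀ x ≤ N, deriv (flux m p U) x ≤ h (U x) := by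
    intro x hx
    have e := hU.eqn x (hN x hx).1
    have := mul_nonneg hγ (hφ0 x)
    have := mul_nonneg hc.le (neg_nonneg.2 (hUneg x))
    linarith
  -- increments of W tend to zero
  have hWt : Tendsto W atBot (𝓝 1) := by
    have := hU.tendsto_one.rpow_const (p := m) (Or.inl one_ne_zero)
    rwa [Real.one_rpow] at this
  have hinc : Tendsto (fun x => |W x - W (x - 1)| ^ (p - 1)) atBot (𝓝 0) := by
    have t1 : Tendsto (fun x => W (x - 1)) atBot (𝓝 1) :=
      hWt.comp (tendsto_atBot_add_const_right _ (-1) tendsto_id)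
    have t2 := ((hWt.sub t1).abs).rpow_const (p := p - 1) (Or.inr hp1.le)
    simpa [Real.zero_rpow hp1.ne'] using t2
  have hft : Tendsto (flux m p U) atBot (𝓝 0) := by
    rw [Metric.tendsto_nhds]
    intro ε hε
    obtain ⟨M, hM⟩ := eventually_atBot.1 (hhU.eventually (gt_mem_nhds (half_pos hε)))
    filter_upwards [eventually_le_atBot N, eventually_le_atBot M,
      hinc.eventually (gt_mem_nhds (half_pos hε))] with x hxN hxM hxi
    obtain ⟨t, ht, hte⟩ := exists_deriv_eq_slope W (a := x - 1) (b := x) (by linarith)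
      (fun y hy => (hWd y (hN y (hy.2.trans hxN)).1).continuousAt.continuousWithinAt)
      (fun y hy => (hWd y (hN y (hy.2.le.trans hxN)).1).differentiableAt.differentiableWithinAt)
    have hte' : deriv W t = W x - W (x - 1) := by rw [hte]; simp
    have hmv := (convex_Icc (x - 1) x).image_sub_le_mul_sub_of_deriv_le (f := flux m p U)
      (C := ε / 2)
      (fun y hy => (hfd y (hy.2.trans hxN)).continuousAt.continuousWithinAt)
      (fun y hy => (hfd y ((interior_subset hy).2.trans hxN)).differentiableWithinAt)
      (fun y hy => (hfle y ((interior_subset hy).2.trans hxN)).trans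
        (hM y ((interior_subset hy).2.trans hxM)).le)
      t ⟨ht.1.le, ht.2.le⟩ x ⟨by linarith, le_rfl⟩ ht.2.le
    have e1 : flux m p U t < ε / 2 := by rw [hφ, hte']; exact hxi
    have e2 : ε / 2 * (x - t) ≤ ε / 2 * 1 :=
      mul_le_mul_of_nonneg_left (by linarith [ht.1]) (half_pos hε).le
    rw [Real.dist_eq, sub_zero, abs_of_nonneg (hφ0 x)]
    linarith
  have hW't : Tendsto (deriv W) atBot (𝓝 0) := by
    rw [tendsto_zero_iff_abs_tendsto_zero]
    have t := hft.rpow_const (p := (p - 1)⁻¹) (Or.inr (inv_pos.2 hp1).le)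
    rw [Real.zero_rpow (inv_pos.2 hp1).ne'] at t
    refine t.congr fun x => ?_
    rw [hφ, Real.rpow_rpow_inv (abs_nonneg _) hp1.ne']
    rfl
  have hUα : Tendsto (fun x => U x ^ (-α)) atBot (𝓝 1) := by
    have := hU.tendsto_one.rpow_const (p := -α) (Or.inl one_ne_zero)
    rwa [Real.one_rpow] at this
  have key := hUα.mul hW't
  rw [mul_zero] at key
  refine key.congr' ?_
  filter_upwards [eventually_lt_atBot (0:ℝ)] with x hx
  have hVd : HasDerivAt V (m / (m - α) * (deriv U x * (m - α) * U x ^ (m - α - 1))) x := by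
    rw [hV]
    exact ((hUd x hx).rpow_const (Or.inl (hU.pos x hx).ne')).const_mul _
  rw [hVd.deriv, (hWd x hx).deriv, show m - α - 1 = -α + (m - 1) by ring,
    Real.rpow_add (hU.pos x hx)]
  field_simp
end

section
/- Assume in addition p ≥ 2. Let U be a finite wavefront with speed c > 0 and convection parameter γ ≥ 0. Then there exist constants λ > 0, M > 0 and ξ* < 0 such that 1 > U(ξ) ≥ 1 − M e^{−λ|ξ|} for all ξ ≤ ξ*. -/
open Set Filter Topology

/-- For `p ≥ 2`, a finite wavefront approaches `1` exponentially as `ξ → -∞`. -/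
theorem statement3 (m p a α c γ : ℝ) (h U : ℝ → ℝ)
    (hm : 0 < m) (hp : 1 < p) (hmp : 1 < m * (p - 1)) (hα : α = 1 / (p - 1))
    (hp2 : 2 ≤ p)
    (ha0 : 0 ≤ a) (ha1 : a < 1)
    (hhC1 : ContDiffOn ℝ 1 h (Ici 0))
    (hh0 : h 0 = 0)
    (hhneg : ∀ u ∈ Icc (0 : ℝ) a, h u ≤ 0)
    (hhpos : ∀ u ∈ Ioo a (1 : ℝ), 0 < h u)
    (hhgt : ∀ u : ℝ, 1 < u → h u < 0)
    (hh1 : deriv h 1 < 0)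
    (hc : 0 < c) (hγ : 0 ≤ γ)
    (hU : FiniteWavefront m p h c γ U) :
    ∃ lam > (0 : ℝ), ∃ M > (0 : ℝ), ∃ ξstar < (0 : ℝ), ∀ ξ ≤ ξstar,
      U ξ < 1 ∧ 1 - M * Real.exp (-lam * |ξ|) ≤ U ξ := by
  -- regularity of U
  have hmem : ∀ ξ : ℝ, ξ < 0 → Iio (0:ℝ) ∈ 𝓝 ξ := fun ξ hξ => Iio_mem_nhds hξ
  have dU : ∀ ξ : ℝ, ξ < 0 → DifferentiableAt ℝ U ξ := fun ξ hξ =>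
    (hU.smooth.contDiffAt (hmem ξ hξ)).differentiableAt (by norm_num)
  have ddU : ∀ ξ : ℝ, ξ < 0 → DifferentiableAt ℝ (deriv U) ξ := by
    intro ξ hξ
    have h2 : ContDiffOn ℝ 1 (deriv U) (Iio 0) :=
      hU.smooth.deriv_of_isOpen isOpen_Iio (by norm_num)
    exact (h2.contDiffAt (hmem ξ hξ)).differentiableAt (by norm_num)
  have dneg : ∀ ξ : ℝ, deriv U ξ ≤ 0 := fun ξ => hU.anti.deriv_nonpos
  have hUm : ∀ ξ : ℝ, ξ < 0 →
      HasDerivAt (fun x => U x ^ m) (deriv U ξ * m * U ξ ^ (m - 1)) ξ := fun ξ hξ =>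
    (dU ξ hξ).hasDerivAt.rpow_const (Or.inl (hU.pos ξ hξ).ne')
  set v : ℝ → ℝ := fun ξ => (-deriv U ξ) * m * U ξ ^ (m - 1) with hv
  have hv0 : ∀ ξ : ℝ, ξ < 0 → 0 ≤ v ξ := by
    intro ξ hξ
    have h1 := dneg ξ
    have h2 := Real.rpow_nonneg (hU.pos ξ hξ).le (m - 1)
    exact mul_nonneg (mul_nonneg (by linarith) hm.le) h2
  have hfl : ∀ ξ : ℝ, ξ < 0 → flux m p U ξ = v ξ ^ (p - 1) := by
    intro ξ hξ
    unfold flux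
    rw [(hUm ξ hξ).deriv]
    have : deriv U ξ * m * U ξ ^ (m - 1) = - v ξ := by simp only [hv]; ring
    rw [this, abs_neg, abs_of_nonneg (hv0 ξ hξ)]
  have hfl0 : ∀ ξ : ℝ, 0 ≤ flux m p U ξ := fun ξ => Real.rpow_nonneg (abs_nonneg _) _
  have dfl : ∀ ξ : ℝ, ξ < 0 → DifferentiableAt ℝ (flux m p U) ξ := by
    intro ξ hξ
    have hvd : DifferentiableAt ℝ v ξ :=
      (((ddU ξ hξ).neg).mul_const m).mul
        ((dU ξ hξ).rpow_const (Or.inl (hU.pos ξ hξ).ne'))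
    have h1 : DifferentiableAt ℝ (fun x => v x ^ (p - 1)) ξ :=
      hvd.rpow_const (Or.inr (by linarith))
    refine h1.congr_of_eventuallyEq ?_
    filter_upwards [hmem ξ hξ] with x hx
    exact hfl x hx
  -- behaviour of h near 1
  have dh : HasDerivAt h (deriv h 1) 1 :=
    (differentiableAt_of_deriv_ne_zero hh1.ne).hasDerivAt
  have hch : ContinuousAt h 1 := dh.continuousAt
  have h1 : h 1 = 0 := by
    apply le_antisymm
    · refine le_of_tendsto (hch.tendsto.mono_left (nhdsWithin_le_nhds (s := Ioi 1))) ?_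
      filter_upwards [self_mem_nhdsWithin] with u hu
      exact (hhgt u hu).le
    · refine ge_of_tendsto (hch.tendsto.mono_left (nhdsWithin_le_nhds (s := Iio 1))) ?_
      filter_upwards [Ioo_mem_nhdsLT ha1] with u hu
      exact (hhpos u hu).le
  obtain ⟨k, hk⟩ : ∃ k, k = -deriv h 1 / 2 := ⟨_, rfl⟩
  have hkpos : 0 < k := by rw [hk]; linarith
  have ev1 : ∀ᶠ u in 𝓝 (1:ℝ), u < 1 → k * (1 - u) ≤ h u := by
    have h3 := (hasDerivAt_iff_isLittleO.mp dh).bound hkpos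
    filter_upwards [h3] with u hu hu1
    rw [h1, Real.norm_eq_abs, Real.norm_eq_abs, abs_of_neg (by linarith : u - 1 < 0)] at hu
    have h4 := (abs_le.mp hu).1
    have h5 : deriv h 1 = -2 * k := by rw [hk]; ring
    rw [h5, smul_eq_mul] at h4
    nlinarith
  have ev2 : ∀ᶠ u in 𝓝 (1:ℝ), h u ≤ 1 :=
    hch.eventually_le_const (by rw [h1]; norm_num)
  have ev3 : ∀ᶠ u in 𝓝 (1:ℝ), 1/2 ≤ u := eventually_ge_nhds (by norm_num)
  obtain ⟨x0, hx0⟩ := eventually_atBot.mp (hU.tendsto_one.eventually (ev1.and (ev2.and ev3)))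
  obtain ⟨ξ0, hξ0⟩ : ∃ t, t = min x0 (-1) := ⟨_, rfl⟩
  have hneg : ∀ ξ ≤ ξ0, ξ < 0 := by
    intro ξ hξ
    have := min_le_right x0 (-1)
    linarith
  have hlow : ∀ ξ ≤ ξ0, k * (1 - U ξ) ≤ h (U ξ) := fun ξ hξ =>
    (hx0 ξ (hξ.trans (hξ0 ▸ min_le_left _ _))).1 (hU.lt_one ξ (hneg ξ hξ))
  have hup : ∀ ξ ≤ ξ0, h (U ξ) ≤ 1 := fun ξ hξ =>
    (hx0 ξ (hξ.trans (hξ0 ▸ min_le_left _ _))).2.1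
  have hhalf : ∀ ξ ≤ ξ0, 1/2 ≤ U ξ := fun ξ hξ =>
    (hx0 ξ (hξ.trans (hξ0 ▸ min_le_left _ _))).2.2
  -- flux bound
  have hflb : ∀ ξ ≤ ξ0, flux m p U ξ ≤ 2 := by
    intro ξ hξ
    have hξn := hneg ξ hξ
    obtain ⟨η, hη, hηe⟩ := exists_hasDerivAt_eq_slope (fun x => U x ^ m)
      (fun x => deriv U x * m * U x ^ (m - 1)) (show ξ - 1 < ξ by linarith)
      (fun x hx => (hUm x (lt_of_le_of_lt hx.2 hξn)).continuousAt.continuousWithinAt)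
      (fun x hx => hUm x (hx.2.trans hξn))
    have hηn : η < 0 := hη.2.trans hξn
    have hvη : v η ≤ 1 := by
      have e1 : v η = U (ξ - 1) ^ m - U ξ ^ m := by
        have : v η = -(deriv U η * m * U η ^ (m - 1)) := by simp only [hv]; ring
        rw [this, hηe]; simp
      have e2 : U (ξ - 1) ^ m ≤ 1 := Real.rpow_le_one (hU.pos _ (by linarith)).le
        (hU.lt_one _ (by linarith)).le hm.le
      have e3 : 0 ≤ U ξ ^ m := Real.rpow_nonneg (hU.pos _ hξn).le _
      linarith
    have hfη : flux m p U η ≤ 1 := by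
      rw [hfl η hηn]
      exact Real.rpow_le_one (hv0 η hηn) hvη (by linarith)
    obtain ⟨ζ, hζ, hζe⟩ := exists_deriv_eq_slope (flux m p U) hη.2
      (fun x hx => (dfl x (lt_of_le_of_lt hx.2 hξn)).continuousAt.continuousWithinAt)
      (fun x hx => (dfl x (hx.2.trans hξn)).differentiableWithinAt)
    have e4 := hU.eqn ζ (hζ.2.trans hξn)
    have e5 : deriv (flux m p U) ζ ≤ 1 := by
      have a1 := mul_nonneg hγ (hfl0 ζ)
      have a2 := mul_nonneg hc.le (neg_nonneg.mpr (dneg ζ))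
      have a3 := hup ζ (hζ.2.le.trans hξ)
      linarith
    rw [hζe, div_le_one (by linarith [hη.2])] at e5
    linarith [hη.1]
  have hflv : ∀ ξ ≤ ξ0, flux m p U ξ ≤ 4 * m * 2 * (-deriv U ξ) := by
    intro ξ hξ
    have hξn := hneg ξ hξ
    have b1 : flux m p U ξ ≤ 2 * v ξ := by
      rcases le_total (v ξ) 1 with hle | hge
      · rw [hfl ξ hξn]
        have := Real.rpow_le_rpow_of_exponent_ge_of_imp (hv0 ξ hξn) hle
          (show (1:ℝ) ≤ p - 1 by linarith) (fun _ hz => absurd hz (by linarith))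
        rw [Real.rpow_one] at this
        linarith [hv0 ξ hξn]
      · linarith [hflb ξ hξ]
    have b2 : U ξ ^ (m - 1) ≤ 2 := by
      have c1 : U ξ ^ (m - 1) ≤ U ξ ^ (-1 : ℝ) :=
        Real.rpow_le_rpow_of_exponent_ge (hU.pos ξ hξn) (hU.lt_one ξ hξn).le (by linarith)
      rw [Real.rpow_neg_one] at c1
      have c2 : (U ξ)⁻¹ ≤ 2 := by
        rw [inv_le_comm₀ (hU.pos ξ hξn) (by norm_num)]
        linarith [hhalf ξ hξ]
      linarith
    have b3 : v ξ ≤ (-deriv U ξ) * m * 2 :=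
      mul_le_mul_of_nonneg_left b2 (mul_nonneg (by linarith [dneg ξ]) hm.le)
    have b4 := mul_nonneg hm.le (neg_nonneg.mpr (dneg ξ))
    nlinarith
  obtain ⟨C, hC⟩ : ∃ C, C = 4 * m * 2 := ⟨_, rfl⟩
  rw [← hC] at hflv
  have hCpos : 0 < C := by rw [hC]; positivity
  obtain ⟨B, hB⟩ : ∃ B, B = γ * C + c + 1 := ⟨_, rfl⟩
  have hB1 : 1 ≤ B := by
    have := mul_nonneg hγ hCpos.le
    linarith
  obtain ⟨lam, hlam⟩ : ∃ l, l = min (k / B) (1 / C) := ⟨_, rfl⟩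
  have hlampos : 0 < lam := by
    rw [hlam]; exact lt_min (by positivity) (by positivity)
  have hl1 : lam * B ≤ k := by
    rw [← le_div_iff₀ (by linarith), hlam]; exact min_le_left _ _
  have hl2 : lam * C ≤ 1 := by
    rw [← le_div_iff₀ hCpos, hlam]; exact min_le_right _ _
  set E : ℝ → ℝ := fun ξ => flux m p U ξ + B * (1 - U ξ) with hE
  have hEd : ∀ ξ ≤ ξ0, HasDerivAt E (deriv (flux m p U) ξ + B * (-deriv U ξ)) ξ := by
    intro ξ hξ
    exact (dfl ξ (hneg ξ hξ)).hasDerivAt.add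
      (((dU ξ (hneg ξ hξ)).hasDerivAt.const_sub 1).const_mul B)
  have hEineq : ∀ ξ ≤ ξ0, lam * E ξ ≤ deriv (flux m p U) ξ + B * (-deriv U ξ) := by
    intro ξ hξ
    have q1 := hU.eqn ξ (hneg ξ hξ)
    have q2 := hlow ξ hξ
    have q3 := mul_le_mul_of_nonneg_left (hflv ξ hξ) hγ
    have q4 := mul_le_mul_of_nonneg_left (hflv ξ hξ) hlampos.le
    have q5 := mul_le_mul_of_nonneg_right hl1 (show 0 ≤ 1 - U ξ by
      linarith [hU.lt_one ξ (hneg ξ hξ)])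
    have q6 := mul_le_mul_of_nonneg_right hl2 (neg_nonneg.mpr (dneg ξ))
    have q7 : B * (-deriv U ξ) = γ * (C * -deriv U ξ) - c * deriv U ξ + (-deriv U ξ) := by
      rw [hB]; ring
    simp only [hE]
    rw [q7]
    linarith
  have hGd : ∀ ξ ≤ ξ0, HasDerivAt (fun x => E x * Real.exp (-lam * x))
      ((deriv (flux m p U) ξ + B * (-deriv U ξ)) * Real.exp (-lam * ξ)
        + E ξ * (Real.exp (-lam * ξ) * (-lam * 1))) ξ := fun ξ hξ =>
    (hEd ξ hξ).mul (((hasDerivAt_id ξ).const_mul (-lam)).exp)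
  have hmono : MonotoneOn (fun x => E x * Real.exp (-lam * x)) (Iic ξ0) := by
    apply monotoneOn_of_deriv_nonneg (convex_Iic ξ0)
    · exact fun x hx => (hGd x hx).continuousAt.continuousWithinAt
    · intro x hx
      exact (hGd x (mem_Iic.mp (interior_subset hx))).differentiableAt.differentiableWithinAt
    · intro x hx
      have hx' : x ≤ ξ0 := mem_Iic.mp (interior_subset hx)
      rw [(hGd x hx').deriv]
      have := mul_nonneg (sub_nonneg.mpr (hEineq x hx')) (Real.exp_pos (-lam * x)).le
      linarith
  have hEw : ∀ ξ ≤ ξ0, 1 - U ξ ≤ E ξ := by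
    intro ξ hξ
    have := mul_le_mul_of_nonneg_right hB1 (show 0 ≤ 1 - U ξ by
      linarith [hU.lt_one ξ (hneg ξ hξ)])
    have := hfl0 ξ
    simp only [hE]
    linarith
  have hE0 : 0 < E ξ0 := by
    have := hEw ξ0 le_rfl
    linarith [hU.lt_one ξ0 (hneg ξ0 le_rfl)]
  refine ⟨lam, hlampos, E ξ0 * Real.exp (-lam * ξ0), by positivity, ξ0, hneg ξ0 le_rfl, ?_⟩
  intro ξ hξ
  refine ⟨hU.lt_one ξ (hneg ξ hξ), ?_⟩
  have r1 : E ξ * Real.exp (-lam * ξ) ≤ E ξ0 * Real.exp (-lam * ξ0) :=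
    hmono (show ξ ∈ Iic ξ0 from hξ) (mem_Iic.mpr (le_refl ξ0)) hξ
  have r2 : -lam * |ξ| = -(-lam * ξ) := by rw [abs_of_neg (hneg ξ hξ)]; ring
  have r3 := mul_le_mul_of_nonneg_right r1 (Real.exp_pos (-(-lam * ξ))).le
  have r4 : E ξ * Real.exp (-lam * ξ) * Real.exp (-(-lam * ξ)) = E ξ := by
    rw [mul_assoc, ← Real.exp_add, add_neg_cancel, Real.exp_zero, mul_one]
  rw [r4] at r3
  rw [r2]
  linarith [hEw ξ hξ]
end

section
/- Assume in addition 1 < p < 2 and γ > 0. Let U be a finite wavefront with speed c > 0 and convection parameter γ. Then there exist constants M > 0 and ξ* < 0 such that 1 > U(ξ) ≥ 1 − M γ^{(p−1)/(2−p)} |ξ|^{−(p−1)/(2−p)} for all ξ ≤ ξ*. -/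
open Set Filter Topology

/-- Minimum argument: if `g` has positive derivative wherever it is nonpositive, then to the left of
a nonpositive value the function lies below that value. -/
lemma left_le_of_deriv_pos (g : ℝ → ℝ) (x1 : ℝ) (hc : ContinuousOn g (Iic x1))
    (hd : ∀ z ≤ x1, g z ≤ 0 → ∃ d > 0, HasDerivAt g d z) (x y : ℝ) (hx : x ≤ x1) (hyx : y ≤ x)
    (hgx : g x ≤ 0) : g y ≤ g x := by
  obtain ⟨z, hz, hmin⟩ := (isCompact_Icc (a := y) (b := x)).exists_isMinOn
    ⟨x, hyx, le_rfl⟩ (hc.mono (fun t ht => ht.2.trans hx))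
  have hzx : g z ≤ g x := hmin ⟨hyx, le_rfl⟩
  rcases eq_or_lt_of_le hz.1 with h | h
  · rwa [h]
  · exfalso
    obtain ⟨d, hd0, hd1⟩ := hd z (hz.2.trans hx) (hzx.trans hgx)
    have hs := hd1.tendsto_slope
    have hs' : Tendsto (slope g z) (𝓝[<] z) (𝓝 d) :=
      hs.mono_left (nhdsWithin_mono _ (fun t ht => ne_of_lt ht))
    have e1 := hs'.eventually (lt_mem_nhds hd0)
    have e2 : ∀ᶠ t in 𝓝[<] z, t ∈ Ioo y z := Ioo_mem_nhdsLT h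
    obtain ⟨t, ht1, ht2⟩ := (e1.and e2).exists
    have := hmin (show t ∈ Icc y x from ⟨ht2.1.le, ht2.2.le.trans hz.2⟩)
    simp only [mem_ofPred_eq] at this
    rw [slope_def_field] at ht1
    have h3 : (g t - g z) / (t - z) ≤ 0 :=
      div_nonpos_of_nonneg_of_nonpos (by linarith) (by linarith [ht2.2])
    linarith

/-- Near `u = 1`, `h u` is at least linear in `1 - u`. -/
lemma h_lower (a : ℝ) (h : ℝ → ℝ) (ha1 : a < 1)
    (hhpos : ∀ u ∈ Ioo a (1 : ℝ), 0 < h u)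
    (hhgt : ∀ u : ℝ, 1 < u → h u < 0) (hh1 : deriv h 1 < 0) :
    ∃ κ > 0, ∀ᶠ u in 𝓝[<] (1 : ℝ), κ * (1 - u) ≤ h u := by
  have hd := (differentiableAt_of_deriv_ne_zero hh1.ne).hasDerivAt
  have hcont := hd.continuousAt
  have h1 : h 1 = 0 := by
    apply le_antisymm
    · refine le_of_tendsto (hcont.mono_left nhdsWithin_le_nhds : Tendsto h (𝓝[>] 1) _) ?_
      filter_upwards [self_mem_nhdsWithin] with u hu using (hhgt u hu).le
    · refine ge_of_tendsto (hcont.mono_left nhdsWithin_le_nhds : Tendsto h (𝓝[<] 1) _) ?_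
      filter_upwards [Ioo_mem_nhdsLT ha1] with u hu using (hhpos u hu).le
  refine ⟨-(deriv h 1) / 2, by linarith, ?_⟩
  have hs' : Tendsto (slope h 1) (𝓝[<] 1) (𝓝 (deriv h 1)) :=
      hd.tendsto_slope.mono_left (nhdsWithin_mono _ (fun t ht => ne_of_lt ht))
  filter_upwards [hs'.eventually (gt_mem_nhds (show deriv h 1 < deriv h 1 / 2 by linarith)),
    self_mem_nhdsWithin] with u hu hu1
  simp only [mem_Iio] at hu1
  rw [slope_def_field, h1, sub_zero, div_lt_iff_of_neg (by linarith)] at hu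
  linarith

/-- Basic facts on the flux: continuity, nonnegativity, and its relation to the slope of the profile. -/
lemma flux_facts (m p c γ : ℝ) (h U : ℝ → ℝ) (hp : 1 < p)
    (hU : FiniteWavefront m p h c γ U) (hm : 0 < m) (x : ℝ) (hx : x < 0) :
    HasDerivAt U (deriv U x) x ∧ deriv U x ≤ 0 ∧ ContinuousAt (flux m p U) x ∧
    0 ≤ flux m p U x ∧ (flux m p U x) ^ (1 / (p - 1)) = m * U x ^ (m - 1) * (-deriv U x) := by
  have hopen : IsOpen (Iio (0:ℝ)) := isOpen_Iio
  have hdiff : ∀ y < (0:ℝ), HasDerivAt U (deriv U y) y := fun y hy =>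
    ((hU.smooth.differentiableOn (by norm_num)).differentiableAt (hopen.mem_nhds hy)).hasDerivAt
  have hle : ∀ y, deriv U y ≤ 0 := fun y => hU.anti.deriv_nonpos
  have hfl : ∀ y < (0:ℝ), flux m p U y = (m * U y ^ (m - 1) * (-deriv U y)) ^ (p - 1) := by
    intro y hy
    have h1 := (hdiff y hy).rpow_const (p := m) (Or.inl (hU.pos y hy).ne')
    have : 0 ≤ U y ^ (m - 1) := Real.rpow_nonneg (hU.pos y hy).le _
    have h2 : deriv U y * m * U y ^ (m - 1) ≤ 0 := by
      have := mul_nonneg (mul_nonneg hm.le this) (neg_nonneg.2 (hle y))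
      nlinarith
    rw [flux, h1.deriv, abs_of_nonpos h2]
    congr 1; ring
  have hnn : 0 ≤ m * U x ^ (m - 1) * (-deriv U x) :=
    mul_nonneg (mul_nonneg hm.le (Real.rpow_nonneg (hU.pos x hx).le _)) (neg_nonneg.2 (hle x))
  refine ⟨hdiff x hx, hle x, ?_, ?_, ?_⟩
  · have hdc : ContinuousAt (deriv U) x :=
      (hU.smooth.continuousOn_deriv_of_isOpen hopen (by norm_num)).continuousAt (hopen.mem_nhds hx)
    have : ContinuousAt (fun y => (m * U y ^ (m - 1) * (-deriv U y)) ^ (p - 1)) x := by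
      refine ContinuousAt.rpow_const ?_ (Or.inr (by linarith))
      exact (continuousAt_const.mul (hU.cont.continuousAt.rpow_const
        (Or.inl (hU.pos x hx).ne'))).mul hdc.neg
    refine this.congr ?_
    filter_upwards [hopen.mem_nhds hx] with y hy using (hfl y hy).symm
  · exact Real.rpow_nonneg (abs_nonneg _) _
  · rw [hfl x hx, ← Real.rpow_mul hnn, mul_one_div_cancel (by linarith), Real.rpow_one]

/-- For `1 < p < 2` and `γ > 0`, a finite wavefront approaches `1` in a power-like
manner as `ξ → -∞`. -/
theorem statement4 (m p a α c γ : ℝ) (h U : ℝ → ℝ)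
    (hm : 0 < m) (hp : 1 < p) (hmp : 1 < m * (p - 1)) (hα : α = 1 / (p - 1))
    (hp2 : p < 2)
    (ha0 : 0 ≤ a) (ha1 : a < 1)
    (hhC1 : ContDiffOn ℝ 1 h (Ici 0))
    (hh0 : h 0 = 0)
    (hhneg : ∀ u ∈ Icc (0 : ℝ) a, h u ≤ 0)
    (hhpos : ∀ u ∈ Ioo a (1 : ℝ), 0 < h u)
    (hhgt : ∀ u : ℝ, 1 < u → h u < 0)
    (hh1 : deriv h 1 < 0)
    (hc : 0 < c) (hγ : 0 < γ)
    (hU : FiniteWavefront m p h c γ U) :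
    ∃ M > (0 : ℝ), ∃ ξstar < (0 : ℝ), ∀ ξ ≤ ξstar,
      U ξ < 1 ∧
      1 - M * γ ^ ((p - 1) / (2 - p)) * |ξ| ^ (-((p - 1) / (2 - p))) ≤ U ξ := by
  have hp1 : 0 < p - 1 := by linarith
  have h2p : 0 < 2 - p := by linarith
  have hα1 : 1 < α := by rw [hα, lt_div_iff₀ hp1]; linarith
  have hm1 : 1 < m := by nlinarith
  obtain ⟨κ, hκ, hκe⟩ := h_lower a h ha1 hhpos hhgt hh1
  have hF := flux_facts m p c γ h U hp hU hm
  rw [← hα] at hF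
  have htw : Tendsto U atBot (𝓝[<] 1) := by
    refine tendsto_nhdsWithin_iff.2 ⟨hU.tendsto_one, ?_⟩
    filter_upwards [eventually_lt_atBot (0:ℝ)] with x hx using hU.lt_one x hx
  obtain ⟨ξ1, hξ1⟩ := eventually_atBot.1 ((htw.eventually hκe).and
    ((hU.tendsto_one.eventually (lt_mem_nhds (show (1/2:ℝ) < 1 by norm_num))).and
      (eventually_lt_atBot (0:ℝ))))
  have hξ10 : ξ1 < 0 := (hξ1 ξ1 le_rfl).2.2
  set q : ℝ := (1/2 : ℝ) ^ (m - 1) with hq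
  have hqpos : 0 < q := Real.rpow_pos_of_pos (by norm_num) _
  set K : ℝ := 1 / (m * q) with hK
  have hKpos : 0 < K := by positivity
  set δ : ℝ := min 1 (κ / (2 * (γ + (c + 1) * K))) with hδ
  have hden : 0 < γ + (c + 1) * K := by positivity
  have hδpos : 0 < δ := lt_min one_pos (by positivity)
  have hδ1 : δ ≤ 1 := min_le_left _ _
  have hδ2 : δ * (γ + (c + 1) * K) < κ := by
    have : δ ≤ κ / (2 * (γ + (c + 1) * K)) := min_le_right _ _
    rw [le_div_iff₀ (by positivity)] at this
    nlinarith
  -- lower bound for the flux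
  have key : ∀ x ≤ ξ1, δ * (1 - U x) ≤ flux m p U x := by
    set g : ℝ → ℝ := fun x => flux m p U x - δ * (1 - U x) with hg
    have hgc : ContinuousOn g (Iic ξ1) := by
      intro x hx
      have hx0 : x < 0 := lt_of_le_of_lt hx hξ10
      exact ((hF x hx0).2.2.1.sub (continuousAt_const.mul
        (continuousAt_const.sub hU.cont.continuousAt))).continuousWithinAt
    have hgd : ∀ z ≤ ξ1, g z ≤ 0 → ∃ d > 0, HasDerivAt g d z := by
      intro z hz hgz
      obtain ⟨hh, hhalf, hz0⟩ := hξ1 z hz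
      obtain ⟨hd, hdn, -, hfn, hfe⟩ := hF z hz0
      have hw : 0 < 1 - U z := by linarith [hU.lt_one z hz0]
      have hφ : flux m p U z ≤ δ * (1 - U z) := by simpa [hg] using hgz
      have hφ1 : flux m p U z ≤ 1 := by nlinarith [hU.pos z hz0]
      have hpow : flux m p U z ^ α ≤ flux m p U z := by
        rcases eq_or_lt_of_le hfn with h0 | h0
        · rw [← h0, Real.zero_rpow (by linarith)]
        · simpa using Real.rpow_le_rpow_of_exponent_ge h0 hφ1 hα1.le
      have hUq : q ≤ U z ^ (m - 1) := Real.rpow_le_rpow (by norm_num) hhalf.le (by linarith)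
      have hdU : -deriv U z ≤ K * flux m p U z := by
        rw [hK, one_div_mul_eq_div, le_div_iff₀ (by positivity)]
        have : m * q * (-deriv U z) ≤ m * U z ^ (m - 1) * (-deriv U z) :=
          mul_le_mul_of_nonneg_right (mul_le_mul_of_nonneg_left hUq hm.le) (by linarith)
        linarith
      have he := hU.eqn z hz0
      have hpos : 0 < deriv (flux m p U) z + δ * deriv U z := by
        have h1 : (c + δ) * (-deriv U z) ≤ (c + 1) * (K * (δ * (1 - U z))) := by
          apply mul_le_mul (by linarith) (hdU.trans (mul_le_mul_of_nonneg_left hφ hKpos.le))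
            (by linarith) (by linarith)
        have h2 : γ * flux m p U z ≤ γ * (δ * (1 - U z)) := mul_le_mul_of_nonneg_left hφ hγ.le
        have h3 : δ * (γ + (c + 1) * K) * (1 - U z) < κ * (1 - U z) :=
          mul_lt_mul_of_pos_right hδ2 hw
        linarith
      have hne : deriv (flux m p U) z ≠ 0 := by
        have : δ * deriv U z ≤ 0 := mul_nonpos_of_nonneg_of_nonpos hδpos.le hdn
        intro h0
        linarith
      have hdf := (differentiableAt_of_deriv_ne_zero hne).hasDerivAt
      refine ⟨_, hpos, ?_⟩
      have := hdf.sub ((hd.const_sub 1).const_mul δ)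
      rw [show deriv (flux m p U) z + δ * deriv U z
        = deriv (flux m p U) z - δ * (-deriv U z) by ring]
      exact this
    intro x hx
    by_contra hcon
    push Not at hcon
    have hgx : g x < 0 := by simp only [hg]; linarith
    have hle : ∀ y ≤ x, g y ≤ g x := fun y hy =>
      left_le_of_deriv_pos g ξ1 hgc hgd x y hx hy hgx.le
    have hlim : Tendsto (fun y => -(δ * (1 - U y))) atBot (𝓝 0) := by
      have := ((tendsto_const_nhds (x := (1:ℝ))).sub hU.tendsto_one).const_mul δ |>.neg
      simpa using this
    have : (0:ℝ) ≤ g x := by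
      refine le_of_tendsto hlim ?_
      filter_upwards [eventually_le_atBot x] with y hy
      have h1 := hle y hy
      have h2 := (hF y (lt_of_le_of_lt (hy.trans hx) hξ10)).2.2.2.1
      have h3 : g y = flux m p U y - δ * (1 - U y) := rfl
      linarith
    linarith
  set k : ℝ := δ ^ α / m with hk
  have hkpos : 0 < k := div_pos (Real.rpow_pos_of_pos hδpos _) hm
  have hode : ∀ x ≤ ξ1, k * (1 - U x) ^ α ≤ -deriv U x := by
    intro x hx
    have hx0 : x < 0 := lt_of_le_of_lt hx hξ10
    obtain ⟨hd, hdn, -, hfn, hfe⟩ := hF x hx0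
    have hw : 0 < 1 - U x := by linarith [hU.lt_one x hx0]
    have h1 : (δ * (1 - U x)) ^ α ≤ flux m p U x ^ α :=
      Real.rpow_le_rpow (by positivity) (key x hx) (by linarith)
    rw [Real.mul_rpow hδpos.le hw.le, hfe] at h1
    have h2 : U x ^ (m - 1) ≤ 1 :=
      Real.rpow_le_one (hU.pos x hx0).le (hU.lt_one x hx0).le (by linarith)
    have h3 : m * U x ^ (m - 1) * (-deriv U x) ≤ m * 1 * (-deriv U x) :=
      mul_le_mul_of_nonneg_right (mul_le_mul_of_nonneg_left h2 hm.le) (by linarith)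
    rw [hk, div_mul_eq_mul_div, div_le_iff₀ hm]
    linarith
  set β : ℝ := α - 1 with hβ
  have hβpos : 0 < β := by linarith
  set F : ℝ → ℝ := fun x => (1 - U x) ^ (-β) + β * k * x with hFdef
  have hFd : ∀ x ≤ ξ1, HasDerivAt F (-deriv U x * (-β) * (1 - U x) ^ (-β - 1) + β * k) x := by
    intro x hx
    have hx0 : x < 0 := lt_of_le_of_lt hx hξ10
    have hw : 0 < 1 - U x := by linarith [hU.lt_one x hx0]
    have h1 := ((hF x hx0).1.const_sub 1).rpow_const (p := -β) (Or.inl hw.ne')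
    have h2 := h1.add ((hasDerivAt_id x).const_mul (β * k))
    rw [mul_one] at h2
    exact h2
  have hFanti : AntitoneOn F (Iic ξ1) := by
    apply antitoneOn_of_deriv_nonpos (convex_Iic _)
    · exact fun x hx => (hFd x hx).continuousAt.continuousWithinAt
    · intro x hx
      rw [interior_Iic] at hx
      exact (hFd x (le_of_lt hx)).differentiableAt.differentiableWithinAt
    · intro x hx
      rw [interior_Iic] at hx
      have hx' : x ≤ ξ1 := le_of_lt hx
      have hx0 : x < 0 := lt_of_le_of_lt hx' hξ10
      have hw : 0 < 1 - U x := by linarith [hU.lt_one x hx0]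
      rw [(hFd x hx').deriv]
      have h1 := mul_le_mul_of_nonneg_right (hode x hx')
        (Real.rpow_nonneg hw.le (-β - 1))
      rw [mul_assoc, ← Real.rpow_add hw, show α + (-β - 1) = 0 by rw [hβ]; ring,
        Real.rpow_zero, mul_one] at h1
      nlinarith [mul_le_mul_of_nonneg_left h1 hβpos.le]
  set θ : ℝ := (p - 1) / (2 - p) with hθ
  have hβθ : β * θ = 1 := by
    rw [hβ, hθ, hα]
    field_simp
    ring
  have hθpos : 0 < θ := div_pos hp1 h2p
  set A : ℝ := β * k / 2 with hA
  have hApos : 0 < A := by positivity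
  refine ⟨A ^ (-θ) * γ ^ (-θ), mul_pos (Real.rpow_pos_of_pos hApos _)
    (Real.rpow_pos_of_pos hγ _), 2 * ξ1, by linarith, ?_⟩
  intro x hx
  have hx1 : x ≤ ξ1 := by linarith
  have hx0 : x < 0 := by linarith
  refine ⟨hU.lt_one x hx0, ?_⟩
  have hw : 0 < 1 - U x := by linarith [hU.lt_one x hx0]
  have hw1 : 0 < 1 - U ξ1 := by linarith [hU.lt_one ξ1 hξ10]
  have h1 : F ξ1 ≤ F x := hFanti (show x ∈ Iic ξ1 from hx1) (mem_Iic.2 (le_refl ξ1)) hx1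
  simp only [hFdef] at h1
  have h2 := Real.rpow_pos_of_pos hw1 (-β)
  have habs : |x| = -x := abs_of_neg hx0
  have hxpos : 0 < |x| := abs_pos.2 hx0.ne
  have h3 : A * |x| ≤ (1 - U x) ^ (-β) := by
    rw [habs, hA]
    nlinarith [mul_pos hβpos hkpos]
  have h4 : ((1 - U x) ^ (-β)) ^ (-θ) ≤ (A * |x|) ^ (-θ) :=
    Real.rpow_le_rpow_of_nonpos (by positivity) h3 (by linarith)
  rw [← Real.rpow_mul hw.le, show -β * -θ = 1 by rw [neg_mul_neg, hβθ], Real.rpow_one,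
    Real.mul_rpow hApos.le hxpos.le] at h4
  have h5 : A ^ (-θ) * γ ^ (-θ) * γ ^ θ = A ^ (-θ) := by
    rw [mul_assoc, ← Real.rpow_add hγ, neg_add_cancel, Real.rpow_zero, mul_one]
  rw [h5]
  linarith
end

section
/- Let F₁, F₂ : [a,b] × ℝ → ℝ, and let φ₁, φ₂ : [a,b] → ℝ be differentiable with φ₁'(U) = F₁(U, φ₁(U)) and φ₂'(U) = F₂(U, φ₂(U)) for all U ∈ (a,b). If φ₁(a) > φ₂(a), and either F₁(U, φ₁(U)) > F₂(U, φ₁(U)) for all U ∈ (a,b), or F₁(U, φ₂(U)) > F₂(U, φ₂(U)) for all U ∈ (a,b), then φ₁(U) ≥ φ₂(U) for all U ∈ [a,b]. -/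
open Set Filter Topology

/-- ODE comparison lemma for trajectories in the phase plane: if `φ₁' = F₁(U, φ₁)`,
`φ₂' = F₂(U, φ₂)` on `(a,b)`, `φ₁(a) > φ₂(a)`, and `F₁ > F₂` either along `φ₁` or
along `φ₂`, then `φ₁ ≥ φ₂` on `[a,b]`. -/
theorem statement6 (a b : ℝ) (hab : a < b) (F₁ F₂ : ℝ → ℝ → ℝ) (φ₁ φ₂ : ℝ → ℝ)
    (h₁d : DifferentiableOn ℝ φ₁ (Icc a b))
    (h₂d : DifferentiableOn ℝ φ₂ (Icc a b))
    (h₁ : ∀ U ∈ Ioo a b, HasDerivAt φ₁ (F₁ U (φ₁ U)) U)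
    (h₂ : ∀ U ∈ Ioo a b, HasDerivAt φ₂ (F₂ U (φ₂ U)) U)
    (hinit : φ₂ a < φ₁ a)
    (hF : (∀ U ∈ Ioo a b, F₂ U (φ₁ U) < F₁ U (φ₁ U)) ∨
          (∀ U ∈ Ioo a b, F₂ U (φ₂ U) < F₁ U (φ₂ U))) :
    ∀ U ∈ Icc a b, φ₂ U ≤ φ₁ U := by
  have key : ∀ φ : ℝ → ℝ, DifferentiableOn ℝ φ (Icc a b) → ∀ x ∈ Ico a b,
      HasDerivWithinAt φ (derivWithin φ (Icc a b) x) (Ici x) x := by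
    intro φ hφ x hx
    have h := (hφ x ⟨hx.1, hx.2.le⟩).hasDerivWithinAt
    refine h.mono_of_mem_nhdsWithin ?_
    exact mem_of_superset (Icc_mem_nhdsGE hx.2) (Icc_subset_Icc_left hx.1)
  have main := image_le_of_deriv_right_lt_deriv_boundary' h₂d.continuousOn (key φ₂ h₂d)
    hinit.le h₁d.continuousOn (key φ₁ h₁d) (by
      intro x hx hxe
      have hax : a < x := by
        rcases hx.1.eq_or_lt with h | h
        · subst h
          exact absurd hxe hinit.ne
        · exact h
      have hxo : x ∈ Ioo a b := ⟨hax, hx.2⟩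
      have hu : UniqueDiffWithinAt ℝ (Icc a b) x := uniqueDiffOn_Icc hab x ⟨hx.1, hx.2.le⟩
      rw [(h₁ x hxo).hasDerivWithinAt.derivWithin hu, (h₂ x hxo).hasDerivWithinAt.derivWithin hu]
      rcases hF with h | h
      · rw [hxe]
        exact h x hxo
      · rw [← hxe]
        exact h x hxo)
  intro U hU
  exact main hU
end

section
/- For every c₀, γ₀ > 0 there exist constants k₁, k₂ > 0, depending only on m, p, h, c₀ and γ₀, such that for all c ∈ [0, c₀], all γ ∈ [0, γ₀], every b ∈ (0,1], and every solution φ : (0,b) → (0,∞) of the trajectory equation with limsup_{U→0⁺} φ(U) ≤ k₁/2, one has φ(U) < k₁ + k₂ U for all U ∈ (0,b). -/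
open Set Filter Topology

/-- Right-hand side of the trajectory equation
`φ'(U) = c + γ m U^{m-1} φ^{1-α} - f(U)/φ^α`, where `f(U) = m U^{m-1} h(U)`. -/
noncomputable def trajRHS (m α γ c : ℝ) (h : ℝ → ℝ) (U φU : ℝ) : ℝ :=
  c + γ * m * U ^ (m - 1) * φU ^ (1 - α) - (m * U ^ (m - 1) * h U) / φU ^ α

lemma aux_bounded (m α γ c M b : ℝ) (h φ : ℝ → ℝ) (hm : 0 < m) (hα : 0 < α)
    (hγ : 0 ≤ γ) (hc : 0 ≤ c) (hM : ∀ u ∈ Icc (0 : ℝ) 1, |h u| ≤ M)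
    (hb0 : 0 < b) (hb1 : b ≤ 1)
    (hd : ∀ U ∈ Ioo (0 : ℝ) b, HasDerivAt φ (trajRHS m α γ c h U (φ U)) U) :
    IsBoundedUnder (· ≤ ·) (nhdsWithin 0 (Ioi 0)) φ := by
  have hM0 : 0 ≤ M := (abs_nonneg _).trans (hM 0 (by simp))
  have key : ∀ U ∈ Ioo (0 : ℝ) (b / 2), φ U ≤ max 1 (φ (b / 2)) + (M + 1) := by
    intro U hU
    have hB : ∀ s : ℝ, s < 0 → HasDerivAt
        (fun s : ℝ => max 1 (φ (b / 2)) + (M + 1) * (1 - (-s) ^ m))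
        ((M + 1) * (m * (-s) ^ (m - 1))) s := by
      intro s hs
      have h1 := (Real.hasDerivAt_rpow_const (x := -s) (p := m) (Or.inl (by linarith))).comp s
        (hasDerivAt_neg s)
      have h2 := ((h1.const_sub 1).const_mul (M + 1)).const_add (max 1 (φ (b / 2)))
      refine h2.congr_deriv ?_
      ring
    have hf : ∀ s ∈ Icc (-(b / 2)) (-U), HasDerivAt (fun s => φ (-s))
        (-(trajRHS m α γ c h (-s) (φ (-s)))) s := by
      intro s hs
      have h1 := (hd (-s) ⟨by linarith [hs.2, hU.1], by linarith [hs.1]⟩).comp s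
        (hasDerivAt_neg s)
      refine h1.congr_deriv ?_
      ring
    have hpw : ∀ s ∈ Icc (-(b / 2)) (-U), (-s) ^ m ≤ 1 := fun s hs =>
      Real.rpow_le_one (by linarith [hs.2, hU.1]) (by linarith [hs.1]) hm.le
    have main := image_le_of_deriv_right_lt_deriv_boundary' (a := -(b / 2)) (b := -U)
      (f := fun s => φ (-s)) (f' := fun s => -(trajRHS m α γ c h (-s) (φ (-s))))
      (B := fun s : ℝ => max 1 (φ (b / 2)) + (M + 1) * (1 - (-s) ^ m))
      (B' := fun s => (M + 1) * (m * (-s) ^ (m - 1)))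
      (fun s hs => (hf s hs).continuousAt.continuousWithinAt)
      (fun s hs => (hf s ⟨hs.1, hs.2.le⟩).hasDerivWithinAt)
      (by
        have h1 := hpw (-(b / 2)) ⟨le_rfl, by linarith [hU.2]⟩
        have h2 := le_max_right 1 (φ (b / 2))
        have h3 : 0 ≤ (M + 1) * (1 - (-(-(b / 2))) ^ m) :=
          mul_nonneg (by linarith) (by linarith)
        simp only [neg_neg] at h3 ⊢
        linarith)
      (fun s hs => (hB s (by linarith [hs.2, hU.1])).continuousAt.continuousWithinAt)
      (fun s hs => (hB s (by linarith [hs.2, hU.1])).hasDerivWithinAt)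
      (by
        intro s hs heq
        have h1 := hpw s ⟨hs.1, hs.2.le⟩
        have hs0 : 0 < -s := by linarith [hs.2, hU.1]
        have h3 : 0 ≤ (M + 1) * (1 - (-s) ^ m) := mul_nonneg (by linarith) (by linarith)
        have h4 : 1 ≤ φ (-s) := by
          have := le_max_left 1 (φ (b / 2))
          linarith
        have h5 : 1 ≤ φ (-s) ^ α := Real.one_le_rpow h4 hα.le
        have hp : 0 < m * (-s) ^ (m - 1) := mul_pos hm (Real.rpow_pos_of_pos hs0 _)
        have h6 := abs_le.1 (hM (-s) ⟨hs0.le, by linarith [hs.1]⟩)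
        have h7 : m * (-s) ^ (m - 1) * h (-s) / φ (-s) ^ α ≤ m * (-s) ^ (m - 1) * M := by
          rw [div_le_iff₀ (by linarith)]
          have e1 : m * (-s) ^ (m - 1) * h (-s) ≤ m * (-s) ^ (m - 1) * M :=
            mul_le_mul_of_nonneg_left h6.2 hp.le
          have e2 : 0 ≤ m * (-s) ^ (m - 1) * M := by positivity
          nlinarith
        have h8 : 0 ≤ γ * m * (-s) ^ (m - 1) * φ (-s) ^ (1 - α) := by
          have : 0 < (-s) ^ (m - 1) := Real.rpow_pos_of_pos hs0 _
          have : 0 < φ (-s) ^ (1 - α) := Real.rpow_pos_of_pos (by linarith) _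
          positivity
        simp only [trajRHS]
        nlinarith)
    have h1 := main (x := -U) ⟨by linarith [hU.2], le_rfl⟩
    have h2 : 0 ≤ U ^ m := Real.rpow_nonneg hU.1.le _
    simp only [neg_neg] at h1
    nlinarith
  refine ⟨max 1 (φ (b / 2)) + (M + 1), ?_⟩
  rw [eventually_map]
  filter_upwards [Ioo_mem_nhdsGT (show (0 : ℝ) < b / 2 by linarith)] with U hU using key U hU

/-- Universal linear upper barrier for phase-plane trajectories: for every `c₀, γ₀ > 0`
there are `k₁, k₂ > 0`, depending only on `m, p, h, c₀, γ₀`, such that every positive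
solution of the trajectory equation on `(0,b)` with `limsup_{U→0⁺} φ(U) ≤ k₁/2`
satisfies `φ(U) < k₁ + k₂ U`. -/
theorem statement7 (m p a : ℝ) (α : ℝ) (h : ℝ → ℝ)
    (hm : 0 < m) (hp : 1 < p) (hmp : 1 < m * (p - 1)) (hα : α = 1 / (p - 1))
    (ha0 : 0 ≤ a) (ha1 : a < 1)
    (hhC1 : ContDiffOn ℝ 1 h (Ici 0))
    (hh0 : h 0 = 0)
    (hhneg : ∀ u ∈ Icc (0 : ℝ) a, h u ≤ 0)
    (hhpos : ∀ u ∈ Ioo a (1 : ℝ), 0 < h u)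
    (hhgt : ∀ u : ℝ, 1 < u → h u < 0)
    (hh1 : deriv h 1 < 0)
    (c₀ γ₀ : ℝ) (hc₀ : 0 < c₀) (hγ₀ : 0 < γ₀) :
    ∃ k₁ > (0 : ℝ), ∃ k₂ > (0 : ℝ),
      ∀ c ∈ Icc (0 : ℝ) c₀, ∀ γ ∈ Icc (0 : ℝ) γ₀, ∀ b ∈ Ioc (0 : ℝ) 1,
        ∀ φ : ℝ → ℝ,
          (∀ U ∈ Ioo (0 : ℝ) b, 0 < φ U) →
          (∀ U ∈ Ioo (0 : ℝ) b, HasDerivAt φ (trajRHS m α γ c h U (φ U)) U) →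
          limsup φ (nhdsWithin 0 (Ioi 0)) ≤ k₁ / 2 →
          ∀ U ∈ Ioo (0 : ℝ) b, φ U < k₁ + k₂ * U := by
  have hα0 : 0 < α := by rw [hα]; exact one_div_pos.2 (by linarith)
  obtain ⟨M, hM⟩ := (isCompact_Icc (a := (0 : ℝ)) (b := 1)).exists_bound_of_continuousOn
    (hhC1.continuousOn.mono Icc_subset_Ici_self)
  simp only [Real.norm_eq_abs] at hM
  have hM0 : 0 ≤ M := (abs_nonneg _).trans (hM 0 (by simp))
  obtain ⟨K, hK1, hK2⟩ : ∃ K : ℝ, 16 * (c₀ + 1 + M) ≤ K ∧ 16 * γ₀ ≤ (K / 2) ^ α := by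
    have h1 : Tendsto (fun K : ℝ => (K / 2) ^ α) atTop atTop :=
      (tendsto_rpow_atTop hα0).comp (tendsto_id.atTop_div_const (by norm_num))
    exact ((eventually_ge_atTop _).and (h1.eventually_ge_atTop _)).exists
  refine ⟨K, by linarith, 1, one_pos, ?_⟩
  intro c hc γ hγ b hb φ hpos hd hlim V hV
  have hbdd := aux_bounded m α γ c M b h φ hm hα0 hγ.1 hc.1 hM hb.1 hb.2 hd
  have hev : ∀ᶠ U in nhdsWithin (0 : ℝ) (Ioi 0), φ U < 5 / 8 * K :=
    eventually_lt_of_limsup_lt (lt_of_le_of_lt hlim (by linarith)) hbdd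
  obtain ⟨δ, hδ1, hδ2⟩ := (hev.and (Ioo_mem_nhdsGT hV.1)).exists
  have hB : ∀ s : ℝ, 0 < s → HasDerivAt
      (fun s : ℝ => 5 / 8 * K + ((c₀ + 1) * s + (K / 16 + M) * s ^ m))
      (c₀ + 1 + (K / 16 + M) * (m * s ^ (m - 1))) s := by
    intro s hs
    have h1 := Real.hasDerivAt_rpow_const (x := s) (p := m) (Or.inl hs.ne')
    have h2 := (((hasDerivAt_id s).const_mul (c₀ + 1)).add
      (h1.const_mul (K / 16 + M))).const_add (5 / 8 * K)
    refine h2.congr_deriv ?_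
    ring
  have hBle : ∀ s ∈ Icc δ V, 5 / 8 * K ≤ 5 / 8 * K + ((c₀ + 1) * s + (K / 16 + M) * s ^ m) ∧
      5 / 8 * K + ((c₀ + 1) * s + (K / 16 + M) * s ^ m) ≤ K := by
    intro s hs
    have hs0 : 0 < s := by linarith [hs.1, hδ2.1]
    have hs1 : s ≤ 1 := by linarith [hs.2, hV.2, hb.2]
    have h1 : s ^ m ≤ 1 := Real.rpow_le_one hs0.le hs1 hm.le
    have h2 : 0 < s ^ m := Real.rpow_pos_of_pos hs0 _
    have hK0 : 0 < K := by linarith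
    constructor
    · have : 0 ≤ (c₀ + 1) * s + (K / 16 + M) * s ^ m := by positivity
      linarith
    · have e1 : (c₀ + 1) * s ≤ (c₀ + 1) * 1 := mul_le_mul_of_nonneg_left hs1 (by linarith)
      have e2 : (K / 16 + M) * s ^ m ≤ (K / 16 + M) * 1 :=
        mul_le_mul_of_nonneg_left h1 (by linarith)
      linarith
  have hf : ∀ s ∈ Icc δ V, HasDerivAt φ (trajRHS m α γ c h s (φ s)) s := fun s hs =>
    hd s ⟨by linarith [hs.1, hδ2.1], by linarith [hs.2, hV.2]⟩
  have main := image_le_of_deriv_right_lt_deriv_boundary' (a := δ) (b := V)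
    (f := φ) (f' := fun s => trajRHS m α γ c h s (φ s))
    (B := fun s : ℝ => 5 / 8 * K + ((c₀ + 1) * s + (K / 16 + M) * s ^ m))
    (B' := fun s => c₀ + 1 + (K / 16 + M) * (m * s ^ (m - 1)))
    (fun s hs => (hf s hs).continuousAt.continuousWithinAt)
    (fun s hs => (hf s ⟨hs.1, hs.2.le⟩).hasDerivWithinAt)
    (hδ1.le.trans (hBle δ ⟨le_rfl, hδ2.2.le⟩).1)
    (fun s hs => (hB s (by linarith [hs.1, hδ2.1])).continuousAt.continuousWithinAt)
    (fun s hs => (hB s (by linarith [hs.1, hδ2.1])).hasDerivWithinAt)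
    (by
      intro s hs heq
      have hs0 : 0 < s := by linarith [hs.1, hδ2.1]
      have hs1 : s ≤ 1 := by linarith [hs.2, hV.2, hb.2]
      obtain ⟨b1, b2⟩ := hBle s ⟨hs.1, hs.2.le⟩
      rw [← heq] at b1 b2
      have hφ0 : 0 < φ s := by linarith
      have hpα : 0 < φ s ^ α := Real.rpow_pos_of_pos hφ0 _
      have h5 : 1 ≤ φ s ^ α := Real.one_le_rpow (by linarith) hα0.le
      have h9 : 16 * γ₀ ≤ φ s ^ α :=
        hK2.trans (Real.rpow_le_rpow (by linarith) (by linarith) hα0.le)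
      have hp : 0 < m * s ^ (m - 1) := mul_pos hm (Real.rpow_pos_of_pos hs0 _)
      have h6 := abs_le.1 (hM s ⟨hs0.le, hs1⟩)
      have h7 : -(m * s ^ (m - 1) * M) ≤ m * s ^ (m - 1) * h s / φ s ^ α := by
        rw [le_div_iff₀ hpα]
        have e1 : m * s ^ (m - 1) * (-M) ≤ m * s ^ (m - 1) * h s :=
          mul_le_mul_of_nonneg_left h6.1 hp.le
        have e2 : 0 ≤ m * s ^ (m - 1) * M := by positivity
        nlinarith
      have h8 : γ * φ s ^ (1 - α) ≤ K / 16 := by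
        rw [Real.rpow_sub hφ0, Real.rpow_one, ← mul_div_assoc, div_le_iff₀ hpα]
        have e1 : γ * φ s ≤ γ₀ * K := mul_le_mul hγ.2 b2 hφ0.le hγ₀.le
        have e2 : K / 16 * (16 * γ₀) ≤ K / 16 * φ s ^ α :=
          mul_le_mul_of_nonneg_left h9 (by linarith)
        linarith
      have h10 : γ * m * s ^ (m - 1) * φ s ^ (1 - α) ≤ K / 16 * (m * s ^ (m - 1)) := by
        have := mul_le_mul_of_nonneg_right h8 hp.le
        linarith
      simp only [trajRHS]
      linarith [hc.2])
  have h1 := main (x := V) ⟨hδ2.2.le, le_rfl⟩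
  have h2 := (hBle V ⟨hδ2.2.le, le_rfl⟩).2
  have h3 := hV.1
  linarith
end
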